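/- arXiv:0810.1401 — 6 statements merged into one kernel-verified Lean document; each statement's English description precedes it below -/
import Mathlib

section
/- Let 𝒜 be an abelian category (in which Ext-groups exist, e.g. 𝒜 has enough injectives) and let 𝒳, 𝒴 be classes of objects such that Ext_𝒜^n(X,Y) = 0 for all X ∈ 𝒳, Y ∈ 𝒴 and all n ≥ 0. Suppose 0 → Y₁ → X₁ → M → Y₂ → X₂ → 0 is an exact sequence in 𝒜 with X₁, X₂ ∈ 𝒳 and Y₁, Y₂ ∈ 𝒴. Then for every X ∈ 𝒳 composition with the map X₁ → M induces a bijection Hom_𝒜(X, X₁) → Hom_𝒜(X, M), and for every Y ∈ 𝒴 composition with the map M → Y₂ induces a bijection Hom_𝒜(Y₂, Y) → Hom_𝒜(M, Y). -/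
open CategoryTheory

universe w v u

/-- Lifting along the epimorphism of a short exact sequence. -/
theorem aux_lift {𝒜 : Type u} [Category.{v} 𝒜] [Abelian 𝒜] [HasExt.{w} 𝒜]
    {S : ShortComplex 𝒜} (hS : S.ShortExact) (X : 𝒜)
    (h : Subsingleton (Abelian.Ext X S.X₁ 1)) (a : X ⟶ S.X₃) :
    ∃ b : X ⟶ S.X₂, b ≫ S.g = a := by
  obtain ⟨x, hx⟩ := Abelian.Ext.covariant_sequence_exact₃ X hS (Abelian.Ext.mk₀ a)
    (zero_add 1) (Subsingleton.elim _ _)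
  obtain ⟨b, rfl⟩ := (Abelian.Ext.mk₀_bijective _ _).2 x
  rw [Abelian.Ext.mk₀_comp_mk₀] at hx
  exact ⟨b, (Abelian.Ext.mk₀_bijective _ _).1 hx⟩

/-- Extension along the monomorphism of a short exact sequence. -/
theorem aux_desc {𝒜 : Type u} [Category.{v} 𝒜] [Abelian 𝒜] [HasExt.{w} 𝒜]
    {S : ShortComplex 𝒜} (hS : S.ShortExact) (Y : 𝒜)
    (h : Subsingleton (Abelian.Ext S.X₃ Y 1)) (a : S.X₁ ⟶ Y) :
    ∃ b : S.X₂ ⟶ Y, S.f ≫ b = a := by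
  obtain ⟨x, hx⟩ := Abelian.Ext.contravariant_sequence_exact₁ hS Y (Abelian.Ext.mk₀ a)
    (add_zero 1) (Subsingleton.elim _ _)
  obtain ⟨b, rfl⟩ := (Abelian.Ext.mk₀_bijective _ _).2 x
  rw [Abelian.Ext.mk₀_comp_mk₀] at hx
  exact ⟨b, (Abelian.Ext.mk₀_bijective _ _).1 hx⟩

/-- For an Ext-orthogonal situation, the five-term exact sequence
`0 → Y₁ → X₁ → M → Y₂ → X₂ → 0` induces bijections
`Hom(X, X₁) → Hom(X, M)` for `X ∈ 𝒳` and `Hom(Y₂, Y) → Hom(M, Y)` for `Y ∈ 𝒴`. -/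
theorem five_term_sequence_bijections
    {𝒜 : Type u} [Category.{v} 𝒜] [Abelian 𝒜] [HasExt.{w} 𝒜]
    (𝒳 𝒴 : Set 𝒜)
    (orth : ∀ (X Y : 𝒜), X ∈ 𝒳 → Y ∈ 𝒴 → ∀ (n : ℕ), Subsingleton (Abelian.Ext X Y n))
    {Y₁ X₁ M Y₂ X₂ : 𝒜}
    (f₁ : Y₁ ⟶ X₁) (f₂ : X₁ ⟶ M) (f₃ : M ⟶ Y₂) (f₄ : Y₂ ⟶ X₂)
    (hX₁ : X₁ ∈ 𝒳) (hX₂ : X₂ ∈ 𝒳) (hY₁ : Y₁ ∈ 𝒴) (hY₂ : Y₂ ∈ 𝒴)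
    (hmono : Mono f₁) (hepi : Epi f₄)
    (w₁₂ : f₁ ≫ f₂ = 0) (w₂₃ : f₂ ≫ f₃ = 0) (w₃₄ : f₃ ≫ f₄ = 0)
    (ex₁ : (ShortComplex.mk f₁ f₂ w₁₂).Exact)
    (ex₂ : (ShortComplex.mk f₂ f₃ w₂₃).Exact)
    (ex₃ : (ShortComplex.mk f₃ f₄ w₃₄).Exact) :
    (∀ X ∈ 𝒳, Function.Bijective (fun (g : X ⟶ X₁) => g ≫ f₂)) ∧
    (∀ Y ∈ 𝒴, Function.Bijective (fun (g : Y₂ ⟶ Y) => f₃ ≫ g)) := by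
  have hz : ∀ (X Y : 𝒜), X ∈ 𝒳 → Y ∈ 𝒴 → ∀ g : X ⟶ Y, g = 0 := by
    intro X Y hX hY g
    have := orth X Y hX hY 0
    exact (Abelian.Ext.mk₀_bijective _ _).1 (Subsingleton.elim _ _)
  refine ⟨fun X hX => ⟨fun a b hab => ?_, fun h => ?_⟩,
    fun Y hY => ⟨fun a b hab => ?_, fun h => ?_⟩⟩
  · have h0 : (a - b) ≫ f₂ = 0 := by
      rw [Preadditive.sub_comp]; exact sub_eq_zero.2 hab
    have : Mono (ShortComplex.mk f₁ f₂ w₁₂).f := hmono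
    have hl := ex₁.lift_f (a - b) h0
    rw [hz X Y₁ hX hY₁ (ex₁.lift (a - b) h0), Limits.zero_comp] at hl
    exact sub_eq_zero.1 hl.symm
  · have he : Epi (Limits.kernel.lift f₃ f₂ w₂₃) :=
      (ShortComplex.exact_iff_epi_kernel_lift (ShortComplex.mk f₂ f₃ w₂₃)).1 ex₂
    have hw : f₁ ≫ Limits.kernel.lift f₃ f₂ w₂₃ = 0 := by
      rw [← cancel_mono (Limits.kernel.ι f₃)]; simp [w₁₂]
    have hS : (ShortComplex.mk f₁ (Limits.kernel.lift f₃ f₂ w₂₃) hw).ShortExact :=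
      { exact := by
          let φ : ShortComplex.mk f₁ (Limits.kernel.lift f₃ f₂ w₂₃) hw ⟶
              ShortComplex.mk f₁ f₂ w₁₂ :=
            { τ₁ := 𝟙 _, τ₂ := 𝟙 _, τ₃ := Limits.kernel.ι f₃ }
          have : Epi φ.τ₁ := inferInstanceAs (Epi (𝟙 _))
          have : IsIso φ.τ₂ := inferInstanceAs (IsIso (𝟙 _))
          have : Mono φ.τ₃ := inferInstanceAs (Mono (Limits.kernel.ι f₃))
          exact (ShortComplex.exact_iff_of_epi_of_isIso_of_mono φ).2 ex₁
        mono_f := hmono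
        epi_g := he }
    obtain ⟨b, hb⟩ := aux_lift hS X (orth X Y₁ hX hY₁ 1)
      (Limits.kernel.lift f₃ h (hz X Y₂ hX hY₂ _))
    refine ⟨b, ?_⟩
    have := congrArg (· ≫ Limits.kernel.ι f₃) hb
    simpa using this
  · have h0 : f₃ ≫ (a - b) = 0 := by
      rw [Preadditive.comp_sub]; exact sub_eq_zero.2 hab
    have : Epi (ShortComplex.mk f₃ f₄ w₃₄).g := hepi
    have hl := ex₃.g_desc (a - b) h0
    rw [hz X₂ Y hX₂ hY (ex₃.desc (a - b) h0), Limits.comp_zero] at hl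
    exact sub_eq_zero.1 hl.symm
  · have he : Mono (Limits.cokernel.desc f₂ f₃ w₂₃) :=
      (ShortComplex.exact_iff_mono_cokernel_desc (ShortComplex.mk f₂ f₃ w₂₃)).1 ex₂
    have hw : Limits.cokernel.desc f₂ f₃ w₂₃ ≫ f₄ = 0 := by
      rw [← cancel_epi (Limits.cokernel.π f₂)]; simp [w₃₄]
    have hS : (ShortComplex.mk (Limits.cokernel.desc f₂ f₃ w₂₃) f₄ hw).ShortExact :=
      { exact := by
          let φ : ShortComplex.mk f₃ f₄ w₃₄ ⟶
              ShortComplex.mk (Limits.cokernel.desc f₂ f₃ w₂₃) f₄ hw :=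
            { τ₁ := Limits.cokernel.π f₂, τ₂ := 𝟙 _, τ₃ := 𝟙 _ }
          have : Epi φ.τ₁ := inferInstanceAs (Epi (Limits.cokernel.π f₂))
          have : IsIso φ.τ₂ := inferInstanceAs (IsIso (𝟙 _))
          have : Mono φ.τ₃ := inferInstanceAs (Mono (𝟙 _))
          exact (ShortComplex.exact_iff_of_epi_of_isIso_of_mono φ).1 ex₃
        mono_f := he
        epi_g := hepi }
    obtain ⟨b, hb⟩ := aux_desc hS Y (orth X₂ Y hX₂ hY 1)
      (Limits.cokernel.desc f₂ h (hz X₁ Y hX₁ hY _))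
    refine ⟨b, ?_⟩
    have := congrArg (Limits.cokernel.π f₂ ≫ ·) hb
    simpa using this
end

section
/- Let 𝒜 be an abelian category (in which Ext-groups exist, e.g. 𝒜 has enough injectives) and let 𝒳, 𝒴 be classes of objects such that Ext_𝒜^n(X,Y) = 0 for all X ∈ 𝒳, Y ∈ 𝒴 and all n ≥ 0. Suppose 0 → Y₁ → X₁ → M → Y₂ → X₂ → 0 and 0 → Y₁' → X₁' → M → Y₂' → X₂' → 0 are exact sequences in 𝒜 with X₁, X₂, X₁', X₂' ∈ 𝒳 and Y₁, Y₂, Y₁', Y₂' ∈ 𝒴. Then there exist unique isomorphisms Y₁ → Y₁', X₁ → X₁', Y₂ → Y₂', X₂ → X₂' which, together with the identity on M, form an isomorphism of the two exact sequences (i.e. all four squares of the resulting ladder diagram commute). -/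
open CategoryTheory

universe w v u

open CategoryTheory.Limits

lemma fts_hom_zero {𝒜 : Type u} [Category.{v} 𝒜] [Abelian 𝒜] [HasExt.{w} 𝒜]
    {X Y : 𝒜} (h : Subsingleton (Abelian.Ext X Y 0)) (f : X ⟶ Y) : f = 0 :=
  Abelian.Ext.mk₀_bijective X Y |>.1 (Subsingleton.elim _ _)

lemma fts_lift {𝒜 : Type u} [Category.{v} 𝒜] [Abelian 𝒜] [HasExt.{w} 𝒜]
    {X Y₁ X₁ M Y₂ : 𝒜} (f₁ : Y₁ ⟶ X₁) (f₂ : X₁ ⟶ M) (f₃ : M ⟶ Y₂) [Mono f₁]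
    (w₁₂ : f₁ ≫ f₂ = 0) (w₂₃ : f₂ ≫ f₃ = 0)
    (ex₁ : (ShortComplex.mk f₁ f₂ w₁₂).Exact)
    (ex₂ : (ShortComplex.mk f₂ f₃ w₂₃).Exact)
    (hX : Subsingleton (Abelian.Ext X Y₁ 1)) (h : X ⟶ M) (hh : h ≫ f₃ = 0) :
    ∃ p : X ⟶ X₁, p ≫ f₂ = h := by
  have z : f₁ ≫ kernel.lift f₃ f₂ w₂₃ = 0 := by
    rw [← cancel_mono (kernel.ι f₃)]; simp [w₁₂]
  have hS : (ShortComplex.mk f₁ (kernel.lift f₃ f₂ w₂₃) z).ShortExact :=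
    { exact := by
        let φ : ShortComplex.mk f₁ (kernel.lift f₃ f₂ w₂₃) z ⟶ ShortComplex.mk f₁ f₂ w₁₂ :=
          { τ₁ := 𝟙 _, τ₂ := 𝟙 _, τ₃ := kernel.ι f₃ }
        have : Epi φ.τ₁ := by dsimp [φ]; infer_instance
        have : IsIso φ.τ₂ := by dsimp [φ]; infer_instance
        have : Mono φ.τ₃ := by dsimp [φ]; infer_instance
        exact (ShortComplex.exact_iff_of_epi_of_isIso_of_mono φ).2 ex₁
      mono_f := by dsimp; infer_instance
      epi_g := ex₂.epi_kernelLift }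
  obtain ⟨x, hx⟩ := Abelian.Ext.covariant_sequence_exact₃ X hS
    (Abelian.Ext.mk₀ (kernel.lift f₃ h hh)) (n₁ := 1) rfl
    (hX.elim _ _)
  obtain ⟨p, rfl⟩ := (Abelian.Ext.mk₀_bijective _ _).2 x
  rw [Abelian.Ext.mk₀_comp_mk₀] at hx
  have := (Abelian.Ext.mk₀_bijective _ _).1 hx
  refine ⟨p, ?_⟩
  have := congrArg (· ≫ kernel.ι f₃) this
  simpa using this

lemma fts_extend {𝒜 : Type u} [Category.{v} 𝒜] [Abelian 𝒜] [HasExt.{w} 𝒜]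
    {Y X₁ M Y₂ X₂ : 𝒜} (f₂ : X₁ ⟶ M) (f₃ : M ⟶ Y₂) (f₄ : Y₂ ⟶ X₂) [Epi f₄]
    (w₂₃ : f₂ ≫ f₃ = 0) (w₃₄ : f₃ ≫ f₄ = 0)
    (ex₂ : (ShortComplex.mk f₂ f₃ w₂₃).Exact)
    (ex₃ : (ShortComplex.mk f₃ f₄ w₃₄).Exact)
    (hX : Subsingleton (Abelian.Ext X₂ Y 1)) (h : M ⟶ Y) (hh : f₂ ≫ h = 0) :
    ∃ p : Y₂ ⟶ Y, f₃ ≫ p = h := by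
  have z : cokernel.desc f₂ f₃ w₂₃ ≫ f₄ = 0 := by
    rw [← cancel_epi (cokernel.π f₂)]; simp [w₃₄]
  have hS : (ShortComplex.mk (cokernel.desc f₂ f₃ w₂₃) f₄ z).ShortExact :=
    { exact := by
        let φ : ShortComplex.mk f₃ f₄ w₃₄ ⟶ ShortComplex.mk (cokernel.desc f₂ f₃ w₂₃) f₄ z :=
          { τ₁ := cokernel.π f₂, τ₂ := 𝟙 _, τ₃ := 𝟙 _ }
        have : Epi φ.τ₁ := by dsimp [φ]; infer_instance
        have : IsIso φ.τ₂ := by dsimp [φ]; infer_instance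
        have : Mono φ.τ₃ := by dsimp [φ]; infer_instance
        exact (ShortComplex.exact_iff_of_epi_of_isIso_of_mono φ).1 ex₃
      mono_f := ex₂.mono_cokernelDesc
      epi_g := by dsimp; infer_instance }
  obtain ⟨x, hx⟩ := Abelian.Ext.contravariant_sequence_exact₁ hS Y
    (Abelian.Ext.mk₀ (cokernel.desc f₂ h hh)) (n₁ := 1) rfl
    (hX.elim _ _)
  obtain ⟨p, rfl⟩ := (Abelian.Ext.mk₀_bijective _ _).2 x
  rw [Abelian.Ext.mk₀_comp_mk₀] at hx
  have := (Abelian.Ext.mk₀_bijective _ _).1 hx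
  refine ⟨p, ?_⟩
  have := congrArg (cokernel.π f₂ ≫ ·) this
  simpa using this

lemma fts_uniq_left {𝒜 : Type u} [Category.{v} 𝒜] [Abelian 𝒜] [HasExt.{w} 𝒜]
    {X Y₁ X₁ M : 𝒜} (f₁ : Y₁ ⟶ X₁) (f₂ : X₁ ⟶ M) [Mono f₁]
    (w₁₂ : f₁ ≫ f₂ = 0) (ex₁ : (ShortComplex.mk f₁ f₂ w₁₂).Exact)
    (hX : Subsingleton (Abelian.Ext X Y₁ 0)) {p q : X ⟶ X₁} (h : p ≫ f₂ = q ≫ f₂) :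
    p = q := by
  have : Mono (ShortComplex.mk f₁ f₂ w₁₂).f := by dsimp; infer_instance
  have e := ex₁.lift_f (p - q) (by simp [h])
  rw [fts_hom_zero hX (ex₁.lift (p - q) (by simp [h]))] at e
  exact sub_eq_zero.1 (by simpa using e.symm)

lemma fts_uniq_right {𝒜 : Type u} [Category.{v} 𝒜] [Abelian 𝒜] [HasExt.{w} 𝒜]
    {Y M Y₂ X₂ : 𝒜} (f₃ : M ⟶ Y₂) (f₄ : Y₂ ⟶ X₂) [Epi f₄]
    (w₃₄ : f₃ ≫ f₄ = 0) (ex₃ : (ShortComplex.mk f₃ f₄ w₃₄).Exact)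
    (hX : Subsingleton (Abelian.Ext X₂ Y 0)) {p q : Y₂ ⟶ Y} (h : f₃ ≫ p = f₃ ≫ q) :
    p = q := by
  have : Epi (ShortComplex.mk f₃ f₄ w₃₄).g := by dsimp; infer_instance
  have e := ex₃.g_desc (p - q) (by simp [h])
  rw [fts_hom_zero hX (ex₃.desc (p - q) (by simp [h]))] at e
  exact sub_eq_zero.1 (by simpa using e.symm)

lemma fts_ker_iso {𝒜 : Type u} [Category.{v} 𝒜] [Abelian 𝒜]
    {Y₁ X₁ M Y₁' X₁' : 𝒜} (f₁ : Y₁ ⟶ X₁) (f₂ : X₁ ⟶ M) [Mono f₁]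
    (w₁₂ : f₁ ≫ f₂ = 0) (ex₁ : (ShortComplex.mk f₁ f₂ w₁₂).Exact)
    (g₁ : Y₁' ⟶ X₁') (g₂ : X₁' ⟶ M) [Mono g₁]
    (w₁₂' : g₁ ≫ g₂ = 0) (ex₁' : (ShortComplex.mk g₁ g₂ w₁₂').Exact)
    (e : X₁ ≅ X₁') (he : e.hom ≫ g₂ = f₂) :
    ∃ d : Y₁ ≅ Y₁', f₁ ≫ e.hom = d.hom ≫ g₁ := by
  have : Mono (ShortComplex.mk f₁ f₂ w₁₂).f := by dsimp; infer_instance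
  have : Mono (ShortComplex.mk g₁ g₂ w₁₂').f := by dsimp; infer_instance
  have he' : e.inv ≫ f₂ = g₂ := by simp [← he]
  obtain ⟨a, ha⟩ : ∃ a : Y₁ ⟶ Y₁', a ≫ g₁ = f₁ ≫ e.hom :=
    ⟨_, ex₁'.lift_f (f₁ ≫ e.hom) (by simp [he, w₁₂])⟩
  obtain ⟨b, hb⟩ : ∃ b : Y₁' ⟶ Y₁, b ≫ f₁ = g₁ ≫ e.inv :=
    ⟨_, ex₁.lift_f (g₁ ≫ e.inv) (by simp [he', w₁₂'])⟩
  refine ⟨⟨a, b, ?_, ?_⟩, ha.symm⟩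
  · rw [← cancel_mono f₁, Category.assoc, hb, reassoc_of% ha]; simp
  · rw [← cancel_mono g₁, Category.assoc, ha, reassoc_of% hb]; simp

lemma fts_coker_iso {𝒜 : Type u} [Category.{v} 𝒜] [Abelian 𝒜]
    {M Y₂ X₂ Y₂' X₂' : 𝒜} (f₃ : M ⟶ Y₂) (f₄ : Y₂ ⟶ X₂) [Epi f₄]
    (w₃₄ : f₃ ≫ f₄ = 0) (ex₃ : (ShortComplex.mk f₃ f₄ w₃₄).Exact)
    (g₃ : M ⟶ Y₂') (g₄ : Y₂' ⟶ X₂') [Epi g₄]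
    (w₃₄' : g₃ ≫ g₄ = 0) (ex₃' : (ShortComplex.mk g₃ g₄ w₃₄').Exact)
    (e : Y₂ ≅ Y₂') (he : f₃ ≫ e.hom = g₃) :
    ∃ d : X₂ ≅ X₂', f₄ ≫ d.hom = e.hom ≫ g₄ := by
  have : Epi (ShortComplex.mk f₃ f₄ w₃₄).g := by dsimp; infer_instance
  have : Epi (ShortComplex.mk g₃ g₄ w₃₄').g := by dsimp; infer_instance
  have he' : g₃ ≫ e.inv = f₃ := by simp [← he]
  obtain ⟨a, ha⟩ : ∃ a : X₂ ⟶ X₂', f₄ ≫ a = e.hom ≫ g₄ :=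
    ⟨_, ex₃.g_desc (e.hom ≫ g₄) (by simp [reassoc_of% he, w₃₄'])⟩
  obtain ⟨b, hb⟩ : ∃ b : X₂' ⟶ X₂, g₄ ≫ b = e.inv ≫ f₄ :=
    ⟨_, ex₃'.g_desc (e.inv ≫ f₄) (by simp [reassoc_of% he', w₃₄])⟩
  refine ⟨⟨a, b, ?_, ?_⟩, ha⟩
  · rw [← cancel_epi f₄, reassoc_of% ha, hb]; simp
  · rw [← cancel_epi g₄, reassoc_of% hb, ha]; simp

/-- Uniqueness of the five-term exact sequence attached to an object `M`
with respect to an Ext-orthogonal situation: any two such sequences are uniquely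
isomorphic via an isomorphism inducing the identity on `M`. -/
theorem five_term_sequence_uniqueness
    {𝒜 : Type u} [Category.{v} 𝒜] [Abelian 𝒜] [HasExt.{w} 𝒜]
    (𝒳 𝒴 : Set 𝒜)
    (orth : ∀ (X Y : 𝒜), X ∈ 𝒳 → Y ∈ 𝒴 → ∀ (n : ℕ), Subsingleton (Abelian.Ext X Y n))
    {Y₁ X₁ M Y₂ X₂ : 𝒜}
    (f₁ : Y₁ ⟶ X₁) (f₂ : X₁ ⟶ M) (f₃ : M ⟶ Y₂) (f₄ : Y₂ ⟶ X₂)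
    (hX₁ : X₁ ∈ 𝒳) (hX₂ : X₂ ∈ 𝒳) (hY₁ : Y₁ ∈ 𝒴) (hY₂ : Y₂ ∈ 𝒴)
    (hmono : Mono f₁) (hepi : Epi f₄)
    (w₁₂ : f₁ ≫ f₂ = 0) (w₂₃ : f₂ ≫ f₃ = 0) (w₃₄ : f₃ ≫ f₄ = 0)
    (ex₁ : (ShortComplex.mk f₁ f₂ w₁₂).Exact)
    (ex₂ : (ShortComplex.mk f₂ f₃ w₂₃).Exact)
    (ex₃ : (ShortComplex.mk f₃ f₄ w₃₄).Exact)
    {Y₁' X₁' Y₂' X₂' : 𝒜}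
    (g₁ : Y₁' ⟶ X₁') (g₂ : X₁' ⟶ M) (g₃ : M ⟶ Y₂') (g₄ : Y₂' ⟶ X₂')
    (hX₁' : X₁' ∈ 𝒳) (hX₂' : X₂' ∈ 𝒳) (hY₁' : Y₁' ∈ 𝒴) (hY₂' : Y₂' ∈ 𝒴)
    (hmono' : Mono g₁) (hepi' : Epi g₄)
    (w₁₂' : g₁ ≫ g₂ = 0) (w₂₃' : g₂ ≫ g₃ = 0) (w₃₄' : g₃ ≫ g₄ = 0)
    (ex₁' : (ShortComplex.mk g₁ g₂ w₁₂').Exact)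
    (ex₂' : (ShortComplex.mk g₂ g₃ w₂₃').Exact)
    (ex₃' : (ShortComplex.mk g₃ g₄ w₃₄').Exact) :
    ∃! e : (Y₁ ≅ Y₁') × (X₁ ≅ X₁') × (Y₂ ≅ Y₂') × (X₂ ≅ X₂'),
      f₁ ≫ e.2.1.hom = e.1.hom ≫ g₁ ∧
      e.2.1.hom ≫ g₂ = f₂ ∧
      f₃ ≫ e.2.2.1.hom = g₃ ∧
      f₄ ≫ e.2.2.2.hom = e.2.2.1.hom ≫ g₄ := by
  obtain ⟨p, hp⟩ := fts_lift g₁ g₂ g₃ w₁₂' w₂₃' ex₁' ex₂' (orth _ _ hX₁ hY₁' 1) f₂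
    (fts_hom_zero (orth _ _ hX₁ hY₂' 0) _)
  obtain ⟨p', hp'⟩ := fts_lift f₁ f₂ f₃ w₁₂ w₂₃ ex₁ ex₂ (orth _ _ hX₁' hY₁ 1) g₂
    (fts_hom_zero (orth _ _ hX₁' hY₂ 0) _)
  obtain ⟨q, hq⟩ := fts_extend f₂ f₃ f₄ w₂₃ w₃₄ ex₂ ex₃ (orth _ _ hX₂ hY₂' 1) g₃
    (fts_hom_zero (orth _ _ hX₁ hY₂' 0) _)
  obtain ⟨q', hq'⟩ := fts_extend g₂ g₃ g₄ w₂₃' w₃₄' ex₂' ex₃' (orth _ _ hX₂' hY₂ 1) f₃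
    (fts_hom_zero (orth _ _ hX₁' hY₂ 0) _)
  let eX : X₁ ≅ X₁' :=
    { hom := p
      inv := p'
      hom_inv_id := fts_uniq_left f₁ f₂ w₁₂ ex₁ (orth _ _ hX₁ hY₁ 0) (by simp [hp, hp'])
      inv_hom_id := fts_uniq_left g₁ g₂ w₁₂' ex₁' (orth _ _ hX₁' hY₁' 0) (by simp [hp, hp']) }
  let eY : Y₂ ≅ Y₂' :=
    { hom := q
      inv := q'
      hom_inv_id := fts_uniq_right f₃ f₄ w₃₄ ex₃ (orth _ _ hX₂ hY₂ 0)
        (by simp [reassoc_of% hq, hq'])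
      inv_hom_id := fts_uniq_right g₃ g₄ w₃₄' ex₃' (orth _ _ hX₂' hY₂' 0)
        (by simp [reassoc_of% hq', hq]) }
  obtain ⟨d, hd⟩ := fts_ker_iso f₁ f₂ w₁₂ ex₁ g₁ g₂ w₁₂' ex₁' eX hp
  obtain ⟨c, hc⟩ := fts_coker_iso f₃ f₄ w₃₄ ex₃ g₃ g₄ w₃₄' ex₃' eY hq
  refine ⟨(d, eX, eY, c), ⟨hd, hp, hq, hc⟩, ?_⟩
  rintro ⟨d', eX', eY', c'⟩ ⟨h1, h2, h3, h4⟩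
  dsimp only at h1 h2 h3 h4
  obtain rfl : eX' = eX := Iso.ext
    (fts_uniq_left g₁ g₂ w₁₂' ex₁' (orth _ _ hX₁ hY₁' 0) (h2.trans hp.symm))
  obtain rfl : eY' = eY := Iso.ext
    (fts_uniq_right f₃ f₄ w₃₄ ex₃ (orth _ _ hX₂ hY₂' 0) (h3.trans hq.symm))
  obtain rfl : d' = d := Iso.ext (by rw [← cancel_mono g₁, ← h1, hd])
  obtain rfl : c' = c := Iso.ext (by rw [← cancel_epi f₄, h4, hc])
  rfl
end

section
/- Let 𝒞 be a hereditary Grothendieck abelian category, i.e. Grothendieck abelian with Ext_𝒞^n(M,N) = 0 for all objects M, N and all n ≥ 2, and let X₀ be an object of 𝒞. Let 𝒴 = {Y : Ext_𝒞^n(X₀, Y) = 0 for all n ≥ 0}, and let 𝒳 be the smallest isomorphism-closed class of objects of 𝒞 that contains X₀ and is closed under kernels, cokernels, extensions and arbitrary coproducts. Then: (a) 𝒳 = {X : Ext_𝒞^n(X,Y) = 0 for all Y ∈ 𝒴 and all n ≥ 0}; (b) every object M of 𝒞 admits an exact sequence 0 → Y_M → X_M → M → Y^M → X^M → 0 with X_M,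 X^M ∈ 𝒳 and Y_M, Y^M ∈ 𝒴; moreover this sequence induces, by composition, bijections Hom_𝒞(X, X_M) → Hom_𝒞(X, M) and Hom_𝒞(Y^M, Y) → Hom_𝒞(M, Y) for all X ∈ 𝒳 and Y ∈ 𝒴. -/
open CategoryTheory CategoryTheory.Limits

universe w v u

/-- A class of objects of an abelian category with coproducts is "closed" if it is closed
under isomorphisms, kernels, cokernels, extensions and arbitrary coproducts. -/
def IsClosedClass {C : Type u} [Category.{v} C] [Abelian C]
    [HasColimitsOfSize.{v, v} C] (S : Set C) : Prop :=
  (∀ (X Y : C), X ∈ S → (X ≅ Y) → Y ∈ S) ∧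
  (∀ {X Y : C} (f : X ⟶ Y), X ∈ S → Y ∈ S → kernel f ∈ S) ∧
  (∀ {X Y : C} (f : X ⟶ Y), X ∈ S → Y ∈ S → cokernel f ∈ S) ∧
  (∀ (E : ShortComplex C), E.ShortExact → E.X₁ ∈ S → E.X₃ ∈ S → E.X₂ ∈ S) ∧
  (∀ (ι : Type v) (g : ι → C), (∀ i, g i ∈ S) → (∐ g) ∈ S)


namespace ExtPair

open MorphismProperty ZeroObject

set_option linter.unusedSectionVars false

section Closed

variable {C : Type u} [Category.{v} C] [Abelian C] [HasColimitsOfSize.{v, v} C]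

lemma colimit_mem {S : Set C} (hS : IsClosedClass S) {J : Type v} [SmallCategory J]
    (D : J ⥤ C) (c : Cocone D) (hc : IsColimit c) (h : ∀ j, D.obj j ∈ S) : c.pt ∈ S := by
  refine hS.1 _ _ ?_
    ((colimitCoconeOfCoequalizerAndCoproduct D).isColimit.coconePointUniqueUpToIso hc)
  have key : ∀ {A B : C} (f g : A ⟶ B), A ∈ S → B ∈ S → coequalizer f g ∈ S := by
    intro A B f g hA hB
    refine hS.1 (cokernel (f - g)) _ (hS.2.2.1 (f - g) hA hB) ?_
    exact
      { hom := cokernel.desc _ (coequalizer.π f g) (by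
          rw [Preadditive.sub_comp, coequalizer.condition, sub_self])
        inv := coequalizer.desc (cokernel.π (f - g)) (by
          rw [← sub_eq_zero, ← Preadditive.sub_comp, cokernel.condition]) }
  exact key _ _ (hS.2.2.2.2 _ _ (fun p => h _)) (hS.2.2.2.2 _ _ (fun p => h _))

/-- Monomorphisms whose cokernel lies in a given class of objects. -/
def W (S : Set C) : MorphismProperty C := fun _ _ f => Mono f ∧ cokernel f ∈ S

lemma W_respectsIso {S : Set C} (hS : IsClosedClass S) : (W S).RespectsIso := by
  refine RespectsIso.of_respects_arrow_iso _ ?_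
  rintro f g e ⟨h1, h2⟩
  refine ⟨((monomorphisms C).arrow_mk_iso_iff e).1 h1, ?_⟩
  exact hS.1 _ _ h2 (cokernel.mapIso f.hom g.hom (Arrow.leftFunc.mapIso e)
    (Arrow.rightFunc.mapIso e) e.hom.w.symm)

lemma zero_mem {S : Set C} (hS : IsClosedClass S) {Z : C} (hZ : IsZero Z) : Z ∈ S := by
  have := hS.2.2.2.2 PEmpty (fun x => x.elim) (fun x => x.elim)
  refine hS.1 _ _ this (IsZero.iso ?_ hZ)
  rw [IsZero.iff_id_eq_zero]
  ext x
  exact x.elim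

lemma comp_shortExact {A B D : C} (f : A ⟶ B) (g : B ⟶ D) [Mono g] :
    (ShortComplex.mk (cokernel.map f (f ≫ g) (𝟙 _) g (by simp))
      (cokernel.map (f ≫ g) g f (𝟙 _) (by simp)) (by
        rw [← cancel_epi (cokernel.π f)]; simp)).ShortExact := by
  have hmono : Mono (cokernel.map f (f ≫ g) (𝟙 _) g (by simp)) := by
    refine Preadditive.mono_of_cancel_zero _ ?_
    intro T y hy
    obtain ⟨T₁, π₁, _, y₁, hy₁⟩ := surjective_up_to_refinements_of_epi (cokernel.π f) y
    have h1 : (y₁ ≫ g) ≫ cokernel.π (f ≫ g) = 0 := by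
      have := hy₁ =≫ cokernel.map f (f ≫ g) (𝟙 _) g (by simp)
      simp only [Category.assoc, hy, comp_zero, cokernel.π_desc] at this
      simpa using this.symm
    have hex : (ShortComplex.mk (f ≫ g) (cokernel.π (f ≫ g)) (by simp)).Exact :=
      ShortComplex.exact_cokernel _
    obtain ⟨T₂, π₂, _, a, ha⟩ := hex.exact_up_to_refinements (y₁ ≫ g) h1
    dsimp at a ha
    have h2 : π₂ ≫ y₁ = a ≫ f := by
      rw [← cancel_mono g]; simpa using ha
    rw [← cancel_epi π₁, ← cancel_epi π₂, hy₁, reassoc_of% h2]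
    simp
  have hepi : Epi (cokernel.map (f ≫ g) g f (𝟙 _) (by simp)) := by
    have : Epi (cokernel.π (f ≫ g) ≫ cokernel.map (f ≫ g) g f (𝟙 _) (by simp)) := by
      simp only [cokernel.π_desc]; infer_instance
    exact epi_of_epi (cokernel.π (f ≫ g)) _
  refine { exact := ?_, mono_f := hmono, epi_g := hepi }
  rw [ShortComplex.exact_iff_exact_up_to_refinements]
  intro T x hx
  dsimp at x hx ⊢
  obtain ⟨T₁, π₁, _, d, hd⟩ := surjective_up_to_refinements_of_epi (cokernel.π (f ≫ g)) x
  have h1 : d ≫ cokernel.π g = 0 := by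
    have := hd =≫ cokernel.map (f ≫ g) g f (𝟙 _) (by simp)
    simp only [Category.assoc, hx, comp_zero, cokernel.π_desc] at this
    simpa using this.symm
  have hex : (ShortComplex.mk g (cokernel.π g) (by simp)).Exact :=
      ShortComplex.exact_cokernel _
  obtain ⟨T₂, π₂, _, b, hb⟩ := hex.exact_up_to_refinements d h1
  dsimp at b hb
  refine ⟨T₂, π₂ ≫ π₁, inferInstance, b ≫ cokernel.π f, ?_⟩
  simp [hd, reassoc_of% hb]

lemma W_isMultiplicative {S : Set C} (hS : IsClosedClass S) : (W S).IsMultiplicative where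
  id_mem X := ⟨inferInstance, zero_mem hS (isZero_cokernel_of_epi _)⟩
  comp_mem f g hf hg := by
    have := hf.1
    have := hg.1
    exact ⟨mono_comp _ _, hS.2.2.2.1 _ (comp_shortExact f g) hf.2 hg.2⟩

lemma W_cobaseChange {S : Set C} (hS : IsClosedClass S) : (W S).IsStableUnderCobaseChange where
  of_isPushout {A A' B B' f g f' g'} sq hf := by
    refine ⟨(monomorphisms C).of_isPushout sq hf.1, ?_⟩
    refine hS.1 _ _ hf.2 ?_
    exact
      { hom := cokernel.map _ _ _ _ sq.w.symm
        inv := cokernel.desc _ (sq.desc 0 (cokernel.π _) (by simp)) (by simp)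
        hom_inv_id := by
          rw [← cancel_epi (cokernel.π _)]; simp
        inv_hom_id := by
          rw [← cancel_epi (cokernel.π _)]
          apply sq.hom_ext <;> simp }

lemma W_colim {S : Set C} (hS : IsClosedClass S) (J : Type v) [SmallCategory J]
    [(monomorphisms C).IsStableUnderColimitsOfShape J] :
    (W S).IsStableUnderColimitsOfShape J where
  condition X₁ X₂ c₁ c₂ h₁ h₂ f hf φ hφ := by
    refine ⟨IsStableUnderColimitsOfShape.condition (W := monomorphisms C) X₁ X₂ c₁ c₂ h₁ h₂ f
      (fun j => (hf j).1) φ hφ, ?_⟩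
    let D : J ⥤ C :=
      { obj := fun j => cokernel (f.app j)
        map := fun {i j} a => cokernel.map _ _ (X₁.map a) (X₂.map a) (by simp)
        map_id := fun j => by rw [← cancel_epi (cokernel.π _)]; simp
        map_comp := fun a b => by rw [← cancel_epi (cokernel.π _)]; simp }
    let c : Cocone D :=
      { pt := cokernel φ
        ι :=
          { app := fun j => cokernel.map _ _ (c₁.ι.app j) (c₂.ι.app j) (hφ j).symm
            naturality := fun i j a => by
              rw [← cancel_epi (cokernel.π _)]; simp [D] } }
    have hc : IsColimit c :=
      { desc := fun s => cokernel.desc φ (h₂.desc ⟨s.pt,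
          { app := fun j => cokernel.π (f.app j) ≫ s.ι.app j
            naturality := fun i j a => by
              have := s.w a
              dsimp [D] at this
              dsimp
              rw [← this]
              simp }⟩) (by
                apply h₁.hom_ext
                intro j
                rw [reassoc_of% (hφ j)]
                simp)
        fac := fun s j => by
          rw [← cancel_epi (cokernel.π _)]; simp [c]
        uniq := fun s m hm => by
          rw [← cancel_epi (cokernel.π _)]
          apply h₂.hom_ext
          intro j
          have := hm j
          dsimp [c] at this
          simp [← this] }
    exact colimit_mem hS D c hc (fun j => (hf j).2)

lemma W_transf {S : Set C} (hS : IsClosedClass S) [IsGrothendieckAbelian.{v} C] :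
    IsStableUnderTransfiniteComposition.{v} (W S) := by
  have := W_respectsIso hS
  have := W_isMultiplicative hS
  refine ⟨fun J _ _ _ _ => ?_⟩
  refine IsStableUnderTransfiniteCompositionOfShape.of_isStableUnderColimitsOfShape ?_
  intro J _ _ _ _
  exact W_colim hS J

lemma W_coprod {S : Set C} (hS : IsClosedClass S) [IsGrothendieckAbelian.{v} C] :
    IsStableUnderCoproducts.{v} (W S) :=
  ⟨fun J => W_colim hS (Discrete J)⟩

/-- Generic small object argument. -/
lemma soa {S : Set C} (hS : IsClosedClass S) [IsGrothendieckAbelian.{v} C]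
    {ι : Type v} {A B : ι → C} (i : ∀ t, A t ⟶ B t) (hi : ∀ t, W S (i t)) (M : C) :
    ∃ (N : C) (n : M ⟶ N), Mono n ∧ cokernel n ∈ S ∧ ∀ t (a : A t ⟶ N), ∃ b, i t ≫ b = a := by
  have := W_respectsIso hS
  have := W_cobaseChange hS
  have := W_transf hS
  have := W_coprod hS
  let I : MorphismProperty C := ofHoms i
  have hI : I ≤ W S := by
    rintro _ _ _ ⟨t⟩
    exact hi t
  have hI' : I ≤ monomorphisms C := by
    rintro _ _ _ ⟨t⟩
    exact (hi t).1
  obtain ⟨κ, hκ', hκ⟩ := HasCardinalLT.exists_regular_cardinal_forall.{v} (fun t => Subobject (A t))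
  have : Fact κ.IsRegular := ⟨hκ'⟩
  have : Nonempty κ.ord.ToType := by simpa using hκ'.ne_zero
  have := WellFoundedLT.toOrderBot κ.ord.ToType
  have : IsCardinalForSmallObjectArgument.{v} I κ :=
    { preservesColimit {A B X Y} i hi f hf := by
        let hf' : (monomorphisms C).TransfiniteCompositionOfShape κ.ord.ToType f :=
          { toTransfiniteCompositionOfShape := hf.toTransfiniteCompositionOfShape
            map_mem j hj := by
              have := (hf.attachCells j hj).pushouts_coproducts
              simp only [ofHoms_homFamily] at this
              refine (?_ : _ ≤ monomorphisms C) _ this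
              simp only [pushouts_le_iff, coproducts_le_iff]
              exact hI' }
        have (j j' : κ.ord.ToType) (φ : j ⟶ j') : Mono (hf'.F.map φ) := hf'.mem_map φ
        apply IsGrothendieckAbelian.preservesColimit_coyoneda_obj_of_mono (Y := hf'.F) (κ := κ)
        obtain ⟨S⟩ := hi
        exact hκ _ }
  let z : M ⟶ 0 := 0
  have hW : W S (SmallObject.ιObj I κ z) := by
    refine (?_ : _ ≤ W S) _ (SmallObject.transfiniteCompositionsOfShape_ιObj I κ z)
    refine (transfiniteCompositionsOfShape_monotone _ ?_).trans (transfiniteCompositionsOfShape_le _ _)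
    simpa only [pushouts_le_iff, coproducts_le_iff] using hI
  refine ⟨_, SmallObject.ιObj I κ z, hW.1, hW.2, ?_⟩
  intro t a
  have h := SmallObject.rlp_πObj I κ z (i t) ⟨t⟩
  have sq : CommSq a (i t) (SmallObject.πObj I κ z) 0 := ⟨Subsingleton.elim _ _⟩
  exact ⟨sq.lift, sq.fac_left⟩

end Closed

section ExtLemmas

variable {C : Type u} [Category.{v} C] [Abelian C] [HasExt.{w} C]

open Abelian

/-- All morphisms vanish. -/
def H0 (X Y : C) : Prop := ∀ f : X ⟶ Y, f = 0

/-- First extension group vanishes. -/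
def E1 (X Y : C) : Prop := Subsingleton (Ext.{w} X Y 1)

lemma E1_iff (X Y : C) : E1.{w} X Y ↔ ∀ x : Ext.{w} X Y 1, x = 0 :=
  ⟨fun h x => h.elim _ _, fun h => ⟨fun a b => by rw [h a, h b]⟩⟩

lemma sub0_iff (X Y : C) : Subsingleton (Ext.{w} X Y 0) ↔ H0 X Y := by
  refine ⟨fun h f => ?_, fun h => ⟨fun a b => ?_⟩⟩
  · exact (Ext.mk₀_eq_zero_iff f).1 (h.elim _ _)
  · apply Ext.addEquiv₀.injective
    rw [h (Ext.addEquiv₀ a), h (Ext.addEquiv₀ b)]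

variable (C) in
/-- Vanishing of second extension groups and higher. -/
def Her : Prop := ∀ (M N : C) (n : ℕ), 2 ≤ n → Subsingleton (Ext.{w} M N n)

/-- Orthogonality. -/
def Perp (X Y : C) : Prop := H0 X Y ∧ E1.{w} X Y

lemma perp_iff (hC : Her.{w} C) (X Y : C) :
    (∀ n : ℕ, Subsingleton (Ext.{w} X Y n)) ↔ Perp.{w} X Y := by
  refine ⟨fun h => ⟨(sub0_iff X Y).1 (h 0), h 1⟩, fun h n => ?_⟩
  match n with
  | 0 => exact (sub0_iff X Y).2 h.1
  | 1 => exact h.2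
  | n + 2 => exact hC _ _ _ (by lia)

variable {S : ShortComplex C}

lemma exists_lift (hS : S.ShortExact) {X : C} (h : E1.{w} X S.X₁) (f : X ⟶ S.X₃) : ∃ g, g ≫ S.g = f := by
  obtain ⟨x, hx⟩ := Ext.covariant_sequence_exact₃ X hS (Ext.mk₀ f) (zero_add 1) (h.elim _ _)
  obtain ⟨g, rfl⟩ := (Ext.mk₀_bijective _ _).2 x
  refine ⟨g, (Ext.mk₀_bijective _ _).1 ?_⟩
  simpa using hx

lemma exists_extend (hS : S.ShortExact) {Y : C} (h : E1.{w} S.X₃ Y) (f : S.X₁ ⟶ Y) : ∃ g, S.f ≫ g = f := by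
  obtain ⟨x, hx⟩ := Ext.contravariant_sequence_exact₁ hS Y (Ext.mk₀ f) (add_zero 1) (h.elim _ _)
  obtain ⟨g, rfl⟩ := (Ext.mk₀_bijective _ _).2 x
  refine ⟨g, (Ext.mk₀_bijective _ _).1 ?_⟩
  simpa using hx

lemma E1_left (hS : S.ShortExact) {X : C} (h : E1.{w} X S.X₂) (hl : ∀ f : X ⟶ S.X₃, ∃ g, g ≫ S.g = f) :
    E1.{w} X S.X₁ := by
  rw [E1_iff]
  intro x
  obtain ⟨y, rfl⟩ := Ext.covariant_sequence_exact₁ X hS x (h.elim _ _) (zero_add 1)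
  obtain ⟨f, rfl⟩ := (Ext.mk₀_bijective _ _).2 y
  obtain ⟨g, rfl⟩ := hl f
  rw [← Ext.mk₀_comp_mk₀, Ext.comp_assoc_of_second_deg_zero]
  simp

lemma E1_mid (hS : S.ShortExact) {X : C} (h1 : E1.{w} X S.X₁) (h3 : E1.{w} X S.X₃) : E1.{w} X S.X₂ := by
  rw [E1_iff]
  intro x
  obtain ⟨y, rfl⟩ := Ext.covariant_sequence_exact₂ X hS x (h3.elim _ _)
  rw [(E1_iff _ _).1 h1 y]
  simp

lemma E1_right (hS : S.ShortExact) (hC : Her.{w} C) {X : C} (h : E1.{w} X S.X₂) : E1.{w} X S.X₃ := by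
  rw [E1_iff]
  intro x
  obtain ⟨y, rfl⟩ := Ext.covariant_sequence_exact₃ X hS x (n₁ := 2) rfl
    ((hC _ _ 2 le_rfl).elim _ _)
  rw [(E1_iff _ _).1 h y]
  simp

lemma E1_mid' (hS : S.ShortExact) {Y : C} (h1 : E1.{w} S.X₁ Y) (h3 : E1.{w} S.X₃ Y) : E1.{w} S.X₂ Y := by
  rw [E1_iff]
  intro x
  obtain ⟨y, rfl⟩ := Ext.contravariant_sequence_exact₂ hS Y x (h1.elim _ _)
  rw [(E1_iff _ _).1 h3 y]
  simp

lemma E1_left' (hS : S.ShortExact) (hC : Her.{w} C) {Y : C} (h : E1.{w} S.X₂ Y) : E1.{w} S.X₁ Y := by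
  rw [E1_iff]
  intro x
  obtain ⟨y, rfl⟩ := Ext.contravariant_sequence_exact₁ hS Y x (n₁ := 2) rfl
    ((hC _ _ 2 le_rfl).elim _ _)
  rw [(E1_iff _ _).1 h y]
  simp

lemma E1_right' (hS : S.ShortExact) {Y : C} (h : E1.{w} S.X₂ Y) (h0 : H0 S.X₁ Y) : E1.{w} S.X₃ Y := by
  rw [E1_iff]
  intro x
  obtain ⟨y, rfl⟩ := Ext.contravariant_sequence_exact₃ hS Y x (h.elim _ _) (add_zero 1)
  obtain ⟨f, rfl⟩ := (Ext.mk₀_bijective _ _).2 y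
  rw [h0 f]
  simp

lemma H0_mid (hS : S.ShortExact) {X : C} (h1 : H0 X S.X₁) (h3 : H0 X S.X₃) : H0 X S.X₂ := by
  intro f
  have := hS.mono_f
  have e := hS.exact.lift_f f (h3 _)
  rw [← e, h1 (hS.exact.lift f (h3 _)), zero_comp]

lemma H0_mid' (hS : S.ShortExact) {Y : C} (h1 : H0 S.X₁ Y) (h3 : H0 S.X₃ Y) : H0 S.X₂ Y := by
  intro f
  have := hS.epi_g
  have e := hS.exact.g_desc f (h1 _)
  rw [← e, h3 (hS.exact.desc f (h1 _)), comp_zero]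

end ExtLemmas

section ExtLemmas2

variable {C : Type u} [Category.{v} C] [Abelian C] [HasExt.{w} C]

open Abelian

lemma H0_of_mono {X Y Z : C} (i : Y ⟶ Z) [Mono i] (h : H0 X Z) : H0 X Y := fun f => by
  rw [← cancel_mono i, zero_comp]; exact h _

lemma H0_of_epi {X Y Z : C} (p : X ⟶ Y) [Epi p] (h : H0 X Z) : H0 Y Z := fun f => by
  rw [← cancel_epi p, comp_zero]; exact h _

lemma se_mono {A B : C} (f : A ⟶ B) [Mono f] :
    (ShortComplex.mk f (cokernel.π f) (cokernel.condition f)).ShortExact where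
  exact := ShortComplex.exact_cokernel f

lemma se_epi {A B : C} (f : A ⟶ B) [Epi f] :
    (ShortComplex.mk (kernel.ι f) f (kernel.condition f)).ShortExact where
  exact := ShortComplex.exact_kernel f

lemma se_coker {A B : C} (f : A ⟶ B) :
    (ShortComplex.mk (Abelian.image.ι f) (cokernel.π f) (by simp)).ShortExact where
  exact := ShortComplex.exact_kernel (cokernel.π f)

lemma se_ker {A B : C} (f : A ⟶ B) :
    (ShortComplex.mk (kernel.ι f) (Abelian.factorThruImage f) (by
      rw [← cancel_mono (Abelian.image.ι f)]; simp)).ShortExact where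
  exact := by
    rw [ShortComplex.exact_iff_exact_up_to_refinements]
    intro T x hx
    dsimp at x hx ⊢
    have h : x ≫ f = 0 := by
      rw [← Abelian.image.fac f, reassoc_of% hx, zero_comp]
    exact ⟨T, 𝟙 _, inferInstance, kernel.lift f x h, by simp⟩

lemma E1_iso {X Y Y' : C} (e : Y ≅ Y') (h : E1.{w} X Y) : E1.{w} X Y' := by
  have hs := se_mono e.hom
  rw [E1_iff] at h ⊢
  intro x
  have := h (x.comp (Ext.mk₀ e.inv) (add_zero 1))
  have h2 : (x.comp (Ext.mk₀ e.inv) (add_zero 1)).comp (Ext.mk₀ e.hom) (add_zero 1) = x := by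
    rw [Ext.comp_assoc_of_third_deg_zero]
    simp
  rw [← h2, this]; simp

lemma E1_iso' {X X' Y : C} (e : X ≅ X') (h : E1.{w} X Y) : E1.{w} X' Y := by
  rw [E1_iff] at h ⊢
  intro x
  have := h ((Ext.mk₀ e.hom).comp x (zero_add 1))
  have h2 : (Ext.mk₀ e.inv).comp ((Ext.mk₀ e.hom).comp x (zero_add 1)) (zero_add 1) = x := by
    simp
  rw [← h2, this]; simp

lemma perp_iso {X Y Y' : C} (e : Y ≅ Y') (h : Perp.{w} X Y) : Perp.{w} X Y' :=
  ⟨H0_of_mono e.inv h.1, E1_iso e h.2⟩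

lemma E1_injective (X I : C) [Injective I] : E1.{w} X I := Ext.subsingleton_of_injective X I 0

lemma injective_of_E1 (Q : C) (h : ∀ X, E1.{w} X Q) : Injective Q where
  factors g f _ := exists_extend (se_mono f) (h _) g

variable [HasColimitsOfSize.{v, v} C]

lemma perp_closed (hC : Her.{w} C) [EnoughInjectives C] (T : Set C) :
    IsClosedClass {X : C | ∀ Y ∈ T, Perp.{w} X Y} := by
  have him : ∀ {A B : C} (f : A ⟶ B) (Z : C), Perp.{w} A Z → Perp.{w} B Z →
      Perp.{w} (Abelian.image f) Z := by
    intro A B f Z hA hB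
    exact ⟨H0_of_epi (Abelian.factorThruImage f) hA.1, E1_left' (se_coker f) hC hB.2⟩
  refine ⟨?_, ?_, ?_, ?_, ?_⟩
  · intro A B hA e Z hZ
    exact ⟨H0_of_epi e.hom (hA Z hZ).1, E1_iso' e (hA Z hZ).2⟩
  · intro A B f hA hB Z hZ
    refine ⟨?_, E1_left' (se_ker f) hC (hA Z hZ).2⟩
    intro g
    obtain ⟨g', hg'⟩ := exists_extend (se_ker f) (him f Z (hA Z hZ) (hB Z hZ)).2 g
    rw [← hg', (hA Z hZ).1 g', comp_zero]
  · intro A B f hA hB Z hZ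
    exact ⟨H0_of_epi (cokernel.π f) (hB Z hZ).1,
      E1_right' (se_coker f) (hB Z hZ).2 (him f Z (hA Z hZ) (hB Z hZ)).1⟩
  · intro E hE h1 h3 Z hZ
    exact ⟨H0_mid' hE (h1 Z hZ).1 (h3 Z hZ).1, E1_mid' hE (h1 Z hZ).2 (h3 Z hZ).2⟩
  · intro ι g hg Z hZ
    refine ⟨fun f => ?_, ?_⟩
    · apply Sigma.hom_ext
      intro i
      rw [(hg i Z hZ).1 (Sigma.ι g i ≫ f), comp_zero]
    · refine E1_left (se_mono (Injective.ι Z)) (E1_injective _ _) ?_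
      intro f
      choose l hl using fun i => exists_lift (se_mono (Injective.ι Z)) (hg i Z hZ).2
        (Sigma.ι g i ≫ f)
      refine ⟨Sigma.desc l, ?_⟩
      apply Sigma.hom_ext
      intro i
      simpa using hl i

end ExtLemmas2

section Main

variable {C : Type u} [Category.{v} C] [Abelian C] [HasExt.{w} C] [HasColimitsOfSize.{v, v} C]

/-- Embedding killing the first extension group. -/
lemma exists_embed {S : Set C} (hS : IsClosedClass S) [IsGrothendieckAbelian.{v} C]
    {X₀ : C} (hX : X₀ ∈ S) (M : C) :
    ∃ (N : C) (n : M ⟶ N), Mono n ∧ cokernel n ∈ S ∧ E1.{w} X₀ N := by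
  let G : C := separator C
  have hG : IsSeparator G := isSeparator_separator C
  rw [Preadditive.isSeparator_iff] at hG
  let ι : Type v := {T : Set (G ⟶ X₀) // Epi (Sigma.desc (fun s : T => s.1))}
  let p : ∀ t : ι, (∐ fun _ : t.1 => G) ⟶ X₀ := fun t => Sigma.desc (fun s : t.1 => s.1)
  have hp : ∀ t, Epi (p t) := fun t => t.2
  obtain ⟨N, n, h1, h2, h3⟩ := soa hS (fun t => kernel.ι (p t)) (fun t => ⟨inferInstance,
    hS.1 _ _ hX (IsColimit.coconePointUniqueUpToIso (se_epi (p t)).gIsCokernel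
      (colimit.isColimit (parallelPair (kernel.ι (p t)) 0)))⟩) M
  refine ⟨N, n, h1, h2, ?_⟩
  refine E1_left (se_mono (Injective.ι N)) (E1_injective _ _) ?_
  dsimp
  intro g
  let π := cokernel.π (Injective.ι N)
  let T : Set (G ⟶ X₀) := {t | ∃ u : G ⟶ Injective.under N, u ≫ π = t ≫ g}
  have hT : Epi (Sigma.desc (fun s : T => s.1)) := by
    apply Preadditive.epi_of_cancel_zero
    intro Z z hz
    have hz' : ∀ t ∈ T, t ≫ z = 0 := by
      intro t ht
      have := Sigma.ι (fun _ : T => G) ⟨t, ht⟩ ≫= hz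
      simpa using this
    rw [← cancel_epi (pullback.fst g π), comp_zero]
    apply hG
    intro h
    rw [← Category.assoc]
    apply hz'
    exact ⟨h ≫ pullback.snd g π, by simp [pullback.condition]⟩
  choose u hu using fun s : T => s.2
  let t : ι := ⟨T, hT⟩
  let b : (∐ fun _ : t.1 => G) ⟶ Injective.under N := Sigma.desc u
  have hb : b ≫ π = p t ≫ g := by
    apply Sigma.hom_ext
    intro s
    have e1 : Sigma.ι (fun _ : t.1 => G) s ≫ b = u s := by simp [b]
    have e2 : Sigma.ι (fun _ : t.1 => G) s ≫ p t = s.1 := by simp [p]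
    rw [reassoc_of% e1, reassoc_of% e2]
    exact hu s
  have hb' : (kernel.ι (p t) ≫ b) ≫ π = 0 := by
    rw [Category.assoc, hb, kernel.condition_assoc, zero_comp]
  have hs := se_mono (Injective.ι N)
  obtain ⟨h, hh⟩ := h3 t (hs.exact.lift _ hb')
  have hl : hs.exact.lift _ hb' ≫ Injective.ι N = kernel.ι (p t) ≫ b := hs.exact.lift_f _ hb'
  have h4 : kernel.ι (p t) ≫ (b - h ≫ Injective.ι N) = 0 := by
    rw [Preadditive.comp_sub, reassoc_of% hh, hl, sub_self]
  have hs2 := se_epi (p t)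
  have := hs2.epi_g
  refine ⟨hs2.exact.desc _ h4, ?_⟩
  have h5 : p t ≫ hs2.exact.desc _ h4 = _ := hs2.exact.g_desc _ h4
  rw [← cancel_epi (p t), reassoc_of% h5]
  simp only [Preadditive.sub_comp, Category.assoc, cokernel.condition, comp_zero, sub_zero]
  exact hb

/-- Factorization of a morphism in a hereditary category. -/
lemma hered_factor (hC : Her.{w} C) [EnoughInjectives C] {X T : C} (f : X ⟶ T) :
    ∃ (Z : C) (i : X ⟶ Z) (p : Z ⟶ T), i ≫ p = f ∧
      ∃ (h : i ≫ p ≫ cokernel.π f = 0),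
        (ShortComplex.mk i (p ≫ cokernel.π f) h).ShortExact := by
  let K := kernel f
  let j : K ⟶ Injective.under K := Injective.ι K
  let q := cokernel.π j
  have hQ : Injective (cokernel j) :=
    injective_of_E1.{w} _ (fun X => E1_right (se_mono j) hC (E1_injective _ _))
  let e : X ⟶ Injective.under K := Injective.factorThru j (kernel.ι f)
  have he : kernel.ι f ≫ e = j := Injective.comp_factorThru _ _
  have hs := se_ker f
  have := hs.epi_g
  have h1 : kernel.ι f ≫ e ≫ q = 0 := by rw [reassoc_of% he]; simp [q]
  let t : T ⟶ cokernel j := Injective.factorThru (hs.exact.desc (e ≫ q) h1) (Abelian.image.ι f)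
  have ht : f ≫ t = e ≫ q := by
    have h2 : Abelian.factorThruImage f ≫ hs.exact.desc (e ≫ q) h1 = _ :=
      hs.exact.g_desc (e ≫ q) h1
    calc f ≫ t = Abelian.factorThruImage f ≫ Abelian.image.ι f ≫ t := by simp
      _ = _ := by rw [Injective.comp_factorThru, h2]
  let i : X ⟶ pullback t q := pullback.lift f e ht
  have hi1 : i ≫ pullback.fst t q = f := pullback.lift_fst _ _ _
  have hi2 : i ≫ pullback.snd t q = e := pullback.lift_snd _ _ _
  have hi : Mono i := by
    refine Preadditive.mono_of_cancel_zero _ ?_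
    intro A x hx
    have hxf : x ≫ f = 0 := by rw [← hi1, reassoc_of% hx, zero_comp]
    have hxe : x ≫ e = 0 := by rw [← hi2, reassoc_of% hx, zero_comp]
    have h3 : kernel.lift f x hxf ≫ j = 0 := by
      rw [← he, kernel.lift_ι_assoc, hxe]
    have h4 : kernel.lift f x hxf = 0 := by
      rw [← cancel_mono j, h3, zero_comp]
    rw [← kernel.lift_ι f x hxf, h4, zero_comp]
  have hep : Epi (pullback.fst t q) := inferInstance
  refine ⟨pullback t q, i, pullback.fst t q, hi1, by rw [reassoc_of% hi1]; simp, ?_⟩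
  refine { exact := ?_, mono_f := hi, epi_g := epi_comp _ _ }
  rw [ShortComplex.exact_iff_exact_up_to_refinements]
  intro A z hz
  dsimp at z hz ⊢
  rw [← Category.assoc] at hz
  obtain ⟨A₁, π₁, _, x, hx⟩ := (ShortComplex.exact_cokernel f).exact_up_to_refinements _ hz
  dsimp at x hx
  have h5 : (π₁ ≫ z ≫ pullback.snd t q - x ≫ e) ≫ q = 0 := by
    rw [Preadditive.sub_comp, Category.assoc, Category.assoc, Category.assoc,
      ← pullback.condition, ← ht, ← reassoc_of% hx, sub_self]
  let k : A₁ ⟶ K := (se_mono j).exact.lift _ h5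
  have hk : k ≫ j = _ := (se_mono j).exact.lift_f _ h5
  refine ⟨A₁, π₁, inferInstance, x + k ≫ kernel.ι f, ?_⟩
  apply pullback.hom_ext
  · simp only [Category.assoc, hi1, Preadditive.add_comp, kernel.condition, comp_zero, add_zero]
    exact hx
  · simp only [Category.assoc, hi2, Preadditive.add_comp, he, hk]
    simp

lemma se_pullback {E : ShortComplex C} (hE : E.ShortExact) {Y : C} (x : Y ⟶ E.X₃)
    (i : E.X₁ ⟶ pullback x E.g) (hi1 : i ≫ pullback.fst x E.g = 0)
    (hi2 : i ≫ pullback.snd x E.g = E.f) :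
    (ShortComplex.mk i (pullback.fst x E.g) hi1).ShortExact := by
  have := hE.mono_f
  have := hE.epi_g
  have hm : Mono i := by
    have : Mono (i ≫ pullback.snd x E.g) := by
      rw [hi2]; infer_instance
    exact mono_of_mono _ (pullback.snd x E.g)
  refine { exact := ?_, mono_f := hm, epi_g := by dsimp; infer_instance }
  rw [ShortComplex.exact_iff_exact_up_to_refinements]
  intro A z hz
  dsimp at z hz ⊢
  have h1 : (z ≫ pullback.snd x E.g) ≫ E.g = 0 := by
    rw [Category.assoc, ← pullback.condition, reassoc_of% hz, zero_comp]
  refine ⟨A, 𝟙 _, inferInstance, hE.exact.lift _ h1, ?_⟩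
  apply pullback.hom_ext
  · simp [hz, hi1]
  · simp only [Category.id_comp, Category.assoc, hi2]
    exact (hE.exact.lift_f _ h1).symm

/-- A trace-like approximation. -/
lemma exists_trace (hC : Her.{w} C) {S : Set C} (hS : IsClosedClass S)
    [IsGrothendieckAbelian.{v} C] {X₀ : C} (hX : X₀ ∈ S) (N : C) :
    ∃ (X : C) (f : X ⟶ N), X ∈ S ∧ H0 X₀ (cokernel f) := by
  let P : Set (Subobject N) := {s | ∃ (X : C) (f : X ⟶ N), X ∈ S ∧ s = imageSubobject f}
  let ι : Type v := Shrink.{v} P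
  let eq : ι ≃ P := (equivShrink P).symm
  choose X f hXS hf using fun t : ι => (eq t).2
  let F : (∐ X) ⟶ N := Sigma.desc f
  have hF : (∐ X) ∈ S := hS.2.2.2.2 _ _ hXS
  have key : ∀ (X' : C) (g : X' ⟶ N), X' ∈ S → g ≫ cokernel.π F = 0 := by
    intro X' g hX'
    let s : P := ⟨imageSubobject g, X', g, hX', rfl⟩
    have h1 : imageSubobject g = imageSubobject (f (eq.symm s)) := by
      rw [← hf]; simp [s]
    have h2 : f (eq.symm s) ≫ cokernel.π F = 0 := by
      have : Sigma.ι X (eq.symm s) ≫ F = f (eq.symm s) := by simp [F]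
      rw [← this, Category.assoc, cokernel.condition, comp_zero]
    have h3 : (imageSubobject (f (eq.symm s))).arrow ≫ cokernel.π F = 0 := by
      rw [← cancel_epi (factorThruImageSubobject (f (eq.symm s)))]
      simp [h2]
    have h4 : (imageSubobject g).arrow ≫ cokernel.π F = 0 := by
      rw [h1]; exact h3
    rw [← imageSubobject_arrow_comp g, Category.assoc, h4, comp_zero]
  refine ⟨_, F, hF, fun x => ?_⟩
  obtain ⟨Z, i, p, hip, h0, hE⟩ := hered_factor hC F
  have hE' := se_pullback hE x (pullback.lift 0 i (by simpa using h0.symm))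
    (pullback.lift_fst _ _ _) (pullback.lift_snd _ _ _)
  have hmem := hS.2.2.2.1 _ hE' hF hX
  have h6 := key _ (pullback.snd x (p ≫ cokernel.π F) ≫ p) hmem
  have := hE'.epi_g
  dsimp at this
  rw [← cancel_epi (pullback.fst x (p ≫ cokernel.π F)), pullback.condition, comp_zero]
  simpa using h6

end Main

section Final

variable {C : Type u} [Category.{v} C] [Abelian C] [HasExt.{w} C] [HasColimitsOfSize.{v, v} C]

/-- Approximation when the first extension group vanishes. -/
lemma exists_approx (hC : Her.{w} C) {S : Set C} (hS : IsClosedClass S)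
    [IsGrothendieckAbelian.{v} C] {X₀ : C} (hX : X₀ ∈ S) (N : C) (hN : E1.{w} X₀ N) :
    ∃ (X : C) (f : X ⟶ N), X ∈ S ∧ Perp.{w} X₀ (kernel f) ∧ Perp.{w} X₀ (cokernel f) := by
  obtain ⟨X, f, hXS, hf⟩ := exists_trace hC hS hX N
  have hcf : Perp.{w} X₀ (cokernel f) := ⟨hf, E1_right (se_coker f) hC hN⟩
  obtain ⟨K', k, hk, hkS, hK'⟩ := exists_embed.{w} hS hX (kernel f)
  obtain ⟨X₂, g, hX₂, hg⟩ := exists_trace hC hS hX K'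
  have hcg : Perp.{w} X₀ (cokernel g) := ⟨hg, E1_right (se_coker g) hC hK'⟩
  have := W_cobaseChange hS
  have hinl : W S (pushout.inl (kernel.ι f) k) := pushout_inl _ _ ⟨hk, hkS⟩
  have := hinl.1
  have hX' : pushout (kernel.ι f) k ∈ S := hS.2.2.2.1 _ (se_mono _) hXS hinl.2
  let l : X ⟶ pushout (kernel.ι f) k := pushout.inl _ _
  let r : K' ⟶ pushout (kernel.ι f) k := pushout.inr _ _
  have hlr : kernel.ι f ≫ l = k ≫ r := pushout.condition
  have hr : Mono r := by dsimp [r]; infer_instance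
  let f' : pushout (kernel.ι f) k ⟶ N := pushout.desc f 0 (by simp)
  have hl : l ≫ f' = f := pushout.inl_desc _ _ _
  have hr0 : r ≫ f' = 0 := pushout.inr_desc _ _ _
  have hX'' : cokernel (g ≫ r) ∈ S := hS.2.2.1 _ hX₂ hX'
  let f'' : cokernel (g ≫ r) ⟶ N := cokernel.desc (g ≫ r) f' (by rw [Category.assoc, hr0, comp_zero])
  have hf'' : cokernel.π (g ≫ r) ≫ f'' = f' := cokernel.π_desc _ _ _
  let c : cokernel g ⟶ cokernel (g ≫ r) := cokernel.map g (g ≫ r) (𝟙 _) r (by simp)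
  have hc : cokernel.π g ≫ c = r ≫ cokernel.π (g ≫ r) := cokernel.π_desc _ _ _
  have hcm : Mono c := (comp_shortExact g r).mono_f
  have hcf0 : c ≫ f'' = 0 := by
    rw [← cancel_epi (cokernel.π g), reassoc_of% hc, hf'', hr0, comp_zero]
  have hbi : Epi (biprod.desc l r) := by
    apply Preadditive.epi_of_cancel_zero
    intro Z z hz
    apply pushout.hom_ext
    · have := biprod.inl ≫= hz
      simpa using this
    · have := biprod.inr ≫= hz
      simpa using this
  have hex : (ShortComplex.mk c f'' hcf0).Exact := by
    rw [ShortComplex.exact_iff_exact_up_to_refinements]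
    intro A z hz
    dsimp at z hz ⊢
    obtain ⟨A₁, π₁, _, z₁, hz₁⟩ := surjective_up_to_refinements_of_epi (cokernel.π (g ≫ r)) z
    obtain ⟨A₂, π₂, _, z₂, hz₂⟩ := surjective_up_to_refinements_of_epi (biprod.desc l r) z₁
    have e1 : z₂ ≫ biprod.desc l r = (z₂ ≫ biprod.fst) ≫ l + (z₂ ≫ biprod.snd) ≫ r := by
      rw [biprod.desc_eq]; simp
    have e2 : (z₂ ≫ biprod.fst) ≫ f = 0 := by
      have h1 : π₂ ≫ z₁ ≫ f' = 0 := by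
        rw [← hf'', ← reassoc_of% hz₁, hz, comp_zero, comp_zero]
      rw [reassoc_of% hz₂, ← Category.assoc, e1] at h1
      simp only [Preadditive.add_comp, Category.assoc, hl, hr0, comp_zero, add_zero] at h1
      rw [Category.assoc]
      exact h1
    let m := kernel.lift f _ e2
    have hm : m ≫ kernel.ι f = z₂ ≫ biprod.fst := kernel.lift_ι _ _ _
    refine ⟨A₂, π₂ ≫ π₁, inferInstance, (m ≫ k + z₂ ≫ biprod.snd) ≫ cokernel.π g, ?_⟩
    rw [Category.assoc, hz₁, reassoc_of% hz₂, Category.assoc, hc, ← Category.assoc, e1,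
      ← hm, Category.assoc, hlr, ← Category.assoc, ← Category.assoc, ← Preadditive.add_comp,
      Category.assoc]
  refine ⟨_, f'', hX'', ?_, ?_⟩
  · exact perp_iso (IsLimit.conePointUniqueUpToIso hex.fIsKernel
      (limit.isLimit (parallelPair f'' 0))) hcg
  · refine perp_iso ?_ hcf
    have e3 : f ≫ cokernel.π f'' = 0 := by
      have h7 : (l ≫ cokernel.π (g ≫ r) ≫ f'') ≫ cokernel.π f'' = 0 := by
        rw [Category.assoc, Category.assoc, cokernel.condition, comp_zero, comp_zero]
      rw [hf'', hl] at h7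
      exact h7
    have e4 : f'' ≫ cokernel.π f = 0 := by
      rw [← cancel_epi (cokernel.π (g ≫ r)), reassoc_of% hf'', comp_zero]
      apply pushout.hom_ext
      · rw [← Category.assoc]
        change (l ≫ f') ≫ _ = _
        rw [hl]; simp
      · rw [← Category.assoc]
        change (r ≫ f') ≫ _ = _
        rw [hr0]; simp
    exact
      { hom := cokernel.desc f (cokernel.π f'') e3
        inv := cokernel.desc f'' (cokernel.π f) e4 }

/-- The five-term sequence. -/
lemma exists_five (hC : Her.{w} C) {S : Set C} (hS : IsClosedClass S)
    [IsGrothendieckAbelian.{v} C] {X₀ : C} (hX : X₀ ∈ S) (M : C) :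
    ∃ (YM XM YM' XM' : C)
      (f₁ : YM ⟶ XM) (f₂ : XM ⟶ M) (f₃ : M ⟶ YM') (f₄ : YM' ⟶ XM')
      (w₁₂ : f₁ ≫ f₂ = 0) (w₂₃ : f₂ ≫ f₃ = 0) (w₃₄ : f₃ ≫ f₄ = 0),
      XM ∈ S ∧ XM' ∈ S ∧ Perp.{w} X₀ YM ∧ Perp.{w} X₀ YM' ∧
      Mono f₁ ∧ Epi f₄ ∧
      (ShortComplex.mk f₁ f₂ w₁₂).Exact ∧
      (ShortComplex.mk f₂ f₃ w₂₃).Exact ∧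
      (ShortComplex.mk f₃ f₄ w₃₄).Exact := by
  obtain ⟨N, n, hn, hnS, hN⟩ := exists_embed.{w} hS hX M
  obtain ⟨X, f, hXS, hkf, hcf⟩ := exists_approx hC hS hX N hN
  let π := cokernel.π n
  have hnπ : n ≫ π = 0 := cokernel.condition n
  have h2 : (kernel.ι (f ≫ π) ≫ f) ≫ π = 0 := by rw [Category.assoc, kernel.condition]
  let f₂ : kernel (f ≫ π) ⟶ M := (se_mono n).exact.lift _ h2
  have hf₂ : f₂ ≫ n = kernel.ι (f ≫ π) ≫ f := (se_mono n).exact.lift_f _ h2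
  let f₁ : kernel f ⟶ kernel (f ≫ π) := kernel.lift _ (kernel.ι f) (by simp)
  have hf₁ : f₁ ≫ kernel.ι (f ≫ π) = kernel.ι f := kernel.lift_ι _ _ _
  let f₃ : M ⟶ cokernel f := n ≫ cokernel.π f
  let f₄ : cokernel f ⟶ cokernel (f ≫ π) := cokernel.desc f (π ≫ cokernel.π (f ≫ π)) (by
    rw [← Category.assoc, cokernel.condition])
  have hf₄ : cokernel.π f ≫ f₄ = π ≫ cokernel.π (f ≫ π) := cokernel.π_desc _ _ _
  have w₁₂ : f₁ ≫ f₂ = 0 := by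
    rw [← cancel_mono n, Category.assoc, hf₂, reassoc_of% hf₁, kernel.condition, zero_comp]
  have w₂₃ : f₂ ≫ f₃ = 0 := by
    rw [reassoc_of% hf₂, cokernel.condition, comp_zero]
  have w₃₄ : f₃ ≫ f₄ = 0 := by
    rw [Category.assoc, hf₄, reassoc_of% hnπ, zero_comp]
  have hm : Mono f₁ := by
    have : Mono (f₁ ≫ kernel.ι (f ≫ π)) := by rw [hf₁]; infer_instance
    exact mono_of_mono _ (kernel.ι (f ≫ π))
  have he : Epi f₄ := by
    have : Epi (cokernel.π f ≫ f₄) := by rw [hf₄]; exact epi_comp _ _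
    exact epi_of_epi (cokernel.π f) _
  refine ⟨_, _, _, _, f₁, f₂, f₃, f₄, w₁₂, w₂₃, w₃₄, hS.2.1 _ hXS hnS, hS.2.2.1 _ hXS hnS,
    hkf, hcf, hm, he, ?_, ?_, ?_⟩
  · rw [ShortComplex.exact_iff_exact_up_to_refinements]
    intro A z hz
    dsimp at z hz ⊢
    have h3 : (z ≫ kernel.ι (f ≫ π)) ≫ f = 0 := by
      rw [Category.assoc, ← hf₂, reassoc_of% hz, zero_comp]
    refine ⟨A, 𝟙 _, inferInstance, kernel.lift f _ h3, ?_⟩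
    rw [← cancel_mono (kernel.ι (f ≫ π)), Category.assoc, Category.assoc, hf₁]
    simp
  · rw [ShortComplex.exact_iff_exact_up_to_refinements]
    intro A z hz
    dsimp at z hz ⊢
    have hz' : (z ≫ n) ≫ cokernel.π f = 0 := by rw [Category.assoc]; exact hz
    obtain ⟨A₁, π₁, _, x, hx⟩ := (ShortComplex.exact_cokernel f).exact_up_to_refinements _ hz'
    dsimp at x hx
    have h4 : x ≫ f ≫ π = 0 := by
      rw [← reassoc_of% hx, hnπ, comp_zero, comp_zero]
    refine ⟨A₁, π₁, inferInstance, kernel.lift _ x h4, ?_⟩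
    rw [← cancel_mono n, Category.assoc, Category.assoc, hf₂, kernel.lift_ι_assoc]
    exact hx
  · rw [ShortComplex.exact_iff_exact_up_to_refinements]
    intro A z hz
    dsimp at z hz ⊢
    obtain ⟨A₁, π₁, _, y, hy⟩ := surjective_up_to_refinements_of_epi (cokernel.π f) z
    have h5 : (y ≫ π) ≫ cokernel.π (f ≫ π) = 0 := by
      rw [Category.assoc, ← hf₄, ← reassoc_of% hy, hz, comp_zero]
    obtain ⟨A₂, π₂, _, x, hx⟩ :=
      (ShortComplex.exact_cokernel (f ≫ π)).exact_up_to_refinements _ h5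
    dsimp at x hx
    have h6 : (π₂ ≫ y - x ≫ f) ≫ π = 0 := by
      rw [Preadditive.sub_comp, Category.assoc, Category.assoc, hx, sub_self]
    let m : A₂ ⟶ M := (se_mono n).exact.lift _ h6
    have hm : m ≫ n = _ := (se_mono n).exact.lift_f _ h6
    refine ⟨A₂, π₂ ≫ π₁, inferInstance, m, ?_⟩
    change _ = m ≫ n ≫ _
    rw [reassoc_of% hm, Preadditive.sub_comp, Category.assoc, Category.assoc, Category.assoc,
      cokernel.condition, comp_zero, sub_zero, hy]

lemma bij_left {X YM XM M YM' : C} (f₁ : YM ⟶ XM) (f₂ : XM ⟶ M) (f₃ : M ⟶ YM')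
    (w₁₂ : f₁ ≫ f₂ = 0) (w₂₃ : f₂ ≫ f₃ = 0) [Mono f₁]
    (h12 : (ShortComplex.mk f₁ f₂ w₁₂).Exact) (h23 : (ShortComplex.mk f₂ f₃ w₂₃).Exact)
    (hX : Perp.{w} X YM) (hX' : Perp.{w} X YM') :
    Function.Bijective (fun (g : X ⟶ XM) => g ≫ f₂) := by
  constructor
  · intro a b hab
    have h1 : (a - b) ≫ f₂ = 0 := by rw [Preadditive.sub_comp]; exact sub_eq_zero.2 hab
    have h2 : h12.lift _ h1 ≫ f₁ = a - b := h12.lift_f _ h1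
    rw [hX.1 (h12.lift _ h1), zero_comp] at h2
    exact sub_eq_zero.1 h2.symm
  · intro h
    have h1 : h ≫ cokernel.π f₂ = 0 := h23.comp_eq_zero (hX'.1 _) (cokernel.condition f₂)
    have h2 : (se_coker f₂).exact.lift _ h1 ≫ Abelian.image.ι f₂ = h :=
      (se_coker f₂).exact.lift_f _ h1
    have hE : E1.{w} X (kernel f₂) := E1_iso (IsLimit.conePointUniqueUpToIso h12.fIsKernel
      (limit.isLimit (parallelPair f₂ 0))) hX.2
    obtain ⟨g, hg⟩ := exists_lift (se_ker f₂) hE ((se_coker f₂).exact.lift _ h1)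
    refine ⟨g, ?_⟩
    dsimp at hg ⊢
    rw [← Abelian.image.fac f₂, reassoc_of% hg, h2]

lemma bij_right {XM M YM' XM' Y : C} (f₂ : XM ⟶ M) (f₃ : M ⟶ YM') (f₄ : YM' ⟶ XM')
    (w₂₃ : f₂ ≫ f₃ = 0) (w₃₄ : f₃ ≫ f₄ = 0) [Epi f₄]
    (h23 : (ShortComplex.mk f₂ f₃ w₂₃).Exact) (h34 : (ShortComplex.mk f₃ f₄ w₃₄).Exact)
    (hY : Perp.{w} XM Y) (hY' : Perp.{w} XM' Y) :
    Function.Bijective (fun (g : YM' ⟶ Y) => f₃ ≫ g) := by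
  constructor
  · intro a b hab
    have h1 : f₃ ≫ (a - b) = 0 := by rw [Preadditive.comp_sub]; exact sub_eq_zero.2 hab
    have h2 : f₄ ≫ h34.desc _ h1 = a - b := h34.g_desc _ h1
    rw [hY'.1 (h34.desc _ h1), comp_zero] at h2
    exact sub_eq_zero.1 h2.symm
  · intro h
    have h1 : kernel.ι f₃ ≫ h = 0 := h23.comp_eq_zero (kernel.condition f₃) (hY.1 _)
    have hs := se_ker f₃
    have := hs.epi_g
    have h2 : Abelian.factorThruImage f₃ ≫ hs.exact.desc _ h1 = h := hs.exact.g_desc _ h1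
    have hE : E1.{w} (cokernel f₃) Y := E1_iso' (IsColimit.coconePointUniqueUpToIso h34.gIsCokernel
      (colimit.isColimit (parallelPair f₃ 0))) hY'.2
    obtain ⟨g, hg⟩ := exists_extend (se_coker f₃) hE (hs.exact.desc _ h1)
    refine ⟨g, ?_⟩
    dsimp at hg ⊢
    rw [← Abelian.image.fac f₃, Category.assoc, hg, h2]

lemma retract_mem {S : Set C} (hS : IsClosedClass S) {X Z : C} (s : X ⟶ Z) (r : Z ⟶ X)
    (h : s ≫ r = 𝟙 X) (hZ : Z ∈ S) : X ∈ S := by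
  refine hS.1 _ _ (hS.2.1 (𝟙 Z - r ≫ s) hZ hZ) ?_
  have h1 : s ≫ (𝟙 Z - r ≫ s) = 0 := by
    rw [Preadditive.comp_sub, reassoc_of% h]; simp
  have h2 := kernel.condition (𝟙 Z - r ≫ s)
  rw [Preadditive.comp_sub, sub_eq_zero, Category.comp_id] at h2
  exact
    { hom := kernel.ι (𝟙 Z - r ≫ s) ≫ r
      inv := kernel.lift (𝟙 Z - r ≫ s) s h1
      hom_inv_id := by
        rw [← cancel_mono (kernel.ι (𝟙 Z - r ≫ s)), Category.assoc, Category.assoc,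
          kernel.lift_ι, ← h2, Category.id_comp]
      inv_hom_id := by rw [kernel.lift_ι_assoc, h] }

end Final

end ExtPair

/-- For a hereditary Grothendieck category `C` and an object `X₀`,
the pair `(𝒳, 𝒴)` with `𝒴 = X₀^⊥` and `𝒳` the smallest extension closed abelian
subcategory closed under coproducts containing `X₀` is a complete Ext-orthogonal pair:
`𝒳 = ^⊥𝒴`, and every object `M` admits a five-term exact sequence
`0 → Y_M → X_M → M → Y^M → X^M → 0` inducing the approximation bijections. -/
theorem complete_ext_orthogonal_pair_of_grothendieck
    {C : Type u} [Category.{v} C] [Abelian C] [HasColimitsOfSize.{v, v} C]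
    [AB5 C] [HasSeparator C] [HasExt.{w} C]
    (hereditary : ∀ (M N : C) (n : ℕ), 2 ≤ n → Subsingleton (Abelian.Ext M N n))
    (X₀ : C)
    (𝒴 : Set C) (h𝒴 : 𝒴 = {Y : C | ∀ n : ℕ, Subsingleton (Abelian.Ext X₀ Y n)})
    (𝒳 : Set C)
    (h𝒳 : ∀ M : C, M ∈ 𝒳 ↔ ∀ S : Set C, IsClosedClass S → X₀ ∈ S → M ∈ S) :
    (𝒳 = {X : C | ∀ Y ∈ 𝒴, ∀ n : ℕ, Subsingleton (Abelian.Ext X Y n)}) ∧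
    (∀ M : C, ∃ (YM XM YM' XM' : C)
      (f₁ : YM ⟶ XM) (f₂ : XM ⟶ M) (f₃ : M ⟶ YM') (f₄ : YM' ⟶ XM')
      (w₁₂ : f₁ ≫ f₂ = 0) (w₂₃ : f₂ ≫ f₃ = 0) (w₃₄ : f₃ ≫ f₄ = 0),
      XM ∈ 𝒳 ∧ XM' ∈ 𝒳 ∧ YM ∈ 𝒴 ∧ YM' ∈ 𝒴 ∧
      Mono f₁ ∧ Epi f₄ ∧
      (ShortComplex.mk f₁ f₂ w₁₂).Exact ∧
      (ShortComplex.mk f₂ f₃ w₂₃).Exact ∧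
      (ShortComplex.mk f₃ f₄ w₃₄).Exact ∧
      (∀ X ∈ 𝒳, Function.Bijective (fun (g : X ⟶ XM) => g ≫ f₂)) ∧
      (∀ Y ∈ 𝒴, Function.Bijective (fun (g : YM' ⟶ Y) => f₃ ≫ g))) := by
  have : IsGrothendieckAbelian.{v} C := {}
  have hC : ExtPair.Her.{w} C := hereditary
  have hXc : IsClosedClass 𝒳 := by
    refine ⟨?_, ?_, ?_, ?_, ?_⟩
    · intro X Y hX e
      rw [h𝒳] at hX ⊢
      exact fun S hS h0 => hS.1 _ _ (hX S hS h0) e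
    · intro X Y f hX hY
      rw [h𝒳] at hX hY ⊢
      exact fun S hS h0 => hS.2.1 _ (hX S hS h0) (hY S hS h0)
    · intro X Y f hX hY
      rw [h𝒳] at hX hY ⊢
      exact fun S hS h0 => hS.2.2.1 _ (hX S hS h0) (hY S hS h0)
    · intro E hE hX hY
      rw [h𝒳] at hX hY ⊢
      exact fun S hS h0 => hS.2.2.2.1 _ hE (hX S hS h0) (hY S hS h0)
    · intro ι g hg
      rw [h𝒳]
      exact fun S hS h0 => hS.2.2.2.2 _ _ (fun i => (h𝒳 _).1 (hg i) S hS h0)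
  have hX₀ : X₀ ∈ 𝒳 := (h𝒳 _).2 (fun S _ h0 => h0)
  have hY : ∀ Y, Y ∈ 𝒴 ↔ ExtPair.Perp.{w} X₀ Y := by
    intro Y
    rw [h𝒴]
    exact ExtPair.perp_iff hC X₀ Y
  have hXY : ∀ X ∈ 𝒳, ∀ Y ∈ 𝒴, ExtPair.Perp.{w} X Y := fun X hX =>
    (h𝒳 X).1 hX _ (ExtPair.perp_closed hC 𝒴) (fun Y h => (hY Y).1 h)
  constructor
  · ext X
    refine ⟨fun hX Y h n => (ExtPair.perp_iff hC X Y).2 (hXY X hX Y h) n, fun hX => ?_⟩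
    obtain ⟨YM, XM, YM', XM', f₁, f₂, f₃, f₄, w₁₂, w₂₃, w₃₄, m1, m2, m3, m4, hm, he,
      h12, h23, h34⟩ := ExtPair.exists_five hC hXc hX₀ X
    obtain ⟨s, hs⟩ := (ExtPair.bij_left f₁ f₂ f₃ w₁₂ w₂₃ h12 h23
      ((ExtPair.perp_iff hC X _).1 (hX _ ((hY _).2 m3)))
      ((ExtPair.perp_iff hC X _).1 (hX _ ((hY _).2 m4)))).2 (𝟙 X)
    exact ExtPair.retract_mem hXc s f₂ hs m1
  · intro M
    obtain ⟨YM, XM, YM', XM', f₁, f₂, f₃, f₄, w₁₂, w₂₃, w₃₄, m1, m2, m3, m4, hm, he,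
      h12, h23, h34⟩ := ExtPair.exists_five hC hXc hX₀ M
    exact ⟨YM, XM, YM', XM', f₁, f₂, f₃, f₄, w₁₂, w₂₃, w₃₄, m1, m2, (hY _).2 m3, (hY _).2 m4,
      hm, he, h12, h23, h34,
      fun X hX => ExtPair.bij_left f₁ f₂ f₃ w₁₂ w₂₃ h12 h23 (hXY X hX _ ((hY _).2 m3))
        (hXY X hX _ ((hY _).2 m4)),
      fun Y h => ExtPair.bij_right f₂ f₃ f₄ w₂₃ w₃₄ h23 h34 (hXY _ m1 Y h) (hXY _ m2 Y h)⟩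
end

section
/- Let A be a hereditary ring and let X, Y be objects of the unbounded derived category D(Mod A). Then Hom_{D(Mod A)}(X, Y[n]) = 0 for all n ∈ ℤ if and only if Ext_A^i(H^p(X), H^q(Y)) = 0 for all p, q ∈ ℤ and all i ≥ 0, where H^p denotes the p-th cohomology module of a complex. -/
open CategoryTheory

universe w u

/-- A ring is (left) hereditary if every submodule of a projective module is projective. -/
def IsHereditaryRing (A : Type u) [Ring A] : Prop :=
  ∀ (M : Type u) [AddCommGroup M] [Module A M], Module.Projective A M →
    ∀ (N : Submodule A M), Module.Projective A N


section Hered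
open Limits Pretriangulated
universe vC uC
variable {C : Type uC} [Category.{vC} C] [Abelian C]

lemma hered_nullHomotopy (P K : CochainComplex C ℤ) (hd : ∀ i j, P.d i j = 0)
    [∀ n, Projective (P.X n)] (f : P ⟶ K)
    (hf : ∀ n, HomologicalComplex.homologyMap f n = 0) : Nonempty (Homotopy f 0) := by
  have key : ∀ i j : ℤ, j + 1 = i → ∃ s : P.X i ⟶ K.X j, s ≫ K.d j i = f.f i := by
    intro i j hij
    have h1 : P.liftCycles (𝟙 (P.X i)) _ rfl (by simp [hd]) ≫
        HomologicalComplex.cyclesMap f i ≫ K.homologyπ i = 0 := by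
      rw [← HomologicalComplex.homologyπ_naturality, hf]; simp
    have hex := (ShortComplex.mk _ _ (K.toCycles_comp_homologyπ j i)).exact_of_g_is_cokernel
      (K.homologyIsCokernel j i (by simp; lia))
    obtain ⟨s, hs⟩ : ∃ s : P.X i ⟶ K.X j, s ≫ K.toCycles j i =
        P.liftCycles (𝟙 (P.X i)) _ rfl (by simp [hd]) ≫ HomologicalComplex.cyclesMap f i :=
      ⟨hex.liftFromProjective (P.liftCycles (𝟙 (P.X i)) _ rfl (by simp [hd]) ≫
        HomologicalComplex.cyclesMap f i) ((Category.assoc _ _ _).trans h1),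
        hex.liftFromProjective_comp _ _⟩
    refine ⟨s, ?_⟩
    rw [← K.toCycles_i j i, reassoc_of% hs]
    simp
  choose s hs using key
  refine ⟨{ hom := fun i j => if h : j + 1 = i then s i j h else 0
            zero := fun i j hij => dif_neg (by simpa using hij)
            comm := fun i => ?_ }⟩
  rw [dNext_eq _ (i' := i + 1) (by simp), prevD_eq _ (j' := i - 1) (by simp)]
  simp [hd, hs]

lemma hered_isKProjective (P : CochainComplex C ℤ) (hd : ∀ i j, P.d i j = 0)
    [∀ n, Projective (P.X n)] : P.IsKProjective where
  nonempty_homotopy_zero {L} f hL := hered_nullHomotopy P L hd f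
    (fun n => ((hL n).isZero_homology).eq_of_tgt _ _)

lemma hered_realize (P K : CochainComplex C ℤ) (hd : ∀ i j, P.d i j = 0)
    [∀ n, Projective (P.X n)] (φ : ∀ n, P.homology n ⟶ K.homology n) :
    ∃ f : P ⟶ K, ∀ n, HomologicalComplex.homologyMap f n = φ n := by
  let l (n : ℤ) : P.X n ⟶ P.cycles n := P.liftCycles (𝟙 (P.X n)) _ rfl (by simp [hd])
  have hl (n : ℤ) : P.iCycles n ≫ l n = 𝟙 _ := by
    rw [← cancel_mono (P.iCycles n)]; simp [l]
  let t (n : ℤ) : P.X n ⟶ K.cycles n :=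
    Projective.factorThru (l n ≫ P.homologyπ n ≫ φ n) (K.homologyπ n)
  have ht (n : ℤ) : t n ≫ K.homologyπ n = l n ≫ P.homologyπ n ≫ φ n :=
    Projective.factorThru_comp _ _
  let f : P ⟶ K := { f := fun n => t n ≫ K.iCycles n
                     comm' := fun i j _ => by simp [hd] }
  refine ⟨f, fun n => ?_⟩
  rw [← cancel_epi (P.homologyπ n), HomologicalComplex.homologyπ_naturality]
  have : HomologicalComplex.cyclesMap f n = P.iCycles n ≫ t n := by
    rw [← cancel_mono (K.iCycles n)]; simp [f]
  rw [this, Category.assoc, ht, reassoc_of% (hl n)]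

variable [HasDerivedCategory.{w} C]

open DerivedCategory

noncomputable def heredFac (K : CochainComplex C ℤ) (n : ℤ) :
    (homologyFunctor C n).obj (Q.obj K) ≅ K.homology n :=
  (homologyFunctorFactors C n).app K

lemma heredFac_nat {K L : CochainComplex C ℤ} (f : K ⟶ L) (n : ℤ) :
    (homologyFunctor C n).map (Q.map f) =
      (heredFac K n).hom ≫ HomologicalComplex.homologyMap f n ≫ (heredFac L n).inv := by
  rw [← Category.assoc, Iso.eq_comp_inv]
  exact homologyFunctorFactors_hom_naturality f n

lemma hered_uniq_Q (P : CochainComplex C ℤ) (hd : ∀ i j, P.d i j = 0)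
    [∀ n, Projective (P.X n)] (Y : DerivedCategory C) (f : Q.obj P ⟶ Y)
    (hf : ∀ n, (homologyFunctor C n).map f = 0) : f = 0 := by
  have := hered_isKProjective P hd
  let K := Q.objPreimage Y
  let e : Q.obj K ≅ Y := Q.objObjPreimageIso Y
  obtain ⟨g, hg⟩ : ∃ g : P ⟶ K, Q.map g = f ≫ e.inv := by
    obtain ⟨g', hg'⟩ := (CochainComplex.IsKProjective.Qh_map_bijective P
      ((HomotopyCategory.quotient _ _).obj K)).surjective
      ((quotientCompQhIso C).hom.app P ≫ (f ≫ e.inv) ≫ (quotientCompQhIso C).inv.app K)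
    obtain ⟨g, rfl⟩ := (HomotopyCategory.quotient _ _).map_surjective g'
    refine ⟨g, ?_⟩
    have := quotientCompQhIso_hom_naturality g
    rw [hg'] at this
    rw [← cancel_epi ((quotientCompQhIso C).hom.app P)]
    simpa using this.symm
  have hg0 : ∀ n, HomologicalComplex.homologyMap g n = 0 := by
    intro n
    have h := heredFac_nat g n
    rw [hg, Functor.map_comp, hf, zero_comp] at h
    rw [← cancel_epi (heredFac P n).hom, ← cancel_mono (heredFac K n).inv, Category.assoc, ← h]
    simp
  obtain ⟨h⟩ := hered_nullHomotopy P K hd g hg0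
  have := Q_map_eq_of_homotopy (C := C) h
  rw [hg, Functor.map_zero] at this
  rw [← cancel_mono e.inv, this, zero_comp]

lemma hered_realize_Q (P : CochainComplex C ℤ) (hd : ∀ i j, P.d i j = 0)
    [∀ n, Projective (P.X n)] (Y : DerivedCategory C)
    (φ : ∀ n, (homologyFunctor C n).obj (Q.obj P) ⟶ (homologyFunctor C n).obj Y) :
    ∃ f : Q.obj P ⟶ Y, ∀ n, (homologyFunctor C n).map f = φ n := by
  let K := Q.objPreimage Y
  let e : Q.obj K ≅ Y := Q.objObjPreimageIso Y
  obtain ⟨g, hg⟩ := hered_realize P K hd (fun n => (heredFac P n).inv ≫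
    φ n ≫ (homologyFunctor C n).map e.inv ≫ (heredFac K n).hom)
  refine ⟨Q.map g ≫ e.hom, fun n => ?_⟩
  rw [Functor.map_comp, heredFac_nat, hg]
  simp [← Functor.map_comp]

/-- The complex with zero differentials. -/
noncomputable def heredZero (F : ℤ → C) : CochainComplex C ℤ where
  X := F
  d _ _ := 0

noncomputable def heredZeroIso (F : ℤ → C) (n : ℤ) :
    (homologyFunctor C n).obj (Q.obj (heredZero F)) ≅ F n :=
  heredFac _ n ≪≫
    (((heredZero F).sc n).asIsoHomologyπ rfl).symm ≪≫
    ((heredZero F).sc n).cyclesIsoX₂ rfl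

lemma hered_iso (W : DerivedCategory C) (hW : ∀ n, Projective ((homologyFunctor C n).obj W)) :
    Nonempty (Q.obj (heredZero (fun n => (homologyFunctor C n).obj W)) ≅ W) := by
  have : ∀ n, Projective ((heredZero (fun n => (homologyFunctor C n).obj W)).X n) := hW
  obtain ⟨f, hf⟩ := hered_realize_Q (heredZero (fun n => (homologyFunctor C n).obj W))
    (fun _ _ => rfl) W (fun n => (heredZeroIso _ n).hom)
  have : IsIso f := by
    rw [isIso_iff]; intro n; rw [hf]; infer_instance
  exact ⟨asIso f⟩

lemma hered_uniq (W : DerivedCategory C) (hW : ∀ n, Projective ((homologyFunctor C n).obj W))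
    {Y : DerivedCategory C} (f : W ⟶ Y)
    (hf : ∀ n, (homologyFunctor C n).map f = 0) : f = 0 := by
  obtain ⟨e⟩ := hered_iso W hW
  have : ∀ n, Projective ((heredZero (fun n => (homologyFunctor C n).obj W)).X n) := hW
  rw [← cancel_epi e.hom, comp_zero]
  exact hered_uniq_Q _ (fun _ _ => rfl) _ _ (by simp [hf])

lemma hered_exist (W : DerivedCategory C) (hW : ∀ n, Projective ((homologyFunctor C n).obj W))
    (Y : DerivedCategory C)
    (φ : ∀ n, (homologyFunctor C n).obj W ⟶ (homologyFunctor C n).obj Y) :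
    ∃ f : W ⟶ Y, ∀ n, (homologyFunctor C n).map f = φ n := by
  obtain ⟨e⟩ := hered_iso W hW
  have : ∀ n, Projective ((heredZero (fun n => (homologyFunctor C n).obj W)).X n) := hW
  obtain ⟨f, hf⟩ := hered_realize_Q _ (fun _ _ => rfl) Y
    (fun n => (homologyFunctor C n).map e.hom ≫ φ n)
  refine ⟨e.inv ≫ f, fun n => ?_⟩
  rw [Functor.map_comp, hf, ← Functor.map_comp_assoc]
  simp

/-- homology of a shift -/
noncomputable def heredShiftIso (W : DerivedCategory C) (n a a' : ℤ) (h : n + a = a') :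
    (homologyFunctor C a).obj (W⟦n⟧) ≅ (homologyFunctor C a').obj W :=
  ((homologyFunctor C 0).shiftIso n a a' h).app W

lemma heredShift_nat {W Z : DerivedCategory C} (a : W ⟶ Z) (n : ℤ) :
    (homologyFunctor C n).map (a⟦(1 : ℤ)⟧') =
      (heredShiftIso _ 1 n (1 + n) rfl).hom ≫ (homologyFunctor C (1 + n)).map a ≫
        (heredShiftIso _ 1 n (1 + n) rfl).inv := by
  rw [← Category.assoc, Iso.eq_comp_inv]
  exact ((homologyFunctor C 0).shiftIso 1 n (1 + n) rfl).hom.naturality a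

lemma hered_triangle [EnoughProjectives C]
    (hC : ∀ {M N : C} (i : M ⟶ N) [Mono i] [Projective N], Projective M)
    (X : DerivedCategory C) :
    ∃ (P D : DerivedCategory C) (a : P ⟶ X) (b : X ⟶ D) (c : D ⟶ P⟦(1 : ℤ)⟧),
      Triangle.mk a b c ∈ distTriang _ ∧
      (∀ n, Projective ((homologyFunctor C n).obj P)) ∧
      (∀ n, Projective ((homologyFunctor C n).obj D)) ∧
      (∀ n, Projective ((homologyFunctor C n).obj (P⟦(1 : ℤ)⟧))) ∧
      (∀ n, Epi ((homologyFunctor C n).map a)) ∧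
      (∀ n, ∃ w, (ShortComplex.mk ((homologyFunctor C n).map c)
        ((homologyFunctor C n).map (a⟦(1 : ℤ)⟧')) w).ShortExact) := by
  let F : ℤ → C := fun n => Projective.over ((homologyFunctor C n).obj X)
  have : ∀ n, Projective ((heredZero F).X n) := fun n =>
    Projective.projective_over _
  obtain ⟨a, ha⟩ := hered_realize_Q (heredZero F) (fun _ _ => rfl) X
    (fun n => (heredZeroIso F n).hom ≫ Projective.π _)
  obtain ⟨D, b, c, hT⟩ := distinguished_cocone_triangle a
  have hP : ∀ n, Projective ((homologyFunctor C n).obj (Q.obj (heredZero F))) := fun n =>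
    Projective.of_iso (heredZeroIso F n).symm (this n)
  have hP1 : ∀ n, Projective ((homologyFunctor C n).obj ((Q.obj (heredZero F))⟦(1 : ℤ)⟧)) :=
    fun n => Projective.of_iso (heredShiftIso _ 1 n (1 + n) rfl).symm (hP _)
  have hepi : ∀ n, Epi ((homologyFunctor C n).map a) := fun n => by
    rw [ha]; infer_instance
  have hepi1 : ∀ n, Epi ((homologyFunctor C n).map (a⟦(1 : ℤ)⟧')) := fun n => by
    rw [heredShift_nat]
    have := hepi (1 + n)
    infer_instance
  have hmono : ∀ n, Mono ((homologyFunctor C n).map c) := fun n => by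
    have h := (HomologySequence.mono_homologyMap_mor₂_iff _ (rot_of_distTriang _ hT) n).2
    exact h ((HomologySequence.epi_homologyMap_mor₁_iff _ hT n).1 (hepi n))
  refine ⟨Q.obj (heredZero F), D, a, b, c, hT, hP, fun n => ?_, hP1, hepi, fun n => ?_⟩
  · have := hmono n
    have := hP1 n
    exact hC ((homologyFunctor C n).map c)
  · have hz : c ≫ a⟦(1 : ℤ)⟧' = 0 := comp_distTriang_mor_zero₃₁ _ hT
    have hz' : (homologyFunctor C n).map c ≫ (homologyFunctor C n).map (a⟦(1 : ℤ)⟧') = 0 := by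
      rw [← Functor.map_comp, hz, Functor.map_zero]
    refine ⟨hz', ?_⟩
    have hex := HomologySequence.exact₂ _ (rot_of_distTriang _ (rot_of_distTriang _ hT)) n
    let ni : (homologyFunctor C n).obj (X⟦(1 : ℤ)⟧) ≅ (homologyFunctor C n).obj (X⟦(1 : ℤ)⟧) :=
      ⟨-𝟙 _, -𝟙 _, by simp, by simp⟩
    have hex' : (ShortComplex.mk _ _ hz').Exact := by
      refine ShortComplex.exact_of_iso ?_ hex
      refine ShortComplex.isoMk (Iso.refl _) (Iso.refl _) ni ?_ ?_
      · exact (Category.id_comp _).trans (Category.comp_id _).symm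
      · change 𝟙 _ ≫ (homologyFunctor C n).map (a⟦(1 : ℤ)⟧') =
          (homologyFunctor C n).map (-(a⟦(1 : ℤ)⟧')) ≫ (-𝟙 _)
        simp
    exact { exact := hex', mono_f := hmono n, epi_g := hepi1 n }


end Hered

section Hered2
universe vC uC
variable {C : Type uC} [Category.{vC} C] [Abelian C]

lemma hered_ext_one [HasExt.{u} C] {S : ShortComplex C} (hS : S.ShortExact) [Projective S.X₂]
    (N : C) : Subsingleton (Abelian.Ext S.X₃ N 1) ↔
      ∀ f : S.X₁ ⟶ N, ∃ g : S.X₂ ⟶ N, S.f ≫ g = f := by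
  constructor
  · intro _ f
    obtain ⟨x, hx⟩ := Abelian.Ext.contravariant_sequence_exact₁ hS N (Abelian.Ext.mk₀ f)
      (n₁ := 1) rfl (Subsingleton.elim _ _)
    obtain ⟨g, rfl⟩ := Abelian.Ext.homEquiv₀.symm.surjective x
    refine ⟨g, Abelian.Ext.homEquiv₀.symm.injective ?_⟩
    simpa using hx
  · intro h
    refine subsingleton_of_forall_eq 0 fun x => ?_
    obtain ⟨y, rfl⟩ := Abelian.Ext.contravariant_sequence_exact₃ hS N x
      (Abelian.Ext.eq_zero_of_projective _) (n₀ := 0) rfl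
    obtain ⟨f, rfl⟩ := Abelian.Ext.homEquiv₀.symm.surjective y
    obtain ⟨g, rfl⟩ := h f
    have : Abelian.Ext.homEquiv₀.symm (S.f ≫ g) =
      (Abelian.Ext.mk₀ S.f).comp (Abelian.Ext.mk₀ g) (zero_add 0) := by simp
    rw [this, ShortComplex.ShortExact.extClass_comp_assoc]

lemma hered_ext_zero [HasExt.{u} C] (M N : C) :
    Subsingleton (Abelian.Ext M N 0) ↔ ∀ φ : M ⟶ N, φ = 0 := by
  rw [Abelian.Ext.homEquiv₀.subsingleton_congr]
  exact ⟨fun _ φ => Subsingleton.elim _ _, fun h => subsingleton_of_forall_eq 0 h⟩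

lemma hered_ext_two [EnoughProjectives C] [HasExt.{u} C]
    (hC : ∀ {M N : C} (i : M ⟶ N) [Mono i] [Projective N], Projective M) (M N : C) (i : ℕ) :
    Subsingleton (Abelian.Ext M N (i + 2)) := by
  let S : ShortComplex C := ShortComplex.mk (Limits.kernel.ι (Projective.π M)) (Projective.π M)
    (by simp)
  have hS : S.ShortExact :=
    { exact := ShortComplex.exact_of_f_is_kernel _ (Limits.kernelIsKernel _)
      mono_f := by dsimp [S]; infer_instance
      epi_g := by dsimp [S]; infer_instance }
  have h2 : Projective S.X₂ := Projective.projective_over _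
  have := hS.mono_f
  have h1 : Projective S.X₁ := hC S.f
  have : HasProjectiveDimensionLT S.X₃ 2 :=
    hS.hasProjectiveDimensionLT_X₃ 1 inferInstance inferInstance
  exact HasProjectiveDimensionLT.subsingleton S.X₃ 2 (i + 2) (by lia) N

lemma hered_ext_congr [HasExt.{u} C] {M M₂ N N₂ : C} (e : M ≅ M₂) (e' : N ≅ N₂) (i : ℕ)
    (h : Subsingleton (Abelian.Ext M N i)) : Subsingleton (Abelian.Ext M₂ N₂ i) := by
  refine subsingleton_of_forall_eq 0 fun x => ?_
  have h1 : (Abelian.Ext.mk₀ e.hom).comp (x.comp (Abelian.Ext.mk₀ e'.inv) (add_zero i))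
      (zero_add i) = 0 := Subsingleton.elim _ _
  have h2 : x = (Abelian.Ext.mk₀ e.inv).comp (((Abelian.Ext.mk₀ e.hom).comp
      (x.comp (Abelian.Ext.mk₀ e'.inv) (add_zero i)) (zero_add i)).comp
        (Abelian.Ext.mk₀ e'.hom) (add_zero i)) (zero_add i) := by
    simp
  rw [h2, h1]
  simp

variable [HasDerivedCategory.{w} C]
open Limits Pretriangulated DerivedCategory

lemma hered_main [EnoughProjectives C] [HasExt.{u} C]
    (hC : ∀ {M N : C} (i : M ⟶ N) [Mono i] [Projective N], Projective M)
    (X Y : DerivedCategory C) :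
    (∀ f : X ⟶ Y, f = 0) ↔
      ∀ p, (∀ φ : (homologyFunctor C p).obj X ⟶ (homologyFunctor C p).obj Y, φ = 0) ∧
        Subsingleton (Abelian.Ext ((homologyFunctor C p).obj (X⟦(1 : ℤ)⟧))
          ((homologyFunctor C p).obj Y) 1) := by
  classical
  obtain ⟨P, D, a, b, c, hT, hP, hD, hP1, hepi, hse⟩ := hered_triangle hC X
  have hbc : b ≫ c = 0 := comp_distTriang_mor_zero₂₃ _ hT
  constructor
  · intro h p
    constructor
    · intro φ
      let ψ : ∀ n, (homologyFunctor C n).obj X ⟶ (homologyFunctor C n).obj Y := fun n =>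
        if hn : p = n then hn ▸ φ else 0
      have hψ : ψ p = φ := by simp [ψ]
      obtain ⟨g, hg⟩ := hered_exist P hP Y (fun n => (homologyFunctor C n).map a ≫ ψ n)
      have hz : c ≫ g⟦(1 : ℤ)⟧' = 0 := by
        refine hered_uniq D hD _ fun n => ?_
        obtain ⟨w, -⟩ := hse n
        have h1 : (homologyFunctor C n).map (g⟦(1 : ℤ)⟧') =
            (homologyFunctor C n).map (a⟦(1 : ℤ)⟧') ≫
              (heredShiftIso _ 1 n (1 + n) rfl).hom ≫ ψ (1 + n) ≫
                (heredShiftIso _ 1 n (1 + n) rfl).inv := by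
          rw [heredShift_nat, heredShift_nat, hg]
          simp
        rw [Functor.map_comp, h1, reassoc_of% w, zero_comp]
      obtain ⟨k, hk⟩ : ∃ k : X⟦(1 : ℤ)⟧ ⟶ Y⟦(1 : ℤ)⟧, g⟦(1 : ℤ)⟧' = (-a⟦(1 : ℤ)⟧') ≫ k :=
        Triangle.yoneda_exact₃ _ (rot_of_distTriang _ hT) (g⟦(1 : ℤ)⟧') hz
      obtain ⟨l, rfl⟩ := (shiftFunctor (DerivedCategory C) (1 : ℤ)).map_surjective k
      rw [h l, Functor.map_zero, comp_zero] at hk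
      have hg0 : g = 0 := (shiftFunctor (DerivedCategory C) (1 : ℤ)).map_injective (by simp [hk])
      have := hg p
      rw [hg0, Functor.map_zero, hψ] at this
      have := hepi p
      rw [← cancel_epi ((homologyFunctor C p).map a), comp_zero]
      exact Eq.symm ‹_›
    · obtain ⟨w, hw⟩ := hse p
      have := hP1 p
      refine (hered_ext_one hw _).2 fun φ => ?_
      let ψ : ∀ n, (homologyFunctor C n).obj D ⟶ (homologyFunctor C n).obj Y := fun n =>
        if hn : p = n then hn ▸ φ else 0
      have hψ : ψ p = φ := by simp [ψ]
      obtain ⟨g, hg⟩ := hered_exist D hD Y ψ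
      obtain ⟨k, hk⟩ : ∃ k : P⟦(1 : ℤ)⟧ ⟶ Y, g = c ≫ k :=
        Triangle.yoneda_exact₃ _ hT g (h _)
      refine ⟨(homologyFunctor C p).map k, ?_⟩
      rw [← hψ, ← hg, hk, Functor.map_comp]
  · intro h f
    obtain ⟨g, rfl⟩ : ∃ g, f = b ≫ g := Triangle.yoneda_exact₂ _ hT f
      (hered_uniq P hP _ fun n => by
        erw [Functor.map_comp, (h n).1 ((homologyFunctor C n).map f), comp_zero])
    have hθ : ∀ n, ∃ θ : (homologyFunctor C n).obj (P⟦(1 : ℤ)⟧) ⟶ (homologyFunctor C n).obj Y,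
        (homologyFunctor C n).map c ≫ θ = (homologyFunctor C n).map g := fun n => by
      obtain ⟨w, hw⟩ := hse n
      have := hP1 n
      exact (hered_ext_one hw _).1 (h n).2 _
    choose θ hθ using hθ
    obtain ⟨k, hk⟩ := hered_exist _ hP1 Y θ
    have : g = c ≫ k := by
      rw [← sub_eq_zero]
      refine hered_uniq D hD _ fun n => ?_
      rw [Functor.map_sub, Functor.map_comp, hk, hθ, sub_self]
    rw [this, reassoc_of% hbc, zero_comp]

end Hered2

/-- Over a hereditary ring, for complexes `X, Y` in the derived category,
all morphisms `X ⟶ Y⟦n⟧` vanish iff all Ext-groups between all cohomology modules of `X`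
and of `Y` vanish. -/
theorem hom_vanishing_iff_ext_vanishing_on_cohomology
    {A : Type u} [Ring A] (hA : IsHereditaryRing A)
    [HasDerivedCategory.{w} (ModuleCat.{u} A)] [HasExt.{u} (ModuleCat.{u} A)]
    (X Y : DerivedCategory (ModuleCat.{u} A)) :
    (∀ (n : ℤ) (f : X ⟶ Y⟦n⟧), f = 0) ↔
      (∀ (p q : ℤ) (i : ℕ),
        Subsingleton (Abelian.Ext ((DerivedCategory.homologyFunctor (ModuleCat.{u} A) p).obj X)
          ((DerivedCategory.homologyFunctor (ModuleCat.{u} A) q).obj Y) i)) := by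
  have hC : ∀ {M N : ModuleCat.{u} A} (i : M ⟶ N) [Mono i] [Projective N], Projective M := by
    intro M N i _ _
    have hN : Module.Projective A N := (IsProjective.iff_projective N).2 inferInstance
    have h1 := hA N hN (LinearMap.range i.hom)
    have hi : Function.Injective i.hom := (ModuleCat.mono_iff_injective i).1 inferInstance
    have := Module.Projective.of_equiv (LinearEquiv.ofInjective i.hom hi).symm
    exact (IsProjective.iff_projective M).1 this
  constructor
  · intro h p q i
    match i with
    | 0 =>
      have := ((hered_main hC X (Y⟦q - p⟧)).1 (h _) p).1
      rw [← hered_ext_zero] at this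
      exact hered_ext_congr (Iso.refl _) (heredShiftIso Y (q - p) p q (by lia)) 0 this
    | 1 =>
      have := ((hered_main hC X (Y⟦q - p + 1⟧)).1 (h _) (p - 1)).2
      exact hered_ext_congr (heredShiftIso X 1 (p - 1) p (by lia))
        (heredShiftIso Y (q - p + 1) (p - 1) q (by lia)) 1 this
    | i + 2 => exact hered_ext_two hC _ _ i
  · intro h n
    refine (hered_main hC X (Y⟦n⟧)).2 fun p => ⟨?_, ?_⟩
    · rw [← hered_ext_zero]
      exact hered_ext_congr (Iso.refl _) (heredShiftIso Y n p (n + p) rfl).symm 0 (h _ _ _)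
    · exact hered_ext_congr (heredShiftIso X 1 p (1 + p) rfl).symm
        (heredShiftIso Y n p (n + p) rfl).symm 1 (h _ _ _)
end

section
/- Let A be a hereditary ring and let 0 → Y₁ → X₁ →^{u} M →^{v} Y₂ → X₂ → 0 be an exact sequence of A-modules. Then in the derived category D(Mod A) there is a distinguished triangle X₁ ⊕ X₂[-1] → M → Y₁[1] ⊕ Y₂ → (X₁ ⊕ X₂[-1])[1] in which the composite X₁ → X₁ ⊕ X₂[-1] → M is the given map u and the composite M → Y₁[1] ⊕ Y₂ → Y₂ is the given map v. -/
open CategoryTheory CategoryTheory.Limits CategoryTheory.Pretriangulated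

universe w u

section Abstract

variable {C : Type*} [Category* C] [Preadditive C] [HasZeroObject C] [HasShift C ℤ]
  [∀ n : ℤ, Functor.Additive (shiftFunctor C n)] [Pretriangulated C]

lemma distOfIso {X Y Z X' Y' Z' : C} {f : X ⟶ Y} {g : Y ⟶ Z} {h : Z ⟶ X⟦(1 : ℤ)⟧}
    {f' : X' ⟶ Y'} {g' : Y' ⟶ Z'} {h' : Z' ⟶ X'⟦(1 : ℤ)⟧}
    (hT : Triangle.mk f g h ∈ distTriang C) (eX : X' ≅ X) (eY : Y' ≅ Y) (eZ : Z' ≅ Z)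
    (c₁ : f' ≫ eY.hom = eX.hom ≫ f) (c₂ : g' ≫ eZ.hom = eY.hom ≫ g)
    (c₃ : h' ≫ eX.hom⟦(1 : ℤ)⟧' = eZ.hom ≫ h) : Triangle.mk f' g' h' ∈ distTriang C :=
  isomorphic_distinguished _ hT _ (Triangle.isoMk _ _ eX eY eZ c₁ c₂ c₃)

lemma isIsoMiddle {X Y Y' Z : C} {f : X ⟶ Y} {g : Y ⟶ Z} {h : Z ⟶ X⟦(1 : ℤ)⟧}
    {f' : X ⟶ Y'} {g' : Y' ⟶ Z} {h' : Z ⟶ X⟦(1 : ℤ)⟧}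
    (hT : Triangle.mk f g h ∈ distTriang C) (hT' : Triangle.mk f' g' h' ∈ distTriang C)
    (φ : Y ⟶ Y') (c₁ : f ≫ φ = f') (c₂ : φ ≫ g' = g) (c₃ : h = h') : IsIso φ := by
  let Φ : Triangle.mk f g h ⟶ Triangle.mk f' g' h' :=
    { hom₁ := 𝟙 X
      hom₂ := φ
      hom₃ := 𝟙 Z
      comm₁ := c₁.trans (Category.id_comp f').symm
      comm₂ := (Category.comp_id g).trans c₂.symm
      comm₃ := by
        change h ≫ (𝟙 X)⟦(1 : ℤ)⟧' = 𝟙 Z ≫ h'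
        simp [c₃] }
  exact isIso₂_of_isIso₁₃ Φ hT hT' (inferInstanceAs (IsIso (𝟙 X))) (inferInstanceAs (IsIso (𝟙 Z)))

lemma exists_split {X Y Z : C} {f : X ⟶ Y} {g : Y ⟶ Z} {h : Z ⟶ X⟦(1 : ℤ)⟧}
    (hT : Triangle.mk f g h ∈ distTriang C) (h0 : h = 0) :
    ∃ e : Y ≅ X ⊞ Z, g = e.hom ≫ biprod.snd := by
  obtain ⟨e, -, he⟩ := exists_iso_binaryBiproduct_of_distTriang _ hT h0
  exact ⟨e, he⟩

lemma exists_lift {T X Y Z : C} {f : X ⟶ Y} {g : Y ⟶ Z} {h : Z ⟶ X⟦(1 : ℤ)⟧}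
    (hT : Triangle.mk f g h ∈ distTriang C) (t : T ⟶ Z) (ht : t ≫ h = 0) :
    ∃ s : T ⟶ Y, t = s ≫ g :=
  Triangle.coyoneda_exact₃ _ hT t ht

lemma exists_isoThird {X Y Z Y' Z' : C} {f : X ⟶ Y} {g : Y ⟶ Z} {h : Z ⟶ X⟦(1 : ℤ)⟧}
    {f' : X ⟶ Y'} {g' : Y' ⟶ Z'} {h' : Z' ⟶ X⟦(1 : ℤ)⟧}
    (hT : Triangle.mk f g h ∈ distTriang C) (hT' : Triangle.mk f' g' h' ∈ distTriang C)
    (e : Y ≅ Y') (c : f ≫ e.hom = f') : ∃ ε : Z ≅ Z', g ≫ ε.hom = e.hom ≫ g' := by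
  let E := isoTriangleOfIso₁₂ _ _ hT hT' (Iso.refl X) e (c.trans (Category.id_comp f').symm)
  exact ⟨Triangle.π₃.mapIso E, E.hom.comm₂⟩

lemma inrFst_distinguished (W Y : C) :
    Triangle.mk (biprod.inr : Y ⟶ W ⊞ Y) biprod.fst 0 ∈ distTriang C :=
  distOfIso (binaryBiproductTriangle_distinguished Y W) (Iso.refl _) (biprod.braiding _ _)
    (Iso.refl _) (by ext <;> simp) (by simp) (by simp)

/-- The direct sum of a distinguished triangle with the triangle `0 → W → W → 0`. -/
lemma addContractible_distinguished [IsTriangulated C] {X Y Z : C} (W : C)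
    (f : X ⟶ Y) (g : Y ⟶ Z) (h : Z ⟶ X⟦(1 : ℤ)⟧) (hT : Triangle.mk f g h ∈ distTriang C) :
    ∃ h', Triangle.mk (f ≫ (biprod.inr : Y ⟶ W ⊞ Y)) (biprod.map (𝟙 W) g) h' ∈ distTriang C := by
  obtain ⟨Z', g', h', hT'⟩ := distinguished_cocone_triangle (f ≫ (biprod.inr : Y ⟶ W ⊞ Y))
  let o := Triangulated.someOctahedron rfl hT (inrFst_distinguished W Y) hT'
  have hc₁ : g ≫ o.m₁ = biprod.inr ≫ g' := o.comm₁
  have hc₃ : g' ≫ o.m₃ = biprod.fst := o.comm₃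
  have hm := o.mem
  have h0 : o.m₁ ≫ o.m₃ = 0 := comp_distTriang_mor_zero₁₂ _ hm
  let φ : W ⊞ Z ⟶ Z' := biprod.desc (biprod.inl ≫ g') o.m₁
  have : IsIso φ := isIsoMiddle (inrFst_distinguished W Z) hm φ (by simp [φ])
    (by ext <;> simp [φ, hc₃, h0]) (by simp)
  refine ⟨φ ≫ h', distOfIso hT' (Iso.refl _) (Iso.refl _) (asIso φ) (by simp) ?_ (by simp)⟩
  ext <;> simp [φ, hc₁]

lemma five_term_abstract [IsTriangulated C] {Y₁ X₁ I M J Y₂ X₂ : C}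
    {f₁ : Y₁ ⟶ X₁} {p : X₁ ⟶ I} {d₁ : I ⟶ Y₁⟦(1 : ℤ)⟧}
    (h₁ : Triangle.mk f₁ p d₁ ∈ distTriang C)
    {i : I ⟶ M} {q : M ⟶ J} {d₂ : J ⟶ I⟦(1 : ℤ)⟧}
    (h₂ : Triangle.mk i q d₂ ∈ distTriang C)
    {j : J ⟶ Y₂} {f₄ : Y₂ ⟶ X₂} {d₃ : X₂ ⟶ J⟦(1 : ℤ)⟧}
    (h₃ : Triangle.mk j f₄ d₃ ∈ distTriang C)
    (hJ : ∀ g : J ⟶ (Y₁⟦(1 : ℤ)⟧)⟦(1 : ℤ)⟧, g = 0)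
    (hX : ∀ g : X₂⟦(-1 : ℤ)⟧ ⟶ X₁⟦(1 : ℤ)⟧, g = 0) :
    ∃ (a : X₁ ⊞ (X₂⟦(-1 : ℤ)⟧) ⟶ M) (b : M ⟶ Y₁⟦(1 : ℤ)⟧ ⊞ Y₂)
      (c : Y₁⟦(1 : ℤ)⟧ ⊞ Y₂ ⟶ (X₁ ⊞ (X₂⟦(-1 : ℤ)⟧))⟦(1 : ℤ)⟧),
      Triangle.mk a b c ∈ distTriang C ∧ biprod.inl ≫ a = p ≫ i ∧ b ≫ biprod.snd = q ≫ j := by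
  -- the cone `K` of `p ≫ i` splits
  obtain ⟨K, k, l, hK⟩ := distinguished_cocone_triangle (p ≫ i)
  have h₁' : Triangle.mk p d₁ (-f₁⟦(1 : ℤ)⟧') ∈ distTriang C := rot_of_distTriang _ h₁
  let o := Triangulated.someOctahedron rfl h₁' h₂ hK
  obtain ⟨e, he'⟩ := exists_split o.mem (hJ _)
  have hc₃ : k ≫ o.m₃ = q := o.comm₃
  -- the connecting map `X₂[-1] ⟶ J` and its lift to `M`
  obtain ⟨δ, d, h₃'⟩ : ∃ (δ : X₂⟦(-1 : ℤ)⟧ ⟶ J) (d : Y₂ ⟶ (X₂⟦(-1 : ℤ)⟧)⟦(1 : ℤ)⟧),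
      Triangle.mk δ j d ∈ distTriang C := ⟨_, _, inv_rot_of_distTriang _ h₃⟩
  obtain ⟨α, hα⟩ := exists_lift hK (δ ≫ biprod.inr ≫ e.inv) (hX _)
  obtain ⟨Z, b, c, hZ⟩ := distinguished_cocone_triangle (biprod.desc (p ≫ i) α)
  let o' := Triangulated.someOctahedron (biprod.inl_desc (p ≫ i) α)
    (binaryBiproductTriangle_distinguished X₁ (X₂⟦(-1 : ℤ)⟧)) hZ hK
  have hm₁ : o'.m₁ = δ ≫ biprod.inr ≫ e.inv := by
    have h : (biprod.snd : X₁ ⊞ (X₂⟦(-1 : ℤ)⟧) ⟶ _) ≫ o'.m₁ = biprod.desc (p ≫ i) α ≫ k := o'.comm₁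
    have h' := congrArg (fun t => (biprod.inr : _ ⟶ X₁ ⊞ (X₂⟦(-1 : ℤ)⟧)) ≫ t) h
    simp only [biprod.inr_snd_assoc, biprod.inr_desc_assoc] at h'
    rw [hα, h']
  have hm₃ : k ≫ o'.m₃ = b := o'.comm₃
  obtain ⟨d', hd'⟩ := addContractible_distinguished (Y₁⟦(1 : ℤ)⟧) _ _ _ h₃'
  obtain ⟨ε, hE⟩ := exists_isoThird o'.mem hd' e (by simp [hm₁])
  refine ⟨biprod.desc (p ≫ i) α, b ≫ ε.hom, ε.inv ≫ c, ?_, by simp, ?_⟩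
  · exact distOfIso hZ (Iso.refl _) (Iso.refl _) ε.symm (by simp) (by simp) (by simp)
  · rw [← hm₃, Category.assoc, Category.assoc, reassoc_of% hE, biprod.map_snd, ← hc₃, he']
    simp

end Abstract

lemma IsHereditaryRing.hasProjectiveDimensionLT {A : Type u} [Ring A] (hA : IsHereditaryRing A)
    (X : ModuleCat.{u} A) : HasProjectiveDimensionLT X 2 := by
  let P := Projective.over X
  let π : P ⟶ X := Projective.π X
  have hS : (ShortComplex.mk (kernel.ι π) π (kernel.condition π)).ShortExact :=
    { exact := ShortComplex.exact_kernel π }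
  have hP : Module.Projective A P := (IsProjective.iff_projective P).2 (Projective.projective_over X)
  have hinj : Function.Injective (kernel.ι π).hom :=
    (ModuleCat.mono_iff_injective _).1 inferInstance
  have := hA P hP (LinearMap.range (kernel.ι π).hom)
  have hK : Module.Projective A (kernel π : ModuleCat A) :=
    Module.Projective.of_equiv (LinearEquiv.ofInjective _ hinj).symm
  have hK' : Projective (kernel π) := ModuleCat.projective_of_categoryTheory_projective _
  have hP' : Projective P := Projective.projective_over X
  exact (hS.hasProjectiveDimensionLT_X₃_iff 0 hP').2
    (projective_iff_hasProjectiveDimensionLT_one.1 hK')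

lemma IsHereditaryRing.shift_two_eq_zero {A : Type u} [Ring A] (hA : IsHereditaryRing A)
    [HasDerivedCategory.{w} (ModuleCat.{u} A)] {X Y : ModuleCat.{u} A}
    (g : (DerivedCategory.singleFunctor (ModuleCat.{u} A) 0).obj X ⟶
      (((DerivedCategory.singleFunctor (ModuleCat.{u} A) 0).obj Y)⟦(1 : ℤ)⟧)⟦(1 : ℤ)⟧) :
    g = 0 := by
  have := hA.hasProjectiveDimensionLT X
  have : HasExt.{w} (ModuleCat.{u} A) := hasExt_of_hasDerivedCategory _
  have hs := HasProjectiveDimensionLT.subsingleton.{w} X 2 2 le_rfl Y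
  have hs' : Subsingleton ((DerivedCategory.singleFunctor (ModuleCat.{u} A) 0).obj X ⟶
      (((DerivedCategory.singleFunctor (ModuleCat.{u} A) 0).obj Y)⟦(2 : ℤ)⟧)) :=
    (Abelian.Ext.homEquiv (X := X) (Y := Y) (n := 2)).symm.subsingleton
  let e := (shiftFunctorAdd' (DerivedCategory (ModuleCat.{u} A)) (1 : ℤ) 1 2 rfl).app
    ((DerivedCategory.singleFunctor (ModuleCat.{u} A) 0).obj Y)
  have h : g ≫ e.inv = 0 := Subsingleton.elim _ _
  rw [← cancel_mono e.inv, h, zero_comp]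

lemma IsHereditaryRing.shift_neg_eq_zero {A : Type u} [Ring A] (hA : IsHereditaryRing A)
    [HasDerivedCategory.{w} (ModuleCat.{u} A)] {X Y : ModuleCat.{u} A}
    (g : ((DerivedCategory.singleFunctor (ModuleCat.{u} A) 0).obj X)⟦(-1 : ℤ)⟧ ⟶
      ((DerivedCategory.singleFunctor (ModuleCat.{u} A) 0).obj Y)⟦(1 : ℤ)⟧) :
    g = 0 := by
  apply (shiftFunctor (DerivedCategory (ModuleCat.{u} A)) (1 : ℤ)).map_injective
  rw [Functor.map_zero, ← cancel_epi ((shiftNegShift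
    ((DerivedCategory.singleFunctor (ModuleCat.{u} A) 0).obj X) (1 : ℤ)).inv), comp_zero]
  exact hA.shift_two_eq_zero _

/-- Over a hereditary ring, a five-term exact sequence
`0 → Y₁ → X₁ →ᵘ M →ᵛ Y₂ → X₂ → 0` of modules gives rise to a distinguished triangle
`X₁ ⊕ X₂[-1] → M → Y₁[1] ⊕ Y₂ → (X₁ ⊕ X₂[-1])[1]` in the derived category, where the
composite `X₁ → X₁ ⊕ X₂[-1] → M` is `u` and the composite `M → Y₁[1] ⊕ Y₂ → Y₂` is `v`. -/
theorem five_term_sequence_triangle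
    {A : Type u} [Ring A] (hA : IsHereditaryRing A)
    [HasDerivedCategory.{w} (ModuleCat.{u} A)]
    {Y₁ X₁ M Y₂ X₂ : ModuleCat.{u} A}
    (f₁ : Y₁ ⟶ X₁) (u : X₁ ⟶ M) (v : M ⟶ Y₂) (f₄ : Y₂ ⟶ X₂)
    (hmono : Mono f₁) (hepi : Epi f₄)
    (w₁₂ : f₁ ≫ u = 0) (w₂₃ : u ≫ v = 0) (w₃₄ : v ≫ f₄ = 0)
    (ex₁ : (ShortComplex.mk f₁ u w₁₂).Exact)
    (ex₂ : (ShortComplex.mk u v w₂₃).Exact)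
    (ex₃ : (ShortComplex.mk v f₄ w₃₄).Exact) :
    letI s := DerivedCategory.singleFunctor (ModuleCat.{u} A) 0
    ∃ (a : s.obj X₁ ⊞ ((s.obj X₂)⟦(-1 : ℤ)⟧) ⟶ s.obj M)
      (b : s.obj M ⟶ ((s.obj Y₁)⟦(1 : ℤ)⟧ ⊞ s.obj Y₂))
      (c : ((s.obj Y₁)⟦(1 : ℤ)⟧ ⊞ s.obj Y₂) ⟶ (s.obj X₁ ⊞ ((s.obj X₂)⟦(-1 : ℤ)⟧))⟦(1 : ℤ)⟧),
      (Triangle.mk a b c ∈ distTriang (DerivedCategory (ModuleCat.{u} A))) ∧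
      biprod.inl ≫ a = s.map u ∧
      b ≫ biprod.snd = s.map v := by
  have hp : Epi (kernel.lift v u w₂₃) := ex₂.epi_kernelLift
  have hq : Epi (kernel.lift f₄ v w₃₄) := ex₃.epi_kernelLift
  have z₁ : f₁ ≫ kernel.lift v u w₂₃ = 0 := by
    rw [← cancel_mono (kernel.ι v)]; simp [w₁₂]
  have z₂ : kernel.ι v ≫ kernel.lift f₄ v w₃₄ = 0 := by
    rw [← cancel_mono (kernel.ι f₄)]; simp
  have S₁ : (ShortComplex.mk f₁ (kernel.lift v u w₂₃) z₁).ShortExact :=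
    { exact := by
        let φ : ShortComplex.mk f₁ (kernel.lift v u w₂₃) z₁ ⟶ ShortComplex.mk f₁ u w₁₂ :=
          { τ₁ := 𝟙 _, τ₂ := 𝟙 _, τ₃ := kernel.ι v }
        have : Epi φ.τ₁ := by dsimp [φ]; infer_instance
        have : IsIso φ.τ₂ := by dsimp [φ]; infer_instance
        have : Mono φ.τ₃ := by dsimp [φ]; infer_instance
        exact (ShortComplex.exact_iff_of_epi_of_isIso_of_mono φ).2 ex₁ }
  have S₂ : (ShortComplex.mk (kernel.ι v) (kernel.lift f₄ v w₃₄) z₂).ShortExact :=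
    { exact := by
        let φ : ShortComplex.mk (kernel.ι v) (kernel.lift f₄ v w₃₄) z₂ ⟶
            ShortComplex.mk (kernel.ι v) v (kernel.condition v) :=
          { τ₁ := 𝟙 _, τ₂ := 𝟙 _, τ₃ := kernel.ι f₄ }
        have : Epi φ.τ₁ := by dsimp [φ]; infer_instance
        have : IsIso φ.τ₂ := by dsimp [φ]; infer_instance
        have : Mono φ.τ₃ := by dsimp [φ]; infer_instance
        exact (ShortComplex.exact_iff_of_epi_of_isIso_of_mono φ).2 (ShortComplex.exact_kernel v) }
  have S₃ : (ShortComplex.mk (kernel.ι f₄) f₄ (kernel.condition f₄)).ShortExact :=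
    { exact := ShortComplex.exact_kernel f₄ }
  obtain ⟨a, b, c, hT, ha, hb⟩ := five_term_abstract S₁.singleTriangle_distinguished
    S₂.singleTriangle_distinguished S₃.singleTriangle_distinguished
    (fun g => hA.shift_two_eq_zero g) (fun g => hA.shift_neg_eq_zero g)
  refine ⟨a, b, c, hT, ha.trans ?_, hb.trans ?_⟩
  · rw [← Functor.map_comp]; simp
  · rw [← Functor.map_comp]; simp
end

section
/- Let A be a hereditary ring and 𝒴 an extension closed abelian subcategory of Mod A that is closed under arbitrary products and arbitrary coproducts. Set 𝒳 = {X : Ext_A^n(X,Y) = 0 for all Y ∈ 𝒴 and n ≥ 0} and 𝒵 = {Z : Ext_A^n(Y,Z) = 0 for all Y ∈ 𝒴 and n ≥ 0}. Then every A-module M fits into an exact sequence 0 → Y₁ → X₁ → M → Y₂ → X₂ → 0 with X₁, X₂ ∈ 𝒳 and Y₁, Y₂ ∈ 𝒴, and also into an exact sequence 0 → Z₁ → Y₁' → M → Z₂ → Y₂' → 0 with Y₁', Y₂' ∈ 𝒴 and Z₁, Z₂ ∈ 𝒵. -/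
open CategoryTheory CategoryTheory.Limits

universe u

/-- `FiveTermSequence 𝒰 𝒱 M` says that there is an exact sequence
`0 → V₁ → U₁ → M → V₂ → U₂ → 0` with `U₁, U₂ ∈ 𝒰` and `V₁, V₂ ∈ 𝒱`. -/
def FiveTermSequence {A : Type u} [Ring A]
    (𝒰 𝒱 : Set (ModuleCat.{u} A)) (M : ModuleCat.{u} A) : Prop :=
  ∃ (V₁ U₁ V₂ U₂ : ModuleCat.{u} A)
    (f₁ : V₁ ⟶ U₁) (f₂ : U₁ ⟶ M) (f₃ : M ⟶ V₂) (f₄ : V₂ ⟶ U₂)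
    (w₁₂ : f₁ ≫ f₂ = 0) (w₂₃ : f₂ ≫ f₃ = 0) (w₃₄ : f₃ ≫ f₄ = 0),
    U₁ ∈ 𝒰 ∧ U₂ ∈ 𝒰 ∧ V₁ ∈ 𝒱 ∧ V₂ ∈ 𝒱 ∧
    Mono f₁ ∧ Epi f₄ ∧
    (ShortComplex.mk f₁ f₂ w₁₂).Exact ∧
    (ShortComplex.mk f₂ f₃ w₂₃).Exact ∧
    (ShortComplex.mk f₃ f₄ w₃₄).Exact


namespace ExtOrth

open Abelian

section E1
variable {A : Type u} [Ring A]

lemma shortExact_mk {X₁ X₂ X₃ : Type u} [AddCommGroup X₁] [AddCommGroup X₂] [AddCommGroup X₃]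
    [Module A X₁] [Module A X₂] [Module A X₃] (f : X₁ →ₗ[A] X₂) (g : X₂ →ₗ[A] X₃)
    (hf : Function.Injective f) (hg : Function.Surjective g) (hfg : Function.Exact f g) :
    (ShortComplex.mk (ModuleCat.ofHom f) (ModuleCat.ofHom g)
      (by rw [← ModuleCat.ofHom_comp, hfg.linearMap_comp_eq_zero]; rfl)).ShortExact :=
  ModuleCat.shortComplex_shortExact _ hfg hf hg

variable [HasExt.{u} (ModuleCat.{u} A)]

/-- vanishing of `Ext^1`. -/
def E1 (A : Type u) [Ring A] [HasExt.{u} (ModuleCat.{u} A)] (X Y : Type u) [AddCommGroup X]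
    [AddCommGroup Y] [Module A X] [Module A Y] : Prop :=
  Subsingleton (Ext (ModuleCat.of A X) (ModuleCat.of A Y) 1)

section
variable {X₁ X₂ X₃ : Type u} [AddCommGroup X₁] [AddCommGroup X₂] [AddCommGroup X₃]
    [Module A X₁] [Module A X₂] [Module A X₃] (f : X₁ →ₗ[A] X₂) (g : X₂ →ₗ[A] X₃)
    (hf : Function.Injective f) (hg : Function.Surjective g) (hfg : Function.Exact f g)
    (Y : Type u) [AddCommGroup Y] [Module A Y]

include hf hg hfg

lemma E1.mid_left (h1 : E1 A X₁ Y) (h3 : E1 A X₃ Y) : E1 A X₂ Y := by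
  have hS := shortExact_mk f g hf hg hfg
  unfold E1 at *
  refine subsingleton_of_forall_eq 0 fun x => ?_
  obtain ⟨y, rfl⟩ := Ext.contravariant_sequence_exact₂ hS _ x (Subsingleton.elim _ _)
  rw [Subsingleton.elim y 0, Ext.comp_zero]

lemma E1.mid_right (h1 : E1 A Y X₁) (h3 : E1 A Y X₃) : E1 A Y X₂ := by
  have hS := shortExact_mk f g hf hg hfg
  unfold E1 at *
  refine subsingleton_of_forall_eq 0 fun x => ?_
  obtain ⟨y, rfl⟩ := Ext.covariant_sequence_exact₂ _ hS x (Subsingleton.elim _ _)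
  rw [Subsingleton.elim y 0, Ext.zero_comp]

lemma E1.third_left (h2 : E1 A X₂ Y) (h : ∀ k : X₁ →ₗ[A] Y, ∃ l : X₂ →ₗ[A] Y, l ∘ₗ f = k) :
    E1 A X₃ Y := by
  have hS := shortExact_mk f g hf hg hfg
  unfold E1 at *
  refine subsingleton_of_forall_eq 0 fun x => ?_
  obtain ⟨y, rfl⟩ := Ext.contravariant_sequence_exact₃ hS _ x (Subsingleton.elim _ _) (add_zero 1)
  obtain ⟨k, rfl⟩ := Ext.homEquiv₀.symm.surjective y
  obtain ⟨l, hl⟩ := h k.hom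
  have : k = ModuleCat.ofHom f ≫ ModuleCat.ofHom l := by
    ext x; exact (LinearMap.congr_fun hl x).symm
  rw [this]
  change hS.extClass.comp (Ext.mk₀ _) _ = 0
  rw [← Ext.mk₀_comp_mk₀]
  exact hS.extClass_comp_assoc _

lemma E1.first_right (h2 : E1 A Y X₂) (h : ∀ k : Y →ₗ[A] X₃, ∃ l : Y →ₗ[A] X₂, g ∘ₗ l = k) :
    E1 A Y X₁ := by
  have hS := shortExact_mk f g hf hg hfg
  unfold E1 at *
  refine subsingleton_of_forall_eq 0 fun x => ?_
  obtain ⟨y, rfl⟩ := Ext.covariant_sequence_exact₁ _ hS x (Subsingleton.elim _ _) (zero_add 1)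
  obtain ⟨k, rfl⟩ := Ext.homEquiv₀.symm.surjective y
  obtain ⟨l, hl⟩ := h k.hom
  have : k = ModuleCat.ofHom l ≫ ModuleCat.ofHom g := by
    ext x; exact (LinearMap.congr_fun hl x).symm
  rw [this]
  change (Ext.mk₀ _).comp hS.extClass _ = 0
  rw [← Ext.mk₀_comp_mk₀, Ext.comp_assoc_of_second_deg_zero, hS.comp_extClass, Ext.comp_zero]

lemma E1.extend (h3 : E1 A X₃ Y) (k : X₁ →ₗ[A] Y) : ∃ l : X₂ →ₗ[A] Y, l ∘ₗ f = k := by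
  have hS := shortExact_mk f g hf hg hfg
  unfold E1 at *
  obtain ⟨y, hy⟩ := Ext.contravariant_sequence_exact₁ hS _ (Ext.mk₀ (ModuleCat.ofHom k))
    (add_zero 1) (Subsingleton.elim _ _)
  obtain ⟨l, rfl⟩ := Ext.homEquiv₀.symm.surjective y
  change (Ext.mk₀ _).comp (Ext.mk₀ _) _ = _ at hy
  rw [Ext.mk₀_comp_mk₀] at hy
  have := Ext.homEquiv₀.symm.injective hy
  exact ⟨l.hom, congrArg ModuleCat.Hom.hom this⟩

lemma E1.lift (h1 : E1 A Y X₁) (k : Y →ₗ[A] X₃) : ∃ l : Y →ₗ[A] X₂, g ∘ₗ l = k := by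
  have hS := shortExact_mk f g hf hg hfg
  unfold E1 at *
  obtain ⟨y, hy⟩ := Ext.covariant_sequence_exact₃ _ hS (Ext.mk₀ (ModuleCat.ofHom k))
    (zero_add 1) (Subsingleton.elim _ _)
  obtain ⟨l, rfl⟩ := Ext.homEquiv₀.symm.surjective y
  change (Ext.mk₀ _).comp (Ext.mk₀ _) _ = _ at hy
  rw [Ext.mk₀_comp_mk₀] at hy
  have := Ext.homEquiv₀.symm.injective hy
  exact ⟨l.hom, congrArg ModuleCat.Hom.hom this⟩

lemma E1.first_left (h : Subsingleton (Ext (ModuleCat.of A X₃) (ModuleCat.of A Y) 2))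
    (h2 : E1 A X₂ Y) : E1 A X₁ Y := by
  have hS := shortExact_mk f g hf hg hfg
  unfold E1 at *
  refine subsingleton_of_forall_eq 0 fun x => ?_
  obtain ⟨y, rfl⟩ := Ext.contravariant_sequence_exact₁ hS _ x (by norm_num : 1 + 1 = 2)
    (Subsingleton.elim _ _)
  rw [Subsingleton.elim y 0, Ext.comp_zero]

lemma E1.third_right (h : Subsingleton (Ext (ModuleCat.of A Y) (ModuleCat.of A X₁) 2))
    (h2 : E1 A Y X₂) : E1 A Y X₃ := by
  have hS := shortExact_mk f g hf hg hfg
  unfold E1 at *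
  refine subsingleton_of_forall_eq 0 fun x => ?_
  obtain ⟨y, rfl⟩ := Ext.covariant_sequence_exact₃ _ hS x (by norm_num : 1 + 1 = 2)
    (Subsingleton.elim _ _)
  rw [Subsingleton.elim y 0, Ext.zero_comp]

end

lemma E1.of_projective (P Y : Type u) [AddCommGroup P] [AddCommGroup Y] [Module A P] [Module A Y]
    [Module.Projective A P] : E1 A P Y :=
  HasProjectiveDimensionLT.subsingleton (ModuleCat.of A P) 1 1 le_rfl _

lemma E1.of_injective (Y I : Type u) [AddCommGroup I] [AddCommGroup Y] [Module A I] [Module A Y]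
    [Injective (ModuleCat.of A I)] : E1 A Y I :=
  HasInjectiveDimensionLT.subsingleton (ModuleCat.of A I) 1 1 le_rfl _

lemma ext_two (hA : IsHereditaryRing A) (X Y : ModuleCat.{u} A) (n : ℕ) (hn : 2 ≤ n) :
    Subsingleton (Ext X Y n) := by
  let π : (X →₀ A) →ₗ[A] X := Finsupp.linearCombination A id
  have hπ : Function.Surjective π := Finsupp.linearCombination_id_surjective A X
  have := hA (X →₀ A) inferInstance (LinearMap.ker π)
  have hS := shortExact_mk (X₁ := LinearMap.ker π) (LinearMap.ker π).subtype π
    (Submodule.subtype_injective _) hπ (LinearMap.exact_subtype_ker_map π)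
  have h1 : HasProjectiveDimensionLT (ModuleCat.of A (LinearMap.ker π)) 1 := inferInstance
  have h2 : HasProjectiveDimensionLT (ModuleCat.of A (X →₀ A)) 2 :=
    hasProjectiveDimensionLT_of_ge _ 1 2 (by norm_num)
  have h3 : HasProjectiveDimensionLT X 2 := hS.hasProjectiveDimensionLT_X₃ 1 h1 h2
  exact HasProjectiveDimensionLT.subsingleton X 2 n hn _

lemma E1.of_split (F Y : Type u) [AddCommGroup F] [AddCommGroup Y] [Module A F] [Module A Y]
    (h : ∀ (E : Type u) [AddCommGroup E] [Module A E] (i : Y →ₗ[A] E) (p : E →ₗ[A] F),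
      Function.Injective i → Function.Surjective p → Function.Exact i p →
      ∃ r : E →ₗ[A] Y, ∀ y, r (i y) = y) : E1 A F Y := by
  let π : (F →₀ A) →ₗ[A] F := Finsupp.linearCombination A id
  have hπ : Function.Surjective π := Finsupp.linearCombination_id_surjective A F
  refine E1.third_left (X₁ := LinearMap.ker π) (LinearMap.ker π).subtype π
    (Submodule.subtype_injective _) hπ (LinearMap.exact_subtype_ker_map π) Y (E1.of_projective _ _) fun k => ?_
  let d : LinearMap.ker π →ₗ[A] Y × (F →₀ A) := k.prod (-(LinearMap.ker π).subtype)
  let D := LinearMap.range d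
  let i : Y →ₗ[A] (Y × (F →₀ A)) ⧸ D := D.mkQ ∘ₗ LinearMap.inl A _ _
  let p : ((Y × (F →₀ A)) ⧸ D) →ₗ[A] F := D.liftQ (π ∘ₗ LinearMap.snd A _ _) (by
    rintro _ ⟨x, rfl⟩
    simp [d])
  obtain ⟨r, hr⟩ := h _ i p (by
      rw [← LinearMap.ker_eq_bot, LinearMap.ker_eq_bot']
      intro y hy
      have : (y, (0 : F →₀ A)) ∈ D := (Submodule.Quotient.mk_eq_zero D).1 hy
      obtain ⟨x, hx⟩ := this
      have h2 : -(x : F →₀ A) = 0 := congrArg Prod.snd hx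
      have h3 : k x = y := congrArg Prod.fst hx
      have h4 : x = 0 := Subtype.ext (neg_eq_zero.1 h2)
      rw [← h3, h4, map_zero])
    (by
      intro x
      obtain ⟨y, rfl⟩ := hπ x
      exact ⟨D.mkQ (0, y), by simp [p]⟩)
    (by
      intro e
      obtain ⟨⟨y, x⟩, rfl⟩ := D.mkQ_surjective e
      constructor
      · intro hx
        have hx : π x = 0 := by simpa [p] using hx
        refine ⟨y + k ⟨x, hx⟩, ?_⟩
        refine (Submodule.Quotient.eq D).2 ⟨⟨x, hx⟩, ?_⟩
        simp [d]
      · rintro ⟨z, hz⟩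
        rw [← hz]
        simp [i, p])
  refine ⟨r ∘ₗ D.mkQ ∘ₗ LinearMap.inr A _ _, ?_⟩
  ext x
  rw [← hr (k x)]
  refine congrArg r ?_
  refine (Submodule.Quotient.eq D).2 ⟨-x, ?_⟩
  refine Prod.ext ?_ ?_
  · change k (-x) = 0 - k x
    rw [zero_sub]
    exact k.map_neg x
  · simp [d]

lemma injective_quot (hA : IsHereditaryRing A) {I J : Type u} [AddCommGroup I] [AddCommGroup J]
    [Module A I] [Module A J] [Injective (ModuleCat.of A I)] (g : I →ₗ[A] J)
    (hg : Function.Surjective g) : Injective (ModuleCat.of A J) := by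
  refine injective_iff_subsingleton_ext_one.2 fun {Y} => ?_
  exact E1.third_right (LinearMap.ker g).subtype g (Submodule.subtype_injective _) hg
    (LinearMap.exact_subtype_ker_map g) Y (ext_two hA _ _ 2 le_rfl) (E1.of_injective _ _)

end E1

section Wide
variable {A : Type u} [Ring A]

/-- Module-level closure properties of the subcategory. -/
structure Wide (𝒴 : Set (ModuleCat.{u} A)) : Prop where
  iso : ∀ {M N : Type u} [AddCommGroup M] [AddCommGroup N] [Module A M] [Module A N],
    (M ≃ₗ[A] N) → ModuleCat.of A M ∈ 𝒴 → ModuleCat.of A N ∈ 𝒴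
  ker : ∀ {M N : Type u} [AddCommGroup M] [AddCommGroup N] [Module A M] [Module A N]
    (f : M →ₗ[A] N), ModuleCat.of A M ∈ 𝒴 → ModuleCat.of A N ∈ 𝒴 →
    ModuleCat.of A (LinearMap.ker f) ∈ 𝒴
  coker : ∀ {M N : Type u} [AddCommGroup M] [AddCommGroup N] [Module A M] [Module A N]
    (f : M →ₗ[A] N), ModuleCat.of A M ∈ 𝒴 → ModuleCat.of A N ∈ 𝒴 →
    ModuleCat.of A (N ⧸ LinearMap.range f) ∈ 𝒴
  ext : ∀ {X₁ X₂ X₃ : Type u} [AddCommGroup X₁] [AddCommGroup X₂] [AddCommGroup X₃]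
    [Module A X₁] [Module A X₂] [Module A X₃] (f : X₁ →ₗ[A] X₂) (g : X₂ →ₗ[A] X₃),
    Function.Injective f → Function.Surjective g → Function.Exact f g →
    ModuleCat.of A X₁ ∈ 𝒴 → ModuleCat.of A X₃ ∈ 𝒴 → ModuleCat.of A X₂ ∈ 𝒴
  pi : ∀ {ι : Type u} (N : ι → Type u) [∀ i, AddCommGroup (N i)] [∀ i, Module A (N i)],
    (∀ i, ModuleCat.of A (N i) ∈ 𝒴) → ModuleCat.of A (∀ i, N i) ∈ 𝒴
  dsum : ∀ {ι : Type u} (N : ι → Type u) [∀ i, AddCommGroup (N i)] [∀ i, Module A (N i)],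
    (∀ i, ModuleCat.of A (N i) ∈ 𝒴) → ModuleCat.of A (DirectSum ι N) ∈ 𝒴

lemma wide_mk (𝒴 : Set (ModuleCat.{u} A))
    (h_iso : ∀ (X Y : ModuleCat.{u} A), X ∈ 𝒴 → (X ≅ Y) → Y ∈ 𝒴)
    (h_ker : ∀ {X Y : ModuleCat.{u} A} (g : X ⟶ Y), X ∈ 𝒴 → Y ∈ 𝒴 → kernel g ∈ 𝒴)
    (h_coker : ∀ {X Y : ModuleCat.{u} A} (g : X ⟶ Y), X ∈ 𝒴 → Y ∈ 𝒴 → cokernel g ∈ 𝒴)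
    (h_ext : ∀ (E : ShortComplex (ModuleCat.{u} A)), E.ShortExact →
      E.X₁ ∈ 𝒴 → E.X₃ ∈ 𝒴 → E.X₂ ∈ 𝒴)
    (h_prod : ∀ (ι : Type u) (g : ι → ModuleCat.{u} A), (∀ i, g i ∈ 𝒴) → (∏ᶜ g) ∈ 𝒴)
    (h_coprod : ∀ (ι : Type u) (g : ι → ModuleCat.{u} A), (∀ i, g i ∈ 𝒴) → (∐ g) ∈ 𝒴) :
    Wide 𝒴 where
  iso e h := h_iso _ _ h e.toModuleIso
  ker f hM hN := h_iso _ _ (h_ker (ModuleCat.ofHom f) hM hN) (ModuleCat.kernelIsoKer _)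
  coker f hM hN := h_iso _ _ (h_coker (ModuleCat.ofHom f) hM hN)
    (ModuleCat.cokernelIsoRangeQuotient _)
  ext f g hf hg hfg h1 h3 := h_ext _ (shortExact_mk f g hf hg hfg) h1 h3
  pi N _ _ h := h_iso _ _ (h_prod _ (fun i => ModuleCat.of A (N i)) h) (ModuleCat.piIsoPi _)
  dsum {ι} N _ _ h := by
    classical
    exact h_iso _ _ (h_coprod _ (fun i => ModuleCat.of A (N i)) h)
      (ModuleCat.coprodIsoDirectSum _)

variable {𝒴 : Set (ModuleCat.{u} A)} (W : Wide 𝒴)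
variable {M N : Type u} [AddCommGroup M] [AddCommGroup N] [Module A M] [Module A N]

include W

lemma Wide.range (f : M →ₗ[A] N) (hM : ModuleCat.of A M ∈ 𝒴) (hN : ModuleCat.of A N ∈ 𝒴) :
    ModuleCat.of A (LinearMap.range f) ∈ 𝒴 := by
  have := W.ker (LinearMap.range f).mkQ hN (W.coker f hM hN)
  rwa [Submodule.ker_mkQ] at this

lemma Wide.quot (N' : Submodule A N) (hN' : ModuleCat.of A N' ∈ 𝒴) (hN : ModuleCat.of A N ∈ 𝒴) :
    ModuleCat.of A (N ⧸ N') ∈ 𝒴 := by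
  have := W.coker N'.subtype hN' hN
  rwa [Submodule.range_subtype] at this

lemma Wide.comap (f : M →ₗ[A] N) (N' : Submodule A N) (hM : ModuleCat.of A M ∈ 𝒴)
    (hN' : ModuleCat.of A N' ∈ 𝒴) (hN : ModuleCat.of A N ∈ 𝒴) :
    ModuleCat.of A (N'.comap f) ∈ 𝒴 := by
  have := W.ker (N'.mkQ ∘ₗ f) hM (W.quot N' hN' hN)
  rwa [LinearMap.ker_comp, Submodule.ker_mkQ] at this

lemma Wide.map (f : M →ₗ[A] N) (M' : Submodule A M) 
    (hM' : ModuleCat.of A M' ∈ 𝒴) (hN : ModuleCat.of A N ∈ 𝒴) :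
    ModuleCat.of A (M'.map f) ∈ 𝒴 := by
  have := W.range (f ∘ₗ M'.subtype) hM' hN
  rwa [LinearMap.range_comp, Submodule.range_subtype] at this

lemma Wide.iInf {ι : Type u} (N' : ι → Submodule A N) (hN' : ∀ i, ModuleCat.of A (N' i) ∈ 𝒴)
    (hN : ModuleCat.of A N ∈ 𝒴) : ModuleCat.of A (⨅ i, N' i : Submodule A N) ∈ 𝒴 := by
  have := W.ker (LinearMap.pi fun i => (N' i).mkQ) hN (W.pi _ fun i => W.quot (N' i) (hN' i) hN)
  have h : LinearMap.ker (LinearMap.pi fun i => (N' i).mkQ) = ⨅ i, N' i := by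
    rw [LinearMap.ker_pi]
    exact iInf_congr fun i => Submodule.ker_mkQ _
  rwa [h] at this

lemma Wide.iSup {ι : Type u} (N' : ι → Submodule A N) (hN' : ∀ i, ModuleCat.of A (N' i) ∈ 𝒴)
    (hN : ModuleCat.of A N ∈ 𝒴) : ModuleCat.of A (⨆ i, N' i : Submodule A N) ∈ 𝒴 := by
  classical
  have := W.range (DirectSum.toModule A ι N fun i => (N' i).subtype) (W.dsum _ hN') hN
  have h : LinearMap.range (DirectSum.toModule A ι N fun i => (N' i).subtype) = ⨆ i, N' i := by
    rw [Submodule.iSup_eq_range_dfinsupp_lsum]; rfl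
  rwa [h] at this

/-- reduced powers along the filter of cones of finite subsets -/
lemma Wide.reducedPower {S : Type u} (hN : ModuleCat.of A N ∈ 𝒴) :
    ∃ (K : Submodule A (Finset S → N)), ModuleCat.of A ((Finset S → N) ⧸ K) ∈ 𝒴 ∧
      ∀ g, g ∈ K ↔ ∃ t : Finset S, ∀ s, t ⊆ s → g s = 0 := by
  classical
  let V : Finset S → Submodule A (Finset S → N) := fun t =>
    LinearMap.ker (LinearMap.pi fun s : {s : Finset S // t ⊆ s} =>
      (LinearMap.proj s.1 : (Finset S → N) →ₗ[A] N))
  have hV : ∀ t g, g ∈ V t ↔ ∀ s, t ⊆ s → g s = 0 := by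
    intro t g
    simp [V, funext_iff]
  have hpow : ModuleCat.of A (Finset S → N) ∈ 𝒴 := W.pi _ fun _ => hN
  refine ⟨⨆ t, V t, W.quot _ (W.iSup V (fun t => W.ker _ hpow (W.pi _ fun _ => hN)) hpow) hpow, ?_⟩
  intro g
  rw [Submodule.mem_iSup_of_directed]
  · simp [hV]
  · intro s t
    refine ⟨s ∪ t, ?_, ?_⟩
    · intro g hg
      rw [hV] at hg ⊢
      exact fun r hr => hg r (Finset.union_subset_left hr)
    · intro g hg
      rw [hV] at hg ⊢
      exact fun r hr => hg r (Finset.union_subset_right hr)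

/-- solvability of a finite system of linear equations -/
def Sol (A : Type u) [Ring A] {M Y : Type u} [AddCommGroup M] [AddCommGroup Y] [Module A M]
    [Module A Y] (f : M →ₗ[A] Y) (s : Finset ((ℕ →₀ A) × M)) : Prop :=
  ∃ x : ℕ → Y, ∀ e ∈ s, Finsupp.linearCombination A x e.1 + f e.2 = 0

omit W in
lemma Sol.map {M Y Y' : Type u} [AddCommGroup M] [AddCommGroup Y] [Module A M]
    [Module A Y] [AddCommGroup Y'] [Module A Y'] {f : M →ₗ[A] Y} {s : Finset ((ℕ →₀ A) × M)}
    (h : Sol A f s) (g : Y →ₗ[A] Y') : Sol A (g ∘ₗ f) s := by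
  obtain ⟨x, hx⟩ := h
  refine ⟨g ∘ x, fun e he => ?_⟩
  have := congrArg g (hx e he)
  rw [map_add, map_zero] at this
  rw [← Finsupp.apply_linearCombination]
  exact this

omit W in
/-- a finite system in arbitrary variables is solvable if satisfied in universal pointed module. -/
lemma sol_transfer {M Y Y' : Type u} [AddCommGroup M] [AddCommGroup Y] [Module A M]
    [Module A Y] [AddCommGroup Y'] [Module A Y'] {f : M →ₗ[A] Y} {f' : M →ₗ[A] Y'}
    (h : ∀ s, Sol A f s → Sol A f' s) (s : Finset ((Y →₀ A) × M))
    (hs : ∀ e ∈ s, Finsupp.linearCombination A id e.1 + f e.2 = 0) :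
    ∃ φ : Y → Y', ∀ e ∈ s, Finsupp.linearCombination A φ e.1 + f' e.2 = 0 := by
  classical
  let T : Finset Y := s.biUnion fun e => e.1.support
  obtain ⟨em, hem⟩ : ∃ em : Y → ℕ, Set.InjOn em T := by
    have := T.countable_toSet
    exact (Set.countable_iff_exists_injOn).1 this
  let d : ℕ → Y := fun n => if h : ∃ y ∈ T, em y = n then h.choose else 0
  have hd : ∀ y ∈ T, d (em y) = y := by
    intro y hy
    have h : ∃ y' ∈ T, em y' = em y := ⟨y, hy, rfl⟩
    simp only [d, dif_pos h]
    exact hem h.choose_spec.1 hy h.choose_spec.2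
  obtain ⟨x, hx⟩ := h (s.image fun e => (Finsupp.mapDomain em e.1, e.2)) (by
    refine ⟨d, fun e' he' => ?_⟩
    obtain ⟨e, he, rfl⟩ := Finset.mem_image.1 he'
    rw [← hs e he, Finsupp.linearCombination_mapDomain, Finsupp.linearCombination_apply,
      Finsupp.linearCombination_apply]
    congr 1
    refine Finset.sum_congr rfl fun y hy => ?_
    have : y ∈ T := Finset.mem_biUnion.2 ⟨e, he, hy⟩
    simp [hd y this])
  refine ⟨x ∘ em, fun e he => ?_⟩
  have := hx _ (Finset.mem_image_of_mem _ he)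
  rwa [Finsupp.linearCombination_mapDomain] at this

theorem exists_reflection (M : Type u) [AddCommGroup M] [Module A M] :
    ∃ (L : ModuleCat.{u} A) (η : M →ₗ[A] L), L ∈ 𝒴 ∧
      ∀ (Y : ModuleCat.{u} A) (_ : Y ∈ 𝒴) (f : M →ₗ[A] Y), ∃! g : L →ₗ[A] Y, g ∘ₗ η = f := by
  classical
  let Bad := {s : Finset ((ℕ →₀ A) × M) //
    ∃ (Y : ModuleCat.{u} A) (_ : Y ∈ 𝒴) (f : M →ₗ[A] Y), ¬ Sol A f s}
  choose Y hY f hf using fun s : Bad => s.2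
  let Y₀ := ∀ s : Bad, Y s
  have hY₀ : ModuleCat.of A Y₀ ∈ 𝒴 := W.pi (fun s : Bad => Y s) hY
  let f₀ : M →ₗ[A] Y₀ := LinearMap.pi f
  have huniv : ∀ (Z : ModuleCat.{u} A) (_ : Z ∈ 𝒴) (g : M →ₗ[A] Z) (s), Sol A f₀ s → Sol A g s := by
    intro Z hZ g s hs
    by_contra hcon
    let b : Bad := ⟨s, Z, hZ, g, hcon⟩
    exact hf b (hs.map (LinearMap.proj b))
  -- the dense hull of `M` in `Y₀`
  let ι := {N : Submodule A Y₀ // ModuleCat.of A N ∈ 𝒴 ∧ LinearMap.range f₀ ≤ N}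
  let L : Submodule A Y₀ := ⨅ i : ι, i.1
  have hL : ModuleCat.of A L ∈ 𝒴 := W.iInf (fun i : ι => i.1) (fun i => i.2.1) hY₀
  have hfL : ∀ m, f₀ m ∈ L := fun m => (Submodule.mem_iInf _).2 fun i => i.2.2 ⟨m, rfl⟩
  have hmin : ∀ N : Submodule A Y₀, ModuleCat.of A N ∈ 𝒴 → (∀ m, f₀ m ∈ N) → L ≤ N := by
    intro N hN hm
    exact iInf_le (fun i : ι => i.1) ⟨N, hN, by rintro _ ⟨m, rfl⟩; exact hm m⟩
  let η : M →ₗ[A] L := f₀.codRestrict L hfL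
  have hmin' : ∀ N : Submodule A L, ModuleCat.of A N ∈ 𝒴 → (∀ m, η m ∈ N) → N = ⊤ := by
    intro N hN hm
    have h1 := W.map L.subtype N hN hY₀
    have h2 := hmin _ h1 (fun m => ⟨η m, hm m, rfl⟩)
    rw [eq_top_iff]
    rintro x -
    obtain ⟨y, hy, hyx⟩ := h2 x.2
    rwa [← Subtype.ext hyx]
  refine ⟨ModuleCat.of A L, η, hL, fun Z hZ g => ?_⟩
  refine existsUnique_of_exists_of_unique ?_ ?_
  · let S := {e : (Y₀ →₀ A) × M // Finsupp.linearCombination A id e.1 + f₀ e.2 = 0}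
    obtain ⟨K, hK, hKmem⟩ := W.reducedPower (S := S) (N := Z) hZ
    have hφ : ∀ s : Finset S, ∃ φ : Y₀ → Z, ∀ e ∈ s,
        Finsupp.linearCombination A φ e.1.1 + g e.1.2 = 0 := by
      intro s
      obtain ⟨φ, hφ⟩ := sol_transfer (huniv Z hZ g) (s.image Subtype.val) (by
        intro e he
        obtain ⟨e', _, rfl⟩ := Finset.mem_image.1 he
        exact e'.2)
      exact ⟨φ, fun e he => hφ _ (Finset.mem_image_of_mem _ he)⟩
    choose φ hφ using hφ
    have key : ∀ e : S, (fun s => Finsupp.linearCombination A (φ s) e.1.1 + g e.1.2) ∈ K := by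
      intro e
      exact (hKmem _).2 ⟨{e}, fun s hs => hφ s e (hs (Finset.mem_singleton_self e))⟩
    let Φ : Y₀ →ₗ[A] (Finset S → Z) ⧸ K :=
      { toFun := fun y => K.mkQ (fun s => φ s y)
        map_add' := by
          intro y z
          rw [← map_add]
          refine (Submodule.Quotient.eq K).2 ?_
          convert key ⟨(Finsupp.single (y + z) 1 - Finsupp.single y 1 - Finsupp.single z 1, 0),
            by simp [Finsupp.linearCombination_single]⟩ using 1
          funext s
          simp [Finsupp.linearCombination_single, sub_sub]
        map_smul' := by
          intro a y
          rw [RingHom.id_apply, ← map_smul]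
          refine (Submodule.Quotient.eq K).2 ?_
          convert key ⟨(Finsupp.single (a • y) 1 - Finsupp.single y a, 0),
            by simp [Finsupp.linearCombination_single]⟩ using 1
          funext s
          simp [Finsupp.linearCombination_single] }
    let Δ : Z →ₗ[A] (Finset S → Z) ⧸ K := K.mkQ ∘ₗ LinearMap.pi fun _ => LinearMap.id
    have hΔ : Function.Injective Δ := by
      rw [← LinearMap.ker_eq_bot, LinearMap.ker_eq_bot']
      intro z hz
      obtain ⟨t, ht⟩ := (hKmem _).1 ((Submodule.Quotient.mk_eq_zero K).1 hz)
      exact ht t (Finset.Subset.refl t)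
    have hΦ : ∀ m, Φ (f₀ m) = Δ (g m) := by
      intro m
      refine (Submodule.Quotient.eq K).2 ?_
      convert key ⟨(Finsupp.single (f₀ m) 1, -m),
            by simp [Finsupp.linearCombination_single]⟩ using 1
      funext s
      simp [Finsupp.linearCombination_single, sub_eq_add_neg]
    have hR : ModuleCat.of A (LinearMap.range Δ) ∈ 𝒴 := W.range Δ hZ hK
    have hLle := hmin _ (W.comap Φ _ hY₀ hR hK) (fun m => by
      rw [Submodule.mem_comap, hΦ]; exact ⟨_, rfl⟩)
    let e := LinearEquiv.ofInjective Δ hΔ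
    let Ψ : L →ₗ[A] LinearMap.range Δ :=
      (Φ ∘ₗ L.subtype).codRestrict _ (fun x => hLle x.2)
    refine ⟨e.symm.toLinearMap ∘ₗ Ψ, ?_⟩
    ext m
    change e.symm (Ψ (η m)) = g m
    rw [LinearEquiv.symm_apply_eq]
    exact Subtype.ext (hΦ m)
  · intro g₁ g₂ h₁ h₂
    have := hmin' (LinearMap.ker (g₁ - g₂)) (W.ker _ hL hZ) (fun m => by
      have : g₁ (η m) = g₂ (η m) := LinearMap.congr_fun (h₁.trans h₂.symm) m
      simp [this])
    rwa [LinearMap.ker_eq_top, sub_eq_zero] at this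

end Wide

section Coreflection
variable {A : Type u} [Ring A]

lemma exists_desc {P M N : Type u} [AddCommGroup P] [AddCommGroup M] [AddCommGroup N]
    [Module A P] [Module A M] [Module A N] (p : P →ₗ[A] M) (hp : Function.Surjective p)
    (h : P →ₗ[A] N) (hk : ∀ x, p x = 0 → h x = 0) : ∃ g : M →ₗ[A] N, ∀ x, g (p x) = h x := by
  refine ⟨(LinearMap.ker p).liftQ h (fun x hx => hk x hx) ∘ₗ
    (p.quotKerEquivOfSurjective hp).symm.toLinearMap, fun x => ?_⟩
  have : (p.quotKerEquivOfSurjective hp).symm (p x) = (LinearMap.ker p).mkQ x := by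
    rw [LinearEquiv.symm_apply_eq]; rfl
  rw [LinearMap.comp_apply, LinearEquiv.coe_coe, this]
  rfl

variable {𝒴 : Set (ModuleCat.{u} A)} (W : Wide 𝒴)
include W

theorem exists_coreflection (M : Type u) [AddCommGroup M] [Module A M] :
    ∃ (R : ModuleCat.{u} A) (ε : R →ₗ[A] M), R ∈ 𝒴 ∧
      ∀ (Y : ModuleCat.{u} A) (_ : Y ∈ 𝒴) (f : Y →ₗ[A] M), ∃! g : Y →ₗ[A] R, ε ∘ₗ g = f := by
  classical
  obtain ⟨B, b, hB, huB⟩ := exists_reflection W A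
  let C := DirectSum (B →ₗ[A] M) fun _ => B
  have hC : ModuleCat.of A C ∈ 𝒴 := W.dsum (fun _ => B) fun _ => hB
  let c : C →ₗ[A] M := DirectSum.toModule A _ M fun h => h
  let ι := {N : Submodule A C // ModuleCat.of A N ∈ 𝒴 ∧ N ≤ LinearMap.ker c}
  let K : Submodule A C := ⨆ i : ι, i.1
  have hK : ModuleCat.of A K ∈ 𝒴 := W.iSup (fun i : ι => i.1) (fun i => i.2.1) hC
  have hKc : K ≤ LinearMap.ker c := iSup_le fun i => i.2.2
  have hmax : ∀ N : Submodule A C, ModuleCat.of A N ∈ 𝒴 → N ≤ LinearMap.ker c → N ≤ K :=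
    fun N h1 h2 => le_iSup (fun i : ι => i.1) ⟨N, h1, h2⟩
  have hR : ModuleCat.of A (C ⧸ K) ∈ 𝒴 := W.quot K hK hC
  let ε : (C ⧸ K) →ₗ[A] M := K.liftQ c hKc
  refine ⟨ModuleCat.of A (C ⧸ K), ε, hR, fun Y hY f => ?_⟩
  refine existsUnique_of_exists_of_unique ?_ ?_
  · have hβ : ∀ y : Y, ∃ β : B →ₗ[A] Y, β (b 1) = y := by
      intro y
      obtain ⟨β, hβ, -⟩ := huB Y hY (LinearMap.toSpanSingleton A Y y)
      refine ⟨β, ?_⟩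
      have := LinearMap.congr_fun hβ 1
      simpa using this
    choose β hβ using hβ
    let p : DirectSum Y (fun _ => B) →ₗ[A] Y := DirectSum.toModule A _ _ β
    have hp : Function.Surjective p := fun y =>
      ⟨DirectSum.lof A Y (fun _ => B) y (b 1), by
        simp only [p]; rw [DirectSum.toModule_lof, hβ]⟩
    let q : DirectSum Y (fun _ => B) →ₗ[A] C :=
      DirectSum.toModule A _ _ fun y => DirectSum.lof A (B →ₗ[A] M) (fun _ => B) (f ∘ₗ β y)
    have hcq : c ∘ₗ q = f ∘ₗ p := by
      refine DirectSum.linearMap_ext A fun y => ?_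
      ext x
      simp only [LinearMap.comp_apply, p, q, c]
      rw [DirectSum.toModule_lof, DirectSum.toModule_lof, DirectSum.toModule_lof]
      rfl
    have hD : ModuleCat.of A (DirectSum Y (fun _ => B)) ∈ 𝒴 := W.dsum (fun _ => B) fun _ => hB
    have hle : (LinearMap.ker p).map q ≤ K := by
      refine hmax _ (W.map q _ (W.ker p hD hY) hC) ?_
      rintro _ ⟨x, hx, rfl⟩
      have h1 : c (q x) = f (p x) := LinearMap.congr_fun hcq x
      have h2 : p x = 0 := hx
      rw [LinearMap.mem_ker, h1, h2, map_zero]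
    obtain ⟨g, hg⟩ := exists_desc p hp (K.mkQ ∘ₗ q) (fun x hx =>
      (Submodule.Quotient.mk_eq_zero K).2 (hle ⟨x, hx, rfl⟩))
    refine ⟨g, ?_⟩
    ext y
    obtain ⟨x, rfl⟩ := hp y
    have h1 : c (q x) = f (p x) := LinearMap.congr_fun hcq x
    rw [LinearMap.comp_apply, hg, ← h1]
    rfl
  · intro g₁ g₂ h₁ h₂
    let h : Y →ₗ[A] C ⧸ K := g₁ - g₂
    have hε : ∀ y, ε (h y) = 0 := by
      intro y
      have : ε (g₁ y) = ε (g₂ y) := LinearMap.congr_fun (h₁.trans h₂.symm) y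
      simp [h, this]
    have := hmax ((LinearMap.range h).comap K.mkQ)
      (W.comap K.mkQ _ hC (W.range h hY hR) hR) (by
        rintro x ⟨y, hy⟩
        have h1 : ε (K.mkQ x) = 0 := by rw [← hy, hε]
        exact h1)
    have h0 : h = 0 := by
      ext y
      obtain ⟨x, hx⟩ := K.mkQ_surjective (h y)
      rw [← hx]
      exact (Submodule.Quotient.mk_eq_zero K).2 (this ⟨y, hx.symm⟩)
    exact sub_eq_zero.1 h0

end Coreflection

section Main
variable {A : Type u} [Ring A]

lemma fiveTerm_mk (𝒰 𝒱 : Set (ModuleCat.{u} A)) {M V₁ U₁ V₂ U₂ : Type u}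
    [AddCommGroup M] [AddCommGroup V₁] [AddCommGroup U₁] [AddCommGroup V₂] [AddCommGroup U₂]
    [Module A M] [Module A V₁] [Module A U₁] [Module A V₂] [Module A U₂]
    (f₁ : V₁ →ₗ[A] U₁) (f₂ : U₁ →ₗ[A] M) (f₃ : M →ₗ[A] V₂) (f₄ : V₂ →ₗ[A] U₂)
    (hU₁ : ModuleCat.of A U₁ ∈ 𝒰) (hU₂ : ModuleCat.of A U₂ ∈ 𝒰)
    (hV₁ : ModuleCat.of A V₁ ∈ 𝒱) (hV₂ : ModuleCat.of A V₂ ∈ 𝒱)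
    (h₁ : Function.Injective f₁) (h₁₂ : Function.Exact f₁ f₂) (h₂₃ : Function.Exact f₂ f₃)
    (h₃₄ : Function.Exact f₃ f₄) (h₄ : Function.Surjective f₄) :
    FiveTermSequence 𝒰 𝒱 (ModuleCat.of A M) := by
  refine ⟨ModuleCat.of A V₁, ModuleCat.of A U₁, ModuleCat.of A V₂, ModuleCat.of A U₂,
    ModuleCat.ofHom f₁, ModuleCat.ofHom f₂, ModuleCat.ofHom f₃, ModuleCat.ofHom f₄,
    ?_, ?_, ?_, hU₁, hU₂, hV₁, hV₂, ?_, ?_, ?_, ?_, ?_⟩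
  · rw [← ModuleCat.ofHom_comp, h₁₂.linearMap_comp_eq_zero]; rfl
  · rw [← ModuleCat.ofHom_comp, h₂₃.linearMap_comp_eq_zero]; rfl
  · rw [← ModuleCat.ofHom_comp, h₃₄.linearMap_comp_eq_zero]; rfl
  · exact (ModuleCat.mono_iff_injective _).2 h₁
  · exact (ModuleCat.epi_iff_surjective _).2 h₄
  · exact ModuleCat.shortComplex_exact _ h₁₂
  · exact ModuleCat.shortComplex_exact _ h₂₃
  · exact ModuleCat.shortComplex_exact _ h₃₄

variable [HasExt.{u} (ModuleCat.{u} A)] (hA : IsHereditaryRing A)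

include hA in
lemma perp_of {X Y : Type u} [AddCommGroup X] [AddCommGroup Y] [Module A X] [Module A Y]
    (h0 : ∀ k : X →ₗ[A] Y, k = 0) (h1 : E1 A X Y) (n : ℕ) :
    Subsingleton (Ext (ModuleCat.of A X) (ModuleCat.of A Y) n) := by
  match n with
  | 0 =>
    refine @Equiv.subsingleton _ _ Ext.homEquiv₀ ⟨fun a b => ?_⟩
    ext x
    rw [h0 a.hom, h0 b.hom]
  | 1 => exact h1
  | n + 2 => exact ext_two hA _ _ _ (by omega)

variable {𝒴 : Set (ModuleCat.{u} A)} (W : Wide 𝒴)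

section
variable {E F : Type u} [AddCommGroup E] [AddCommGroup F] [Module A E] [Module A F]

include hA in
lemma orth_left (f : E →ₗ[A] F)
    (hE : ∀ Y : ModuleCat.{u} A, Y ∈ 𝒴 → E1 A E Y) (hF : ∀ Y : ModuleCat.{u} A, Y ∈ 𝒴 → E1 A F Y)
    (hu : ∀ Y : ModuleCat.{u} A, Y ∈ 𝒴 → ∀ k : E →ₗ[A] Y, ∃! g : F →ₗ[A] Y, g ∘ₗ f = k)
    (Y : ModuleCat.{u} A) (hY : Y ∈ 𝒴) (n : ℕ) :
    Subsingleton (Ext (ModuleCat.of A (LinearMap.ker f)) Y n) ∧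
    Subsingleton (Ext (ModuleCat.of A (F ⧸ LinearMap.range f)) Y n) := by
  have hinj := Submodule.subtype_injective (LinearMap.range f)
  have hsur := Submodule.mkQ_surjective (LinearMap.range f)
  have hex := LinearMap.exact_subtype_mkQ (LinearMap.range f)
  have hinj' := Submodule.subtype_injective (LinearMap.ker f)
  have hsur' := f.surjective_rangeRestrict
  have hex' : Function.Exact (LinearMap.ker f).subtype f.rangeRestrict := by
    rw [LinearMap.exact_iff]; simp
  have hr : E1 A (LinearMap.range f) Y :=
    E1.first_left _ _ hinj hsur hex Y (ext_two hA _ _ 2 le_rfl) (hF Y hY)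
  constructor
  · refine perp_of hA (Y := Y) (fun k => ?_)
      (E1.first_left _ _ hinj' hsur' hex' Y (ext_two hA _ _ 2 le_rfl) (hE Y hY)) n
    obtain ⟨l, hl⟩ := E1.extend _ _ hinj' hsur' hex' Y hr k
    obtain ⟨g, hg, -⟩ := hu Y hY l
    rw [← hl, ← hg]
    ext x
    simp
  · refine perp_of hA (Y := Y) (fun k => ?_)
      (E1.third_left _ _ hinj hsur hex Y (hF Y hY) fun k => ?_) n
    · have : k ∘ₗ (LinearMap.range f).mkQ = 0 := by
        refine (hu Y hY 0).unique ?_ (by simp)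
        ext x
        have h0 : (LinearMap.range f).mkQ (f x) = 0 :=
          (Submodule.Quotient.mk_eq_zero _).2 ⟨x, rfl⟩
        change k ((LinearMap.range f).mkQ (f x)) = 0
        rw [h0, map_zero]
      ext x
      exact LinearMap.congr_fun this x
    · obtain ⟨g, hg, -⟩ := hu Y hY (k ∘ₗ f.rangeRestrict)
      refine ⟨g, ?_⟩
      ext x
      obtain ⟨x, rfl⟩ := hsur' x
      exact LinearMap.congr_fun hg x

include hA in
lemma orth_right (f : F →ₗ[A] E)
    (hE : ∀ Y : ModuleCat.{u} A, Y ∈ 𝒴 → E1 A Y E) (hF : ∀ Y : ModuleCat.{u} A, Y ∈ 𝒴 → E1 A Y F)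
    (hu : ∀ Y : ModuleCat.{u} A, Y ∈ 𝒴 → ∀ k : Y →ₗ[A] E, ∃! g : Y →ₗ[A] F, f ∘ₗ g = k)
    (Y : ModuleCat.{u} A) (hY : Y ∈ 𝒴) (n : ℕ) :
    Subsingleton (Ext Y (ModuleCat.of A (LinearMap.ker f)) n) ∧
    Subsingleton (Ext Y (ModuleCat.of A (E ⧸ LinearMap.range f)) n) := by
  have hinj := Submodule.subtype_injective (LinearMap.range f)
  have hsur := Submodule.mkQ_surjective (LinearMap.range f)
  have hex := LinearMap.exact_subtype_mkQ (LinearMap.range f)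
  have hinj' := Submodule.subtype_injective (LinearMap.ker f)
  have hsur' := f.surjective_rangeRestrict
  have hex' : Function.Exact (LinearMap.ker f).subtype f.rangeRestrict := by
    rw [LinearMap.exact_iff]; simp
  have hr : E1 A Y (LinearMap.range f) :=
    E1.third_right _ _ hinj' hsur' hex' Y (ext_two hA _ _ 2 le_rfl) (hF Y hY)
  constructor
  · refine perp_of hA (X := Y) (fun k => ?_)
      (E1.first_right _ _ hinj' hsur' hex' Y (hF Y hY) fun k => ?_) n
    · have : (LinearMap.ker f).subtype ∘ₗ k = 0 := by
        refine (hu Y hY 0).unique ?_ (by simp)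
        ext x
        simp
      ext x
      exact LinearMap.congr_fun this x
    · obtain ⟨g, hg, -⟩ := hu Y hY ((LinearMap.range f).subtype ∘ₗ k)
      refine ⟨g, ?_⟩
      ext x
      exact LinearMap.congr_fun hg x
  · refine perp_of hA (X := Y) (fun k => ?_)
      (E1.third_right _ _ hinj hsur hex Y (ext_two hA _ _ 2 le_rfl) (hE Y hY)) n
    obtain ⟨l, hl⟩ := E1.lift _ _ hinj hsur hex Y hr k
    obtain ⟨g, hg, -⟩ := hu Y hY l
    rw [← hl, ← hg]
    ext x
    simp

end

include W in
lemma E1_reflection {P : Type u} [AddCommGroup P] [Module A P] [Module.Projective A P]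
    (L : ModuleCat.{u} A) (η : P →ₗ[A] L) (hL : L ∈ 𝒴)
    (hu : ∀ (Y : ModuleCat.{u} A) (_ : Y ∈ 𝒴) (f : P →ₗ[A] Y), ∃! g : L →ₗ[A] Y, g ∘ₗ η = f)
    (Y : ModuleCat.{u} A) (hY : Y ∈ 𝒴) : E1 A L Y := by
  refine E1.of_split _ _ fun E _ _ i p hi hp hip => ?_
  have hE : ModuleCat.of A E ∈ 𝒴 := W.ext i p hi hp hip hY hL
  obtain ⟨l, hl⟩ := E1.lift i p hi hp hip P (E1.of_projective _ _) η
  obtain ⟨g, hg, -⟩ := hu (ModuleCat.of A E) hE l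
  change L →ₗ[A] E at g
  have hs : p ∘ₗ g = LinearMap.id := by
    refine (hu L hL η).unique ?_ (by ext; simp)
    rw [LinearMap.comp_assoc]
    exact (congrArg p.comp hg).trans hl
  have hs' : ∀ x, p (g x) = x := fun x => LinearMap.congr_fun hs x
  let e := LinearEquiv.ofInjective i hi
  let s : E →ₗ[A] LinearMap.range i := (LinearMap.id - g ∘ₗ p).codRestrict _ (fun x =>
    (hip _).1 (by simp [hs']))
  refine ⟨e.symm.toLinearMap ∘ₗ s, fun y => ?_⟩
  change e.symm (s (i y)) = y
  rw [LinearEquiv.symm_apply_eq]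
  refine Subtype.ext ?_
  have : p (i y) = 0 := (hip _).2 ⟨y, rfl⟩
  change i y - g (p (i y)) = i y
  rw [this, map_zero, sub_zero]

include W in
lemma E1_coreflection {I : Type u} [AddCommGroup I] [Module A I] [Injective (ModuleCat.of A I)]
    (R : ModuleCat.{u} A) (ε : R →ₗ[A] I) (hR : R ∈ 𝒴)
    (hu : ∀ (Y : ModuleCat.{u} A) (_ : Y ∈ 𝒴) (f : Y →ₗ[A] I), ∃! g : Y →ₗ[A] R, ε ∘ₗ g = f)
    (Y : ModuleCat.{u} A) (hY : Y ∈ 𝒴) : E1 A Y R := by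
  refine E1.of_split _ _ fun E _ _ i p hi hp hip => ?_
  have hE : ModuleCat.of A E ∈ 𝒴 := W.ext i p hi hp hip hR hY
  obtain ⟨l, hl⟩ := E1.extend i p hi hp hip I (E1.of_injective _ _) ε
  obtain ⟨g, hg, -⟩ := hu (ModuleCat.of A E) hE l
  change E →ₗ[A] R at g
  have hs : g ∘ₗ i = LinearMap.id := by
    refine (hu R hR ε).unique ?_ (by ext; simp)
    rw [← LinearMap.comp_assoc]
    exact (congrArg (fun t => t ∘ₗ i) hg).trans hl
  exact ⟨g, fun y => LinearMap.congr_fun hs y⟩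

end Main

section Final
variable {A : Type u} [Ring A] [HasExt.{u} (ModuleCat.{u} A)] (hA : IsHereditaryRing A)
variable {𝒴 : Set (ModuleCat.{u} A)} (W : Wide 𝒴)
include hA W

theorem fiveTerm_left (M : Type u) [AddCommGroup M] [Module A M] :
    FiveTermSequence {X | ∀ Y ∈ 𝒴, ∀ n : ℕ, Subsingleton (Ext X Y n)} 𝒴
      (ModuleCat.of A M) := by
  obtain ⟨P, _, _, _, π, hπ⟩ : ∃ (P : Type u) (_ : AddCommGroup P) (_ : Module A P)
      (_ : Module.Projective A P) (π : P →ₗ[A] M), Function.Surjective π :=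
    ⟨M →₀ A, inferInstance, inferInstance, inferInstance, Finsupp.linearCombination A id,
      Finsupp.linearCombination_id_surjective A M⟩
  let Q := LinearMap.ker π
  have hQ : Module.Projective A Q := hA P inferInstance Q
  obtain ⟨LP, ηP, hLP, huP⟩ := exists_reflection W P
  obtain ⟨LQ, ηQ, hLQ, huQ⟩ := exists_reflection W Q
  obtain ⟨lam, hlam, -⟩ := huQ LP hLP (ηP ∘ₗ Q.subtype)
  have hlam' : ∀ q : Q, lam (ηQ q) = ηP q := fun q => LinearMap.congr_fun hlam q
  let d : Q →ₗ[A] P × LQ := Q.subtype.prod (-ηQ)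
  have hd : ∀ q, d q = ((q : P), -ηQ q) := fun q => rfl
  have hdinj : Function.Injective d := fun a b h => Subtype.ext (congrArg Prod.fst h)
  let D := LinearMap.range d
  let E := (P × LQ) ⧸ D
  have hED : ∀ x : P × LQ, D.mkQ x = 0 ↔ ∃ q, d q = x := fun x =>
    Submodule.Quotient.mk_eq_zero D
  have hdD : Function.Exact d D.mkQ := fun x => hED x
  let f : E →ₗ[A] LP := D.liftQ (ηP.coprod lam) (by
    rintro _ ⟨q, rfl⟩
    simp [hd, hlam'])
  have hf : ∀ p l, f (D.mkQ (p, l)) = ηP p + lam l := fun p l => by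
    change (ηP.coprod lam) (p, l) = _
    rw [LinearMap.coprod_apply]
  let t : E →ₗ[A] M := D.liftQ (π ∘ₗ LinearMap.fst A P LQ) (by
    rintro _ ⟨q, rfl⟩
    exact q.2)
  have ht : ∀ p l, t (D.mkQ (p, l)) = π p := fun p l => rfl
  have hsurj : ∀ e : E, ∃ p l, D.mkQ (p, l) = e := fun e => by
    obtain ⟨⟨p, l⟩, h⟩ := D.mkQ_surjective e
    exact ⟨p, l, h⟩
  have hE1P : ∀ Y : ModuleCat.{u} A, Y ∈ 𝒴 → E1 A LP Y := E1_reflection W LP ηP hLP huP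
  have hE1Q : ∀ Y : ModuleCat.{u} A, Y ∈ 𝒴 → E1 A LQ Y := E1_reflection W LQ ηQ hLQ huQ
  have hE1E : ∀ Y : ModuleCat.{u} A, Y ∈ 𝒴 → E1 A E Y := by
    intro Y hY
    refine E1.third_left d D.mkQ hdinj D.mkQ_surjective hdD Y
      (E1.mid_left (LinearMap.inl A P LQ) (LinearMap.snd A P LQ) LinearMap.inl_injective
        LinearMap.snd_surjective (Function.Exact.inl_snd) Y
        (E1.of_projective _ _) (hE1Q Y hY)) fun k => ?_
    obtain ⟨g, hg, -⟩ := huQ Y hY k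
    refine ⟨-(g ∘ₗ LinearMap.snd A P LQ), ?_⟩
    ext q
    have := LinearMap.congr_fun hg q
    simpa [hd] using this
  have hu : ∀ Y : ModuleCat.{u} A, Y ∈ 𝒴 → ∀ k : E →ₗ[A] Y, ∃! g : LP →ₗ[A] Y, g ∘ₗ f = k := by
    intro Y hY k
    refine existsUnique_of_exists_of_unique ?_ ?_
    · obtain ⟨g, hg, -⟩ := huP Y hY (k ∘ₗ D.mkQ ∘ₗ LinearMap.inl A P LQ)
      have hg' : ∀ p, g (ηP p) = k (D.mkQ (p, 0)) := fun p => LinearMap.congr_fun hg p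
      have h2 : g ∘ₗ lam = k ∘ₗ D.mkQ ∘ₗ LinearMap.inr A P LQ := by
        refine (huQ Y hY (g ∘ₗ lam ∘ₗ ηQ)).unique rfl ?_
        ext q
        change k (D.mkQ (0, ηQ q)) = g (lam (ηQ q))
        rw [hlam', hg']
        have : D.mkQ ((q : P), 0) - D.mkQ (0, ηQ q) = 0 := by
          rw [← map_sub, hED]
          exact ⟨q, by simp [hd]⟩
        rw [sub_eq_zero.1 this]
      refine ⟨g, ?_⟩
      refine LinearMap.ext fun e => ?_
      obtain ⟨p, l, rfl⟩ := hsurj e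
      have h3 : g (lam l) = k (D.mkQ (0, l)) := LinearMap.congr_fun h2 l
      rw [LinearMap.comp_apply, hf, map_add, hg', h3, ← map_add, ← map_add]
      simp
    · intro g₁ g₂ h₁ h₂
      refine (huP Y hY (g₂ ∘ₗ ηP)).unique ?_ rfl
      ext p
      have := LinearMap.congr_fun (h₁.trans h₂.symm) (D.mkQ (p, 0))
      rw [LinearMap.comp_apply, LinearMap.comp_apply, hf] at this
      simpa using this
  have horth := orth_left hA f hE1E hE1P hu
  let f₁ : LinearMap.ker lam →ₗ[A] LinearMap.ker f :=
    (D.mkQ ∘ₗ LinearMap.inr A P LQ ∘ₗ (LinearMap.ker lam).subtype).codRestrict _ (fun l => by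
      have h := l.2
      rw [LinearMap.mem_ker] at h ⊢
      change f (D.mkQ (0, l.1)) = 0
      rw [hf, h, map_zero, add_zero])
  have hf₁ : ∀ l, (f₁ l : E) = D.mkQ (0, l.1) := fun l => rfl
  obtain ⟨f₃, hf₃⟩ := exists_desc π hπ ((LinearMap.range lam).mkQ ∘ₗ ηP) (fun x hx => by
    refine (Submodule.Quotient.mk_eq_zero _).2 ⟨ηQ ⟨x, hx⟩, ?_⟩
    rw [hlam'])
  let f₄ : (LP ⧸ LinearMap.range lam) →ₗ[A] (LP ⧸ LinearMap.range f) :=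
    (LinearMap.range lam).liftQ (LinearMap.range f).mkQ (by
      rintro _ ⟨l, rfl⟩
      rw [Submodule.ker_mkQ]
      exact ⟨D.mkQ (0, l), by rw [hf, map_zero, zero_add]⟩)
  refine fiveTerm_mk _ _ (V₁ := LinearMap.ker lam) (U₁ := LinearMap.ker f) f₁
    (t ∘ₗ (LinearMap.ker f).subtype) f₃ f₄
    (fun Y hY n => (horth Y hY n).1) (fun Y hY n => (horth Y hY n).2)
    (W.ker lam hLQ hLP) (W.coker lam hLQ hLP) ?_ ?_ ?_ ?_ ?_
  · rw [← LinearMap.ker_eq_bot, LinearMap.ker_eq_bot']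
    intro l hl
    have : D.mkQ (0, l.1) = 0 := congrArg Subtype.val hl
    obtain ⟨q, hq⟩ := (hED _).1 this
    have h1 : (q : P) = 0 := congrArg Prod.fst hq
    have h2 : -ηQ q = l.1 := congrArg Prod.snd hq
    have h3 : q = 0 := Subtype.ext h1
    refine Subtype.ext ?_
    rw [← h2, h3]
    simp
  · rintro ⟨e, he⟩
    obtain ⟨p, l, rfl⟩ := hsurj e
    rw [LinearMap.mem_ker, hf] at he
    change π p = 0 ↔ _
    constructor
    · intro hp
      let q : Q := ⟨p, hp⟩
      refine ⟨⟨l + ηQ q, ?_⟩, Subtype.ext ?_⟩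
      · rw [LinearMap.mem_ker, map_add, hlam', add_comm]
        exact he
      · rw [hf₁]
        refine sub_eq_zero.1 ?_
        rw [← map_sub, hED]
        exact ⟨-q, by simp [d, q]⟩
    · rintro ⟨l', hl'⟩
      have := congrArg (fun x : LinearMap.ker f => t x.1) hl'
      simp only [hf₁, ht, map_zero] at this
      exact this.symm
  · intro m
    obtain ⟨p, rfl⟩ := hπ m
    rw [hf₃]
    change (LinearMap.range lam).mkQ (ηP p) = 0 ↔ _
    rw [← LinearMap.mem_ker, Submodule.ker_mkQ]
    constructor
    · rintro ⟨l, hl⟩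
      refine ⟨⟨D.mkQ (p, -l), ?_⟩, rfl⟩
      rw [LinearMap.mem_ker, hf, map_neg, hl, add_neg_cancel]
    · rintro ⟨⟨e, he⟩, hx⟩
      obtain ⟨p', l, rfl⟩ := hsurj e
      change π p' = π p at hx
      rw [LinearMap.mem_ker, hf] at he
      have hq : p - p' ∈ Q := by
        rw [LinearMap.mem_ker, map_sub, hx, sub_self]
      refine ⟨ηQ ⟨p - p', hq⟩ - l, ?_⟩
      rw [map_sub, hlam', map_sub, sub_sub, he, sub_zero]
  · intro x
    obtain ⟨x, rfl⟩ := Submodule.mkQ_surjective _ x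
    change (LinearMap.range f).mkQ x = 0 ↔ _
    rw [← LinearMap.mem_ker, Submodule.ker_mkQ]
    constructor
    · rintro ⟨e, rfl⟩
      obtain ⟨p, l, rfl⟩ := hsurj e
      refine ⟨π p, ?_⟩
      rw [hf₃, hf]
      refine (Submodule.Quotient.eq _).2 ⟨-l, ?_⟩
      simp
    · rintro ⟨m, hm⟩
      obtain ⟨p, rfl⟩ := hπ m
      rw [hf₃] at hm
      obtain ⟨l, hl⟩ := (Submodule.Quotient.eq _).1 hm
      refine ⟨D.mkQ (p, -l), ?_⟩
      rw [hf, map_neg, hl]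
      abel
  · intro x
    obtain ⟨x, rfl⟩ := Submodule.mkQ_surjective _ x
    exact ⟨(LinearMap.range lam).mkQ x, rfl⟩

theorem fiveTerm_right (M : Type u) [AddCommGroup M] [Module A M] :
    FiveTermSequence 𝒴 {Z | ∀ Y ∈ 𝒴, ∀ n : ℕ, Subsingleton (Ext Y Z n)}
      (ModuleCat.of A M) := by
  obtain ⟨I, _, _, _, i, hi⟩ : ∃ (I : Type u) (_ : AddCommGroup I) (_ : Module A I)
      (_ : Injective (ModuleCat.of A I)) (i : M →ₗ[A] I), Function.Injective i :=
    ⟨(Injective.under (ModuleCat.of A M) : ModuleCat.{u} A),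
      (Injective.under (ModuleCat.of A M) : ModuleCat.{u} A).isAddCommGroup,
      (Injective.under (ModuleCat.of A M) : ModuleCat.{u} A).isModule,
      inferInstanceAs (Injective (Injective.under (ModuleCat.of A M))),
      (Injective.ι (ModuleCat.of A M)).hom, (ModuleCat.mono_iff_injective _).1 inferInstance⟩
  let J := I ⧸ LinearMap.range i
  let π : I →ₗ[A] J := (LinearMap.range i).mkQ
  have hπ : Function.Surjective π := Submodule.mkQ_surjective _
  have hπ0 : ∀ a, π a = 0 ↔ ∃ m, i m = a := fun a => Submodule.Quotient.mk_eq_zero _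
  have hJ : Injective (ModuleCat.of A J) := injective_quot hA π hπ
  obtain ⟨RI, εI, hRI, huI⟩ := exists_coreflection W I
  obtain ⟨RJ, εJ, hRJ, huJ⟩ := exists_coreflection W J
  obtain ⟨lam, hlam, -⟩ := huJ RI hRI (π ∘ₗ εI)
  have hlam' : ∀ x, εJ (lam x) = π (εI x) := fun q => LinearMap.congr_fun hlam q
  let δ : I × RJ →ₗ[A] J := π.coprod (-εJ)
  have hδ : ∀ a r, δ (a, r) = π a - εJ r := fun a r => by simp [δ, sub_eq_add_neg]
  have hδs : Function.Surjective δ := fun j => by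
    obtain ⟨a, rfl⟩ := hπ j
    exact ⟨(a, 0), by simp [hδ]⟩
  let E := LinearMap.ker δ
  have hE : ∀ a r, (a, r) ∈ E ↔ π a = εJ r := fun a r => by
    rw [LinearMap.mem_ker, hδ, sub_eq_zero]
  let f : RI →ₗ[A] E := (εI.prod lam).codRestrict E (fun x => (hE _ _).2 (hlam' x).symm)
  have hf : ∀ x, (f x : I × RJ) = (εI x, lam x) := fun x => rfl
  have hE1I : ∀ Y : ModuleCat.{u} A, Y ∈ 𝒴 → E1 A Y RI := E1_coreflection W RI εI hRI huI
  have hE1J : ∀ Y : ModuleCat.{u} A, Y ∈ 𝒴 → E1 A Y RJ := E1_coreflection W RJ εJ hRJ huJ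
  have hE1E : ∀ Y : ModuleCat.{u} A, Y ∈ 𝒴 → E1 A Y E := by
    intro Y hY
    refine E1.first_right E.subtype δ E.subtype_injective hδs (LinearMap.exact_subtype_ker_map δ) Y
      (E1.mid_right (LinearMap.inl A I RJ) (LinearMap.snd A I RJ) LinearMap.inl_injective
        LinearMap.snd_surjective (Function.Exact.inl_snd) Y
        (E1.of_injective _ _) (hE1J Y hY)) fun k => ?_
    obtain ⟨g, hg, -⟩ := huJ Y hY k
    refine ⟨LinearMap.inr A I RJ ∘ₗ (-g), ?_⟩
    refine LinearMap.ext fun y => ?_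
    have h1 : εJ (g y) = k y := LinearMap.congr_fun hg y
    change δ (0, -g y) = k y
    rw [hδ, map_zero, map_neg, h1, zero_sub, neg_neg]
  have hu : ∀ Y : ModuleCat.{u} A, Y ∈ 𝒴 → ∀ k : Y →ₗ[A] E, ∃! g : Y →ₗ[A] RI, f ∘ₗ g = k := by
    intro Y hY k
    refine existsUnique_of_exists_of_unique ?_ ?_
    · obtain ⟨g, hg, -⟩ := huI Y hY (LinearMap.fst A I RJ ∘ₗ E.subtype ∘ₗ k)
      have hg' : ∀ y, εI (g y) = (k y).1.1 := fun y => LinearMap.congr_fun hg y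
      have h2 : lam ∘ₗ g = LinearMap.snd A I RJ ∘ₗ E.subtype ∘ₗ k := by
        refine (huJ Y hY (εJ ∘ₗ lam ∘ₗ g)).unique rfl ?_
        refine LinearMap.ext fun y => ?_
        change εJ (k y).1.2 = εJ (lam (g y))
        rw [hlam', hg']
        exact ((hE _ _).1 (k y).2).symm
      refine ⟨g, ?_⟩
      refine LinearMap.ext fun y => Subtype.ext ?_
      exact Prod.ext (hg' y) (LinearMap.congr_fun h2 y)
    · intro g₁ g₂ h₁ h₂
      refine (huI Y hY (εI ∘ₗ g₂)).unique ?_ rfl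
      refine LinearMap.ext fun y => ?_
      have := LinearMap.congr_fun (h₁.trans h₂.symm) y
      exact congrArg (fun e : E => e.1.1) this
  have horth := orth_right hA f hE1E hE1I hu
  let f₁ : LinearMap.ker f →ₗ[A] LinearMap.ker lam :=
    (LinearMap.ker f).subtype.codRestrict _ (fun x =>
      congrArg (fun e : E => e.1.2) (LinearMap.mem_ker.1 x.2))
  have hf₁ : ∀ x, (f₁ x : RI) = x.1 := fun x => rfl
  let ei := LinearEquiv.ofInjective i hi
  let f₂ : LinearMap.ker lam →ₗ[A] M := ei.symm.toLinearMap ∘ₗ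
    (εI ∘ₗ (LinearMap.ker lam).subtype).codRestrict (LinearMap.range i) (fun x => by
      have h := x.2
      rw [LinearMap.mem_ker] at h
      refine (hπ0 _).1 ?_
      change π (εI x.1) = 0
      rw [← hlam', h, map_zero])
  have hf₂ : ∀ x, i (f₂ x) = εI x.1 := fun x =>
    congrArg Subtype.val (ei.apply_symm_apply ((εI ∘ₗ (LinearMap.ker lam).subtype).codRestrict
      (LinearMap.range i) _ x))
  let j : M →ₗ[A] E := (LinearMap.inl A I RJ ∘ₗ i).codRestrict E (fun m =>
    (hE _ _).2 (((hπ0 (i m)).2 ⟨m, rfl⟩).trans (map_zero εJ).symm))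
  have hj : ∀ m, (j m : I × RJ) = (i m, 0) := fun m => rfl
  let f₄ : (E ⧸ LinearMap.range f) →ₗ[A] (RJ ⧸ LinearMap.range lam) :=
    (LinearMap.range f).liftQ ((LinearMap.range lam).mkQ ∘ₗ LinearMap.snd A I RJ ∘ₗ E.subtype) (by
      rintro _ ⟨x, rfl⟩
      exact (Submodule.Quotient.mk_eq_zero _).2 ⟨x, rfl⟩)
  refine fiveTerm_mk _ _ (V₁ := LinearMap.ker f) (U₁ := LinearMap.ker lam) f₁ f₂
    ((LinearMap.range f).mkQ ∘ₗ j) f₄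
    (W.ker lam hRI hRJ) (W.coker lam hRI hRJ)
    (fun Y hY n => (horth Y hY n).1) (fun Y hY n => (horth Y hY n).2)
    ?_ ?_ ?_ ?_ ?_
  · intro a b h
    have h' : (f₁ a : RI) = f₁ b := congrArg Subtype.val h
    exact Subtype.ext h'
  · intro x
    constructor
    · intro hx
      have h1 : εI x.1 = 0 := by rw [← hf₂, hx, map_zero]
      refine ⟨⟨x.1, ?_⟩, rfl⟩
      rw [LinearMap.mem_ker]
      refine Subtype.ext ?_
      rw [hf, h1, LinearMap.mem_ker.1 x.2]
      rfl
    · rintro ⟨y, rfl⟩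
      refine hi ?_
      rw [hf₂, map_zero, hf₁]
      exact congrArg (fun e : E => e.1.1) (LinearMap.mem_ker.1 y.2)
  · intro m
    change (LinearMap.range f).mkQ (j m) = 0 ↔ _
    rw [← LinearMap.mem_ker, Submodule.ker_mkQ]
    constructor
    · rintro ⟨x, hx⟩
      have h1 : εI x = i m := congrArg (fun e : E => e.1.1) hx
      have h2 : lam x = 0 := congrArg (fun e : E => e.1.2) hx
      exact ⟨⟨x, h2⟩, hi (by rw [hf₂, h1])⟩
    · rintro ⟨x, rfl⟩
      refine ⟨x.1, Subtype.ext ?_⟩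
      rw [hf, hj, hf₂, LinearMap.mem_ker.1 x.2]
  · intro x
    obtain ⟨⟨⟨a, r⟩, har⟩, rfl⟩ := Submodule.mkQ_surjective _ x
    change (LinearMap.range lam).mkQ r = 0 ↔ _
    rw [← LinearMap.mem_ker, Submodule.ker_mkQ]
    constructor
    · rintro ⟨x, rfl⟩
      have h1 : π (a - εI x) = 0 := by
        rw [map_sub, (hE _ _).1 har, hlam', sub_self]
      obtain ⟨m, hm⟩ := (hπ0 _).1 h1
      refine ⟨m, (Submodule.Quotient.eq _).2 ⟨-x, Subtype.ext ?_⟩⟩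
      rw [hf, Submodule.coe_sub, hj, hm]
      simp
    · rintro ⟨m, hm⟩
      obtain ⟨x, hx⟩ := (Submodule.Quotient.eq _).1 hm
      have h2 : lam x = 0 - r := congrArg (fun e : E => e.1.2) hx
      exact ⟨-x, by rw [map_neg, h2]; simp⟩
  · intro x
    obtain ⟨r, rfl⟩ := Submodule.mkQ_surjective _ x
    obtain ⟨a, ha⟩ := hπ (εJ r)
    exact ⟨(LinearMap.range f).mkQ ⟨(a, r), (hE _ _).2 ha⟩, rfl⟩

end Final

end ExtOrth

/-- For a hereditary ring `A` and an extension closed abelian subcategory `𝒴`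
of `Mod A` closed under products and coproducts, with `𝒳 = ^⊥𝒴` and `𝒵 = 𝒴^⊥`, every module
`M` admits five-term exact sequences `0 → Y₁ → X₁ → M → Y₂ → X₂ → 0` and
`0 → Z₁ → Y₁' → M → Z₂ → Y₂' → 0`. -/
theorem complete_ext_orthogonal_pairs_of_bireflective_subcategory
    {A : Type u} [Ring A] [HasExt.{u} (ModuleCat.{u} A)]
    (hA : IsHereditaryRing A)
    (𝒴 : Set (ModuleCat.{u} A))
    (h_iso : ∀ (X Y : ModuleCat.{u} A), X ∈ 𝒴 → (X ≅ Y) → Y ∈ 𝒴)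
    (h_ker : ∀ {X Y : ModuleCat.{u} A} (g : X ⟶ Y), X ∈ 𝒴 → Y ∈ 𝒴 → kernel g ∈ 𝒴)
    (h_coker : ∀ {X Y : ModuleCat.{u} A} (g : X ⟶ Y), X ∈ 𝒴 → Y ∈ 𝒴 → cokernel g ∈ 𝒴)
    (h_ext : ∀ (E : ShortComplex (ModuleCat.{u} A)), E.ShortExact →
      E.X₁ ∈ 𝒴 → E.X₃ ∈ 𝒴 → E.X₂ ∈ 𝒴)
    (h_prod : ∀ (ι : Type u) (g : ι → ModuleCat.{u} A), (∀ i, g i ∈ 𝒴) → (∏ᶜ g) ∈ 𝒴)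
    (h_coprod : ∀ (ι : Type u) (g : ι → ModuleCat.{u} A), (∀ i, g i ∈ 𝒴) → (∐ g) ∈ 𝒴)
    (𝒳 : Set (ModuleCat.{u} A))
    (h𝒳 : 𝒳 = {X | ∀ Y ∈ 𝒴, ∀ n : ℕ, Subsingleton (Abelian.Ext X Y n)})
    (𝒵 : Set (ModuleCat.{u} A))
    (h𝒵 : 𝒵 = {Z | ∀ Y ∈ 𝒴, ∀ n : ℕ, Subsingleton (Abelian.Ext Y Z n)}) :
    ∀ M : ModuleCat.{u} A,
      FiveTermSequence 𝒳 𝒴 M ∧ FiveTermSequence 𝒴 𝒵 M := by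
  intro M
  have W := ExtOrth.wide_mk 𝒴 h_iso h_ker h_coker h_ext h_prod h_coprod
  subst h𝒳 h𝒵
  exact ⟨ExtOrth.fiveTerm_left hA W M, ExtOrth.fiveTerm_right hA W M⟩
end
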